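/- arXiv:1205.5985 — 2 statements merged into one kernel-verified Lean document; each statement's English description precedes it below -/
import Mathlib

section
/- Let (R,m) be a Noetherian local ring, let a be an ideal of R, and let M be a finitely generated R-module which is relative Cohen-Macaulay with respect to a with cd(a,M) = n. Then Supp H_a^n(M) = Supp(M/aM) and ht_M(a) = grade(a,M), where ht_M(a) = inf{ dim_{R_p} M_p : p ∈ Supp(M/aM) }. -/
/-!
Common definitions: semidualizing modules, `C`-injective modules and dimensions,
`G_C`-injective modules, Bass/Auslander classes, relative Cohen-Macaulayness,
Cohen-Macaulay and Gorenstein local rings, trivial extensions, ideal torsion.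
-/

noncomputable section

open CategoryTheory TensorProduct

universe u

variable (R : Type u) [CommRing R]

/-- An `R`-module `M` is `C`-injective if it is isomorphic to `Hom_R(C, I)`
for some injective `R`-module `I`. -/
def IsCInjective (C M : ModuleCat.{u} R) : Prop :=
  ∃ I : ModuleCat.{u} R, Module.Injective R I ∧ Nonempty (M ≃ₗ[R] (C →ₗ[R] I))

/-- `HasCoresDimLE R P n M` : the module `M` admits a coresolution of length at most `n`
by modules satisfying the property `P`. -/
def HasCoresDimLE (P : ModuleCat.{u} R → Prop) : ℕ → ModuleCat.{u} R → Prop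
  | 0, M => Subsingleton M ∨ P M
  | n + 1, M => Subsingleton M ∨ ∃ (X : ModuleCat.{u} R) (f : M →ₗ[R] X),
      P X ∧ Function.Injective f ∧
        HasCoresDimLE P n (ModuleCat.of R (X ⧸ LinearMap.range f))

/-- The coresolution dimension of `M` with respect to the class of modules satisfying `P`,
as an element of `ℕ∞` (`⊤` meaning no finite coresolution exists). -/
def coresDim (P : ModuleCat.{u} R → Prop) (M : ModuleCat.{u} R) : ℕ∞ :=
  sInf {d : ℕ∞ | ∃ n : ℕ, d = n ∧ HasCoresDimLE R P n M}

/-- The `C`-injective dimension of `M`. -/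
def cinjDim (C M : ModuleCat.{u} R) : ℕ∞ :=
  coresDim R (IsCInjective R C) M

/-- The injective dimension of `M`. -/
def injDim (M : ModuleCat.{u} R) : ℕ∞ :=
  coresDim R (fun N => Module.Injective R N) M

/-- A finitely generated `R`-module `C` is semidualizing if the natural map
`R → Hom_R(C,C)` is bijective and `Ext_R^i(C,C) = 0` for all `i ≥ 1`. -/
def IsSemidualizing (C : ModuleCat.{u} R) : Prop :=
  Module.Finite R C ∧ Function.Bijective (LinearMap.lsmul R C) ∧
    ∀ i : ℕ, 1 ≤ i →
      Subsingleton (((Ext R (ModuleCat.{u} R) i).obj (Opposite.op C)).obj C)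

/-- A dualizing module is a semidualizing module of finite injective dimension. -/
def IsDualizing (C : ModuleCat.{u} R) : Prop :=
  IsSemidualizing R C ∧ injDim R C ≠ ⊤

/-- A complete `I_C I`-resolution: an exact complex `Y` (with `d i : Y (i+1) → Y i`)
which stays exact after applying `Hom_R(I, -)` for every `C`-injective `I`, whose terms
in positive degrees are `C`-injective and whose terms in degrees `≤ 0` are injective. -/
structure CompleteICIResolution (C : ModuleCat.{u} R) where
  Y : ℤ → ModuleCat.{u} R
  d : (i : ℤ) → (Y (i + 1) →ₗ[R] Y i)
  exact : ∀ i : ℤ, Function.Exact (d (i + 1)) (d i)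
  cinj_pos : ∀ i : ℤ, 0 < i → IsCInjective R C (Y i)
  inj_nonpos : ∀ i : ℤ, i ≤ 0 → Module.Injective R (Y i)
  homExact : ∀ I : ModuleCat.{u} R, IsCInjective R C I → ∀ i : ℤ,
    Function.Exact (fun f : I →ₗ[R] Y (i + 1 + 1) => (d (i + 1)).comp f)
      (fun f : I →ₗ[R] Y (i + 1) => (d i).comp f)

/-- A module is `G_C`-injective if it is the kernel of the degree-`0` differential of some
complete `I_C I`-resolution. -/
def IsGCInjective (C M : ModuleCat.{u} R) : Prop :=
  ∃ res : CompleteICIResolution R C,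
    Nonempty (M ≃ₗ[R] ↥(LinearMap.ker (res.d (-1))))

/-- The `G_C`-injective dimension of `M`. -/
def gcinjDim (C M : ModuleCat.{u} R) : ℕ∞ :=
  coresDim R (IsGCInjective R C) M

/-- `M` is relative Cohen-Macaulay with respect to `a`: there is exactly one
non-vanishing local cohomology module of `M` with respect to `a`. -/
def IsRelativeCM (a : Ideal R) (M : ModuleCat.{u} R) : Prop :=
  ∃! n : ℕ, Nontrivial ((localCohomology a n).obj M)

/-- `M` is relative Cohen-Macaulay with respect to `a`, with (unique) non-vanishing
local cohomology in degree `n`. -/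
def IsRelativeCMAt (a : Ideal R) (n : ℕ) (M : ModuleCat.{u} R) : Prop :=
  Nontrivial ((localCohomology a n).obj M) ∧
    ∀ i : ℕ, i ≠ n → Subsingleton ((localCohomology a i).obj M)

/-- The cohomological dimension `cd(a, M)`: the largest `i` with `H_a^i(M) ≠ 0`. -/
def lcCohomDim (a : Ideal R) (M : ModuleCat.{u} R) : ℕ :=
  sSup {i : ℕ | Nontrivial ((localCohomology a i).obj M)}

/-- The grade `grade(a, M)`: the least `i` with `H_a^i(M) ≠ 0`. -/
def lcGrade (a : Ideal R) (M : ModuleCat.{u} R) : ℕ :=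
  sInf {i : ℕ | Nontrivial ((localCohomology a i).obj M)}

/-- A Noetherian local ring is Cohen-Macaulay iff `H_m^i(R) = 0` for all `i ≠ dim R`
(Grothendieck's characterization, taken here as the definition). -/
def IsCohenMacaulayLocalRing (S : Type u) [CommRing S] [IsLocalRing S] : Prop :=
  ∀ i : ℕ, (i : WithBot ℕ∞) ≠ ringKrullDim S →
    Subsingleton ((localCohomology (IsLocalRing.maximalIdeal S) i).obj (ModuleCat.of S S))

/-- A local ring is Gorenstein if it has finite injective dimension over itself. -/
def IsGorensteinLocalRing (S : Type u) [CommRing S] : Prop :=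
  injDim S (ModuleCat.of S S) ≠ ⊤

/-- The `a`-torsion submodule `Γ_a(M)` of `M`. -/
def idealTorsion (a : Ideal R) (M : Type u) [AddCommGroup M] [Module R M] :
    Submodule R M :=
  ⨆ n : ℕ, Submodule.torsionBySet R M ((a ^ n : Ideal R) : Set R)

/-- The Krull dimension of a module, `dim_S N = dim (S / ann_S N)`. -/
def moduleKrullDim (S : Type u) [CommRing S] (N : Type u) [AddCommGroup N] [Module S N] :
    WithBot ℕ∞ :=
  ringKrullDim (S ⧸ Module.annihilator S N)

/-- `ht_M(a) = inf { dim_{R_p} M_p  |  p ∈ Supp (M / a M) }`. -/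
def heightWRT (a : Ideal R) (M : Type u) [AddCommGroup M] [Module R M] : WithBot ℕ∞ :=
  ⨅ (p : PrimeSpectrum R) (_ : p ∈ Module.support R (M ⧸ (a • (⊤ : Submodule R M)))),
    moduleKrullDim (Localization.AtPrime p.asIdeal) (LocalizedModule p.asIdeal.primeCompl M)

/-- Membership in the Bass class `B_C(R)`. -/
def MemBassClass (C M : ModuleCat.{u} R) : Prop :=
  (∀ i : ℕ, 1 ≤ i →
      Subsingleton (((Ext R (ModuleCat.{u} R) i).obj (Opposite.op C)).obj M)) ∧
  (∀ i : ℕ, 1 ≤ i →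
      Subsingleton (((Tor (ModuleCat.{u} R) i).obj C).obj (ModuleCat.of R (C →ₗ[R] M)))) ∧
  Function.Bijective
    (TensorProduct.lift ((LinearMap.id : (C →ₗ[R] M) →ₗ[R] (C →ₗ[R] M)).flip))

/-- Membership in the Auslander class `A_C(R)`. -/
def MemAuslanderClass (C M : ModuleCat.{u} R) : Prop :=
  (∀ i : ℕ, 1 ≤ i →
      Subsingleton (((Tor (ModuleCat.{u} R) i).obj C).obj M)) ∧
  (∀ i : ℕ, 1 ≤ i →
      Subsingleton (((Ext R (ModuleCat.{u} R) i).obj (Opposite.op C)).obj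
        (ModuleCat.of R (↥C ⊗[R] ↥M)))) ∧
  Function.Bijective ((TensorProduct.mk R ↥C ↥M).flip)

/-- `HasResDimLE R P n M` : `M` admits a resolution of length at most `n`
by modules satisfying `P`. -/
def HasResDimLE (P : ModuleCat.{u} R → Prop) : ℕ → ModuleCat.{u} R → Prop
  | 0, M => Subsingleton M ∨ P M
  | n + 1, M => Subsingleton M ∨ ∃ (X : ModuleCat.{u} R) (f : X →ₗ[R] M),
      P X ∧ Function.Surjective f ∧
        HasResDimLE P n (ModuleCat.of R ↥(LinearMap.ker f))

/-- The projective dimension of `M`. -/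
def projDim (M : ModuleCat.{u} R) : ℕ∞ :=
  sInf {d : ℕ∞ | ∃ n : ℕ, d = n ∧ HasResDimLE R (fun N => Module.Projective R N) n M}

/-- The first projection of the trivial extension `R ⋉ C`, as a ring homomorphism. -/
def trivExtFst (C : Type u) [AddCommGroup C] [Module R C] [Module Rᵐᵒᵖ C]
    [IsCentralScalar R C] : TrivSqZeroExt R C →+* R where
  toFun := TrivSqZeroExt.fst
  map_one' := TrivSqZeroExt.fst_one (R := R) (M := C)
  map_mul' := TrivSqZeroExt.fst_mul
  map_zero' := TrivSqZeroExt.fst_zero (R := R) (M := C)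
  map_add' := TrivSqZeroExt.fst_add

/-- The ideal `a ⊕ C` of the trivial extension `R ⋉ C`. -/
def trivExtIdeal (a : Ideal R) (C : Type u) [AddCommGroup C] [Module R C] [Module Rᵐᵒᵖ C]
    [IsCentralScalar R C] : Ideal (TrivSqZeroExt R C) :=
  Ideal.comap (trivExtFst R C) a

/-- An `R`-module `M`, viewed as a module over the trivial extension `R ⋉ C` via the
natural surjection `R ⋉ C → R`. -/
def trivExtModuleCat (C : Type u) [AddCommGroup C] [Module R C] [Module Rᵐᵒᵖ C]
    [IsCentralScalar R C] (M : Type u) [AddCommGroup M] [Module R M] :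
    ModuleCat.{u} (TrivSqZeroExt R C) :=
  letI := Module.compHom M (trivExtFst R C)
  ModuleCat.of (TrivSqZeroExt R C) M

end

noncomputable section

open CategoryTheory Limits Abelian

universe u

namespace CategoryTheory.ProjectiveResolution

variable {R : Type u} [CommRing R] {X X' : ModuleCat.{u} R}

/-- The complex in the opposite category computing `Ext(X, Y)`. -/
abbrev homOp (P : ProjectiveResolution X) (Y : ModuleCat.{u} R) :
    ChainComplex (ModuleCat.{u} R)ᵒᵖ ℕ :=
  (((linearYoneda R (ModuleCat.{u} R)).obj Y).rightOp.mapHomologicalComplex _).obj P.complex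

/-- The cocycle `f` represents the element `z` of `Ext(X, Y)`. -/
def Represents (P : ProjectiveResolution X) {Y : ModuleCat.{u} R} {n : ℕ}
    (z : ((Ext R (ModuleCat.{u} R) n).obj (Opposite.op X)).obj Y) (f : P.complex.X n ⟶ Y) : Prop :=
  ∃ c : ((P.homOp Y).opcycles n).unop,
    (ConcreteCategory.hom ((P.homOp Y).pOpcycles n).unop) c = f ∧
    (ConcreteCategory.hom ((P.homOp Y).homologyι n).unop) c =
      (ConcreteCategory.hom (P.isoLeftDerivedObj
        ((linearYoneda R (ModuleCat.{u} R)).obj Y).rightOp n).inv.unop) z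

variable (P : ProjectiveResolution X) {Y : ModuleCat.{u} R} {n : ℕ}

lemma Represents.cocycle {P : ProjectiveResolution X}
    {z : ((Ext R (ModuleCat.{u} R) n).obj (Opposite.op X)).obj Y} {f : P.complex.X n ⟶ Y}
    (h : P.Represents z f) (m : ℕ) : P.complex.d m n ≫ f = 0 := by
  obtain ⟨c, rfl, -⟩ := h
  have := congrArg Quiver.Hom.unop ((P.homOp Y).d_pOpcycles m n)
  exact ConcreteCategory.congr_hom this c

lemma exists_represents (z : ((Ext R (ModuleCat.{u} R) n).obj (Opposite.op X)).obj Y) :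
    ∃ f, P.Represents z f := by
  have : Function.Surjective (ConcreteCategory.hom ((P.homOp Y).homologyι n).unop) :=
    (ModuleCat.epi_iff_surjective _).1 inferInstance
  obtain ⟨c, hc⟩ := this ((ConcreteCategory.hom (P.isoLeftDerivedObj
        ((linearYoneda R (ModuleCat.{u} R)).obj Y).rightOp n).inv.unop) z)
  exact ⟨_, c, rfl, hc⟩

lemma exists_represents_of_cocycle (f : P.complex.X n ⟶ Y) (m : ℕ) (hm : n + 1 = m)
    (hf : P.complex.d m n ≫ f = 0) :
    ∃ z : ((Ext R (ModuleCat.{u} R) n).obj (Opposite.op X)).obj Y, P.Represents z f := by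
  have h := (ShortComplex.exact_of_g_is_cokernel (ShortComplex.mk _ _
    ((P.homOp Y).d_pOpcycles m n)) ((P.homOp Y).opcyclesIsCokernel m n (by simp [hm]))).unop
  rw [ShortComplex.moduleCat_exact_iff] at h
  obtain ⟨c, hc⟩ := h f hf
  refine ⟨(ConcreteCategory.hom (P.isoLeftDerivedObj
        ((linearYoneda R (ModuleCat.{u} R)).obj Y).rightOp n).hom.unop)
        ((ConcreteCategory.hom ((P.homOp Y).homologyι n).unop) c), c, hc, ?_⟩
  have := congrArg Quiver.Hom.unop (P.isoLeftDerivedObj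
        ((linearYoneda R (ModuleCat.{u} R)).obj Y).rightOp n).inv_hom_id
  exact (ConcreteCategory.congr_hom this _).symm

lemma Represents.smul {P : ProjectiveResolution X}
    {z : ((Ext R (ModuleCat.{u} R) n).obj (Opposite.op X)).obj Y} {f : P.complex.X n ⟶ Y}
    (h : P.Represents z f) (r : R) : P.Represents (r • z) (r • f) := by
  obtain ⟨c, rfl, hc⟩ := h
  refine ⟨r • c, ?_, ?_⟩
  · exact map_smul (ConcreteCategory.hom ((P.homOp Y).pOpcycles n).unop) r c
  · have h1 := map_smul (ConcreteCategory.hom ((P.homOp Y).homologyι n).unop) r c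
    have h2 := map_smul (ConcreteCategory.hom (P.isoLeftDerivedObj
        ((linearYoneda R (ModuleCat.{u} R)).obj Y).rightOp n).inv.unop) r z
    exact h1.trans ((congrArg (r • ·) hc).trans h2.symm)

lemma Represents.map {P : ProjectiveResolution X}
    {z : ((Ext R (ModuleCat.{u} R) n).obj (Opposite.op X)).obj Y} {f : P.complex.X n ⟶ Y}
    (h : P.Represents z f) {P' : ProjectiveResolution X'} {g : X' ⟶ X} (φ : Hom P' P g) :
    P'.Represents ((ConcreteCategory.hom (((Ext R (ModuleCat.{u} R) n).map g.op).app Y)) z)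
      (φ.hom.f n ≫ f) := by
  obtain ⟨c, rfl, hc⟩ := h
  let F := ((linearYoneda R (ModuleCat.{u} R)).obj Y).rightOp
  let ψ : P'.homOp Y ⟶ P.homOp Y := (F.mapHomologicalComplex _).map φ.hom
  have comm : φ.hom.f 0 ≫ P.π.f 0 = P'.π.f 0 ≫ g := by
    simpa using φ.hom_f_zero_comp_π_f_zero
  refine ⟨(ConcreteCategory.hom (HomologicalComplex.opcyclesMap ψ n).unop) c, ?_, ?_⟩
  · exact ConcreteCategory.congr_hom
      (congrArg Quiver.Hom.unop (HomologicalComplex.p_opcyclesMap ψ n)) c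
  · have h1 := ConcreteCategory.congr_hom
      (congrArg Quiver.Hom.unop (HomologicalComplex.homologyι_naturality ψ n)) c
    have h2 := ConcreteCategory.congr_hom
      (congrArg Quiver.Hom.unop (isoLeftDerivedObj_inv_naturality g P' P φ.hom comm F n)) z
    refine h1.symm.trans (.trans ?_ h2.symm)
    exact congrArg (ConcreteCategory.hom (HomologicalComplex.homologyMap ψ n).unop) hc

lemma Represents.eq_zero_iff {P : ProjectiveResolution X}
    {z : ((Ext R (ModuleCat.{u} R) n).obj (Opposite.op X)).obj Y} {f : P.complex.X n ⟶ Y}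
    (h : P.Represents z f) (p : ℕ) (hp : (ComplexShape.down ℕ).next n = p) :
    z = 0 ↔ ∃ g : P.complex.X p ⟶ Y, P.complex.d n p ≫ g = f := by
  obtain ⟨c, rfl, hc⟩ := h
  have h1 := (ShortComplex.exact_of_f_is_kernel (ShortComplex.mk _ _
    ((P.homOp Y).homologyι_comp_fromOpcycles n p)) ((P.homOp Y).homologyIsKernel n p hp)).unop
  rw [ShortComplex.moduleCat_exact_iff] at h1
  have hinj : Function.Injective (ConcreteCategory.hom ((P.homOp Y).pOpcycles n).unop) :=
    (ModuleCat.mono_iff_injective _).1 inferInstance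
  have hinj' : Function.Injective (ConcreteCategory.hom (P.isoLeftDerivedObj
        ((linearYoneda R (ModuleCat.{u} R)).obj Y).rightOp n).inv.unop) :=
    (ModuleCat.mono_iff_injective _).1 inferInstance
  have hfac (g : P.complex.X p ⟶ Y) := ConcreteCategory.congr_hom
    (congrArg Quiver.Hom.unop ((P.homOp Y).p_fromOpcycles n p)) g
  constructor
  · rintro rfl
    obtain ⟨g, hg⟩ := h1 c (hc.trans (map_zero _))
    exact ⟨g, (hfac g).symm.trans (congrArg _ hg)⟩
  · rintro ⟨g, hg⟩
    have hgc : (ConcreteCategory.hom ((P.homOp Y).fromOpcycles n p).unop) g = c :=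
      hinj ((hfac g).trans hg)
    apply hinj'
    refine hc.symm.trans (.trans ?_ (map_zero _).symm)
    rw [← hgc]
    exact ConcreteCategory.congr_hom
      (congrArg Quiver.Hom.unop ((P.homOp Y).homologyι_comp_fromOpcycles n p)) g

lemma extMk_eq_zero_iff_of_next (f : P.complex.X n ⟶ Y) (m : ℕ) (hm : n + 1 = m)
    (hf : P.complex.d m n ≫ f = 0) (p : ℕ) (hp : (ComplexShape.down ℕ).next n = p) :
    P.extMk f m hm hf = 0 ↔ ∃ g : P.complex.X p ⟶ Y, P.complex.d n p ≫ g = f := by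
  cases n with
  | succ n =>
    obtain rfl : n = p := by simpa using hp
    exact P.extMk_eq_zero_iff f m hm hf _ rfl
  | zero =>
    have hd : P.complex.d 0 p = 0 := P.complex.shape _ _ (by simp)
    have h0 : IsZero (P.cochainComplex.X 1) := P.cochainComplex.isZero_of_isStrictlyLE 0 1
    have hd' : P.cochainComplex.d (-((0 : ℕ) : ℤ)) 1 = 0 := h0.eq_of_tgt _ _
    simp only [hd, zero_comp, ← P.extEquivCohomologyClass.apply_eq_iff_eq,
      extEquivCohomologyClass_extMk, extEquivCohomologyClass_zero,
      CochainComplex.HomComplex.CohomologyClass.mk_eq_zero_iff]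
    rw [CochainComplex.HomComplex.Cocycle.toSingleMk_mem_coboundaries_iff _ _ _ _ _ 1 (by simp),
      hd']
    simp only [zero_comp]
    refine ⟨fun ⟨_, h⟩ ↦ ⟨0, ?_⟩, fun ⟨_, h⟩ ↦ ⟨0, by simp [← h]⟩⟩
    rw [← cancel_epi (P.cochainComplexXIso (-((0 : ℕ) : ℤ)) 0 rfl).hom, ← h, comp_zero]

/-- The class `z` in `CategoryTheory.Ext` and the class `e` in `CategoryTheory.Abelian.Ext`
are represented by the same cocycle. -/
def SameClass (z : ((Ext R (ModuleCat.{u} R) n).obj (Opposite.op X)).obj Y)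
    (e : Abelian.Ext X Y n) : Prop :=
  ∃ (P : ProjectiveResolution X) (f : P.complex.X n ⟶ Y) (hf : P.complex.d (n + 1) n ≫ f = 0),
    P.Represents z f ∧ P.extMk f (n + 1) rfl hf = e

lemma exists_sameClass (z : ((Ext R (ModuleCat.{u} R) n).obj (Opposite.op X)).obj Y) :
    ∃ e, SameClass z e :=
  let ⟨f, h⟩ := (projectiveResolution X).exists_represents z
  ⟨_, _, f, h.cocycle _, h, rfl⟩

lemma exists_sameClass' (e : Abelian.Ext X Y n) :
    ∃ z : ((Ext R (ModuleCat.{u} R) n).obj (Opposite.op X)).obj Y, SameClass z e :=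
  let ⟨f, hf, h⟩ := (projectiveResolution X).extMk_surjective e (n + 1) rfl
  let ⟨z, hz⟩ := (projectiveResolution X).exists_represents_of_cocycle f _ rfl hf
  ⟨z, _, f, hf, hz, h⟩

namespace SameClass

variable {z : ((Ext R (ModuleCat.{u} R) n).obj (Opposite.op X)).obj Y} {e : Abelian.Ext X Y n}

lemma eq_zero_iff (h : SameClass z e) : z = 0 ↔ e = 0 := by
  obtain ⟨P, f, hf, h, rfl⟩ := h
  rw [h.eq_zero_iff _ rfl, P.extMk_eq_zero_iff_of_next _ _ _ _ _ rfl]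

lemma smul (h : SameClass z e) (r : R) : SameClass (r • z) (r • e) := by
  obtain ⟨P, f, hf, h, rfl⟩ := h
  refine ⟨P, _, (h.smul r).cocycle _, h.smul r, ?_⟩
  rw [Abelian.Ext.smul_eq_comp_mk₀, P.extMk_comp_mk₀]
  simp

lemma map (h : SameClass z e) (g : X' ⟶ X) :
    SameClass ((ConcreteCategory.hom (((Ext R (ModuleCat.{u} R) n).map g.op).app Y)) z)
      ((Abelian.Ext.mk₀ g).comp e (zero_add n)) := by
  obtain ⟨P, f, hf, h, rfl⟩ := h
  let P' := projectiveResolution X'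
  let φ : Hom P' P g := ⟨lift g P' P, by
    have := HomologicalComplex.congr_hom (lift_commutes g P' P) 0
    simpa only [HomologicalComplex.comp_f] using this⟩
  exact ⟨P', _, (h.map φ).cocycle _, h.map φ, (mk₀_comp_extMk f _ rfl hf φ).symm⟩

end SameClass

end CategoryTheory.ProjectiveResolution
end

noncomputable section

open CategoryTheory Limits Abelian

universe u

namespace localCohomology

variable {R : Type u} [CommRing R]

/-- The projection `R ⧸ a ^ s ⟶ R ⧸ a ^ t` for `t ≤ s`. -/
def powQuotient (a : Ideal R) {t s : ℕ} (h : t ≤ s) :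
    ModuleCat.of R (R ⧸ a ^ s) ⟶ ModuleCat.of R (R ⧸ a ^ t) :=
  ModuleCat.ofHom (Submodule.mapQ _ _ LinearMap.id (Ideal.pow_le_pow_right h))

lemma powQuotient_comp (a : Ideal R) {t s r : ℕ} (h : t ≤ s) (h' : s ≤ r) :
    powQuotient a h' ≫ powQuotient a h = powQuotient a (h.trans h') := by
  ext
  rfl

/-- Every class in the directed system `Ext^i(R ⧸ a ^ t, M)` is annihilated, after passing to a
larger exponent, by an element of `S`; equivalently `S⁻¹ H_a^i(M) = 0`. -/
def Vanishes (a : Ideal R) (S : Submonoid R) (M : ModuleCat.{u} R) (i : ℕ) : Prop :=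
  ∀ (t : ℕ) (e : Abelian.Ext (ModuleCat.of R (R ⧸ a ^ t)) M i),
    ∃ (s : ℕ) (h : t ≤ s), ∃ r ∈ S, r • (Ext.mk₀ (powQuotient a h)).comp e (zero_add i) = 0

lemma Vanishes.mono {a : Ideal R} {S T : Submonoid R} {M : ModuleCat.{u} R} {i : ℕ}
    (h : Vanishes a S M i) (hST : S ≤ T) : Vanishes a T M i := fun t e ↦
  let ⟨s, hs, r, hr, h0⟩ := h t e
  ⟨s, hs, r, hST hr, h0⟩

lemma vanishes_iff (a : Ideal R) (S : Submonoid R) (M : ModuleCat.{u} R) (i : ℕ) :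
    Vanishes a S M i ↔ ∀ z : (localCohomology a i).obj M, ∃ r ∈ S, r • z = 0 := by
  let D := diagram (idealPowersDiagram a) i
  let c := ((evaluation (ModuleCat.{u} R) (ModuleCat.{u} R)).obj M).mapCocone (colimit.cocone D)
  have : IsFiltered ℕᵒᵖᵒᵖ := IsFiltered.of_equivalence (opOpEquivalence ℕ).symm
  have : PreservesFilteredColimitsOfSize.{0, 0} (forget (ModuleCat.{u} R)) :=
    preservesFilteredColimitsOfSize_shrink.{0, u, 0, u} _
  have hc : IsColimit c := isColimitOfPreserves _ (colimit.isColimit D)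
  have hmap (t : ℕᵒᵖᵒᵖ) (z) : (ConcreteCategory.hom (c.ι.app t)) z = 0 ↔
      ∃ (s : ℕᵒᵖᵒᵖ) (f : t ⟶ s), (ConcreteCategory.hom ((D.map f).app M)) z = 0 := by
    have := Concrete.isColimit_rep_eq_iff_exists _ hc (i := t) (j := t) z 0
    rw [map_zero] at this
    refine this.trans ⟨fun ⟨s, f, g, h⟩ ↦ ⟨s, f, h.trans (map_zero _)⟩, fun ⟨s, f, h⟩ ↦
      ⟨s, f, f, h.trans (map_zero _).symm⟩⟩
  change _ ↔ ∀ z : c.pt, _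
  constructor
  · intro h z
    obtain ⟨t, z, rfl⟩ := Concrete.isColimit_exists_rep _ hc z
    obtain ⟨e, he⟩ := ProjectiveResolution.exists_sameClass z
    obtain ⟨s, hs, r, hr, h0⟩ := h t.unop.unop e
    refine ⟨r, hr, ?_⟩
    refine (map_smul (ConcreteCategory.hom (c.ι.app t)) r z).symm.trans ((hmap _ _).2 ?_)
    let f : t.unop.unop ⟶ s := homOfLE hs
    refine ⟨Opposite.op (Opposite.op s), f.op.op, ?_⟩
    exact (map_smul (ConcreteCategory.hom ((D.map f.op.op).app M)) r z).trans
      ((((he.map (powQuotient a hs)).smul r).eq_zero_iff).2 h0)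
  · intro h t e
    obtain ⟨z, he⟩ := ProjectiveResolution.exists_sameClass' e
    obtain ⟨z, rfl⟩ : ∃ z' : (D.obj (Opposite.op (Opposite.op t))).obj M, z' = z := ⟨z, rfl⟩
    obtain ⟨r, hr, h0⟩ := h ((ConcreteCategory.hom (c.ι.app (Opposite.op (Opposite.op t)))) z)
    obtain ⟨s, f, h0⟩ := (hmap _ _).1
      ((map_smul (ConcreteCategory.hom (c.ι.app (Opposite.op (Opposite.op t)))) r z).trans h0)
    have hs := leOfHom f.unop.unop
    refine ⟨s.unop.unop, hs, r, hr, ?_⟩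
    exact (((he.map (powQuotient a hs)).smul r).eq_zero_iff).1
      ((map_smul (ConcreteCategory.hom ((D.map f).app M)) r z).symm.trans h0)

lemma vanishes_bot_iff (a : Ideal R) (M : ModuleCat.{u} R) (i : ℕ) :
    Vanishes a ⊥ M i ↔ Subsingleton ((localCohomology a i).obj M) := by
  rw [vanishes_iff, subsingleton_iff_forall_eq (0 : (localCohomology a i).obj M)]
  refine forall_congr' fun z ↦ ⟨?_, fun h ↦ ⟨1, one_mem _, (one_smul R z).trans h⟩⟩
  rintro ⟨r, hr, h⟩
  rw [Submonoid.mem_bot] at hr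
  rw [← h, hr, one_smul]

lemma vanishes_primeCompl_iff (a : Ideal R) (p : PrimeSpectrum R) (M : ModuleCat.{u} R) (i : ℕ) :
    Vanishes a p.asIdeal.primeCompl M i ↔
      p ∉ Module.support R ((localCohomology a i).obj M) := by
  rw [vanishes_iff, Module.notMem_support_iff']
  rfl

end localCohomology
end

noncomputable section

open CategoryTheory Limits Abelian

universe u

namespace localCohomology

variable {R : Type u} [CommRing R] {a : Ideal R} {T : Submonoid R}

lemma Vanishes.of_shortExact {S : ShortComplex (ModuleCat.{u} R)} (hS : S.ShortExact) {i : ℕ}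
    (h₂ : Vanishes a T S.X₂ i) (h₁ : Vanishes a T S.X₁ (i + 1)) : Vanishes a T S.X₃ i := by
  intro t e
  obtain ⟨s, hs, r, hr, h⟩ := h₁ t (e.comp hS.extClass rfl)
  have h' : (r • (Ext.mk₀ (powQuotient a hs)).comp e (zero_add i)).comp hS.extClass rfl = 0 := by
    rw [Ext.smul_comp, Ext.comp_assoc _ _ _ (zero_add i) rfl (by lia), h]
  obtain ⟨x, hx⟩ := Ext.covariant_sequence_exact₃ _ hS _ rfl h'
  obtain ⟨s', hs', r', hr', h0⟩ := h₂ s x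
  refine ⟨s', hs.trans hs', r' * r, mul_mem hr' hr, ?_⟩
  have h0' := congrArg (fun y ↦ y.comp (Ext.mk₀ S.g) (add_zero i)) h0
  simp only [Ext.smul_comp, Ext.zero_comp] at h0'
  rw [Ext.comp_assoc _ _ _ (zero_add i) (add_zero i) (by lia), hx, Ext.comp_smul,
    ← Ext.comp_assoc _ _ _ (zero_add 0) (zero_add i) (by lia), Ext.mk₀_comp_mk₀,
    powQuotient_comp, smul_smul] at h0'
  exact h0'

lemma vanishes_zero_iff {M : Type u} [AddCommGroup M] [Module R M] :
    Vanishes a T (ModuleCat.of R M) 0 ↔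
      ∀ (t : ℕ) (x : M), (∀ b ∈ a ^ t, b • x = 0) → ∃ r ∈ T, r • x = 0 := by
  constructor
  · intro h t x hx
    let f : (R ⧸ a ^ t) →ₗ[R] M :=
      Submodule.liftQ (a ^ t) (LinearMap.toSpanSingleton R M x) hx
    obtain ⟨s, hs, r, hr, h0⟩ := h t (Ext.mk₀ (ModuleCat.ofHom f))
    refine ⟨r, hr, ?_⟩
    rw [Ext.mk₀_comp_mk₀, ← Ext.mk₀_smul, ← Ext.mk₀_zero] at h0
    have h1 := (Ext.mk₀_bijective _ _).1 h0
    have h2 := congrArg (fun φ ↦ ModuleCat.Hom.hom φ (Ideal.Quotient.mk _ 1)) h1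
    change r • f (Submodule.Quotient.mk 1) = 0 at h2
    change r • ((1 : R) • x) = 0 at h2
    rwa [one_smul] at h2
  · intro h t e
    obtain ⟨f, rfl⟩ := (Ext.mk₀_bijective _ _).2 e
    obtain ⟨r, hr, h0⟩ := h t (f.hom (Submodule.Quotient.mk (1 : R))) fun b hb ↦ by
      rw [← map_smul, ← Submodule.Quotient.mk_smul, smul_eq_mul, mul_one,
        (Submodule.Quotient.mk_eq_zero _).2 hb, map_zero]
    refine ⟨t, le_rfl, r, hr, ?_⟩
    rw [Ext.mk₀_comp_mk₀, ← Ext.mk₀_smul, ← Ext.mk₀_zero]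
    congr 1
    ext1
    refine Submodule.linearMap_qext _ (LinearMap.ext_ring ?_)
    exact h0

lemma mk₀_comp_eq_zero_of_forall_mem {X K : Type u} [AddCommGroup X] [Module R X]
    [AddCommGroup K] [Module R K] {Y : ModuleCat.{u} R} {j : ℕ} {N : Submodule R K}
    {e : Ext (ModuleCat.of R K) Y j}
    (h : (Ext.mk₀ (ModuleCat.ofHom N.subtype)).comp e (zero_add j) = 0)
    (γ : X →ₗ[R] K) (hγ : ∀ x, γ x ∈ N) :
    (Ext.mk₀ (ModuleCat.ofHom γ)).comp e (zero_add j) = 0 := by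
  have : ModuleCat.ofHom γ = ModuleCat.ofHom (γ.codRestrict N hγ) ≫
    ModuleCat.ofHom N.subtype := rfl
  rw [this, ← Ext.mk₀_comp_mk₀, Ext.comp_assoc _ _ _ (zero_add 0) (zero_add j) (by lia), h,
    Ext.comp_zero]

lemma mk₀_comp_extClass_comp_eq_zero {M N M' N' : Type u} [AddCommGroup M] [Module R M]
    [AddCommGroup N] [Module R N] [AddCommGroup M'] [Module R M'] [AddCommGroup N'] [Module R N']
    {f : M →ₗ[R] N} (hf : Function.Surjective f) {f' : M' →ₗ[R] N'} (hf' : Function.Surjective f')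
    (α : M' →ₗ[R] M) (β : N' →ₗ[R] N) (h : β ∘ₗ f' = f ∘ₗ α)
    {Y : ModuleCat.{u} R} {j k : ℕ} (hk : 1 + j = k) {e : Ext (ModuleCat.of R N) Y k}
    {g : Ext (ModuleCat.of R (LinearMap.ker f)) Y j}
    (he : (LinearMap.shortExact_shortComplexKer hf).extClass.comp g hk = e)
    {P : Submodule R (LinearMap.ker f)}
    (hP : (Ext.mk₀ (ModuleCat.ofHom P.subtype)).comp g (zero_add j) = 0)
    (hα : ∀ x, f' x = 0 → ∃ y ∈ P, (y : M) = α x) :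
    (Ext.mk₀ (ModuleCat.ofHom β)).comp e (zero_add k) = 0 := by
  have hα' : ∀ x : LinearMap.ker f', f (α x) = 0 := fun x ↦ by
    obtain ⟨y, -, hy⟩ := hα x x.2
    rw [← hy]
    exact y.2
  let γ : LinearMap.ker f' →ₗ[R] LinearMap.ker f :=
    LinearMap.codRestrict _ (α ∘ₗ Submodule.subtype _) hα'
  have hγ : ∀ x, γ x ∈ P := fun x ↦ by
    obtain ⟨y, hyP, hy⟩ := hα x x.2
    rwa [← Subtype.ext (a1 := y) (a2 := γ x) hy]
  have hg := mk₀_comp_eq_zero_of_forall_mem hP γ hγ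
  subst he
  let φ : f'.shortComplexKer ⟶ f.shortComplexKer :=
    { τ₁ := ModuleCat.ofHom γ
      τ₂ := ModuleCat.ofHom α
      τ₃ := ModuleCat.ofHom β
      comm₁₂ := by ext x; rfl
      comm₂₃ := by ext x; exact (LinearMap.congr_fun h x).symm }
  have := ShortComplex.ShortExact.extClass_naturality (LinearMap.shortExact_shortComplexKer hf')
    (LinearMap.shortExact_shortComplexKer hf) φ
  rw [← Ext.comp_assoc _ _ _ (zero_add 1) hk (by lia)]
  erw [← this]
  rw [Ext.comp_assoc _ _ _ (add_zero 1) (zero_add j) (by lia)]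
  erw [hg]
  rw [Ext.comp_zero]

section Noetherian

variable [IsNoetherianRing R]

lemma exists_mk₀_subtype_comp_eq_zero {G : Type u} [AddCommGroup G] [Module R G] {m : ℕ}
    (hG : ∀ b ∈ a ^ m, ∀ x : G, b • x = 0) (j : ℕ) :
    ∀ (K : Type u) [AddCommGroup K] [Module R K] [Module.Finite R K]
      (e : Ext (ModuleCat.of R K) (ModuleCat.of R G) j),
      ∃ s : ℕ, (Ext.mk₀ (ModuleCat.ofHom (a ^ s • ⊤ : Submodule R K).subtype)).comp e
        (zero_add j) = 0 := by
  induction j with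
  | zero =>
    intro K _ _ _ e
    obtain ⟨f, rfl⟩ := (Ext.mk₀_bijective _ _).2 e
    refine ⟨m, ?_⟩
    rw [Ext.mk₀_comp_mk₀, ← Ext.mk₀_zero]
    congr 1
    ext ⟨x, hx⟩
    change f.hom x = 0
    have : (a ^ m • ⊤ : Submodule R K) ≤ LinearMap.ker f.hom :=
      Submodule.smul_le.2 fun b hb y _ ↦ by
        rw [LinearMap.mem_ker, map_smul]
        exact hG b hb _
    exact this hx
  | succ j ih =>
    intro K _ _ _ e
    obtain ⟨k, π, hπ⟩ := Module.Finite.exists_fin' R K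
    have : Projective π.shortComplexKer.X₂ :=
      (IsProjective.iff_projective (Fin k → R)).1 inferInstance
    obtain ⟨g, hg⟩ := Ext.contravariant_sequence_exact₃
      (LinearMap.shortExact_shortComplexKer hπ) _ e (Ext.eq_zero_of_projective _) (add_comm 1 j)
    obtain ⟨s, hs⟩ := ih (LinearMap.ker π) g
    obtain ⟨c, hc⟩ := Ideal.exists_pow_inf_eq_pow_smul a (LinearMap.ker π)
    have hle : a ^ (c + s) • ⊤ ⊓ LinearMap.ker π ≤
        (a ^ s • ⊤ : Submodule R (LinearMap.ker π)).map (LinearMap.ker π).subtype := by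
      rw [hc _ (Nat.le_add_right _ _), Nat.add_sub_cancel_left, Submodule.map_smul'',
        Submodule.map_top, Submodule.range_subtype]
      exact Submodule.smul_mono le_rfl inf_le_right
    refine ⟨c + s, ?_⟩
    have hmem : ∀ x ∈ (a ^ (c + s) • ⊤ : Submodule R (Fin k → R)),
        π x ∈ (a ^ (c + s) • ⊤ : Submodule R K) := fun x hx ↦ by
      have := Submodule.mem_map_of_mem (f := π) hx
      rw [Submodule.map_smul''] at this
      exact Submodule.smul_mono le_rfl le_top this
    let π' := π.restrict hmem
    have hπ' : Function.Surjective π' := by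
      rintro ⟨y, hy⟩
      rw [← LinearMap.range_eq_top.2 hπ, ← Submodule.map_top, ← Submodule.map_smul''] at hy
      obtain ⟨x, hx, rfl⟩ := hy
      exact ⟨⟨x, hx⟩, rfl⟩
    refine mk₀_comp_extClass_comp_eq_zero hπ hπ' (Submodule.subtype _) _ rfl _ hg hs fun x hx ↦ ?_
    obtain ⟨y, hy, hyx⟩ := hle ⟨x.2, congrArg Subtype.val hx⟩
    exact ⟨y, hy, hyx⟩

lemma vanishes_of_pow_smul_eq_zero {G : Type u} [AddCommGroup G] [Module R G] {m : ℕ}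
    (hG : ∀ b ∈ a ^ m, ∀ x : G, b • x = 0) (i : ℕ) :
    Vanishes a T (ModuleCat.of R G) (i + 1) := by
  intro t e
  let q (s : ℕ) : R →ₗ[R] R ⧸ a ^ s := Submodule.mkQ (a ^ s)
  have hq (s : ℕ) : Function.Surjective (q s) := Submodule.mkQ_surjective _
  have hqk (s : ℕ) (x : R) (hx : q s x = 0) : x ∈ a ^ s := (Submodule.Quotient.mk_eq_zero _).1 hx
  have : Projective (q t).shortComplexKer.X₂ := (IsProjective.iff_projective R).1 inferInstance
  obtain ⟨g, hg⟩ := Ext.contravariant_sequence_exact₃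
    (LinearMap.shortExact_shortComplexKer (hq t)) _ e (Ext.eq_zero_of_projective _) (add_comm 1 i)
  obtain ⟨s, hs⟩ := exists_mk₀_subtype_comp_eq_zero hG i (LinearMap.ker (q t)) g
  refine ⟨s + t, Nat.le_add_left _ _, 1, one_mem _, ?_⟩
  rw [one_smul]
  refine mk₀_comp_extClass_comp_eq_zero (hq t) (hq (s + t)) LinearMap.id _ rfl _ hg hs
    fun x hx ↦ ?_
  have hx' : x ∈ a ^ s * a ^ t := by
    rw [← pow_add]
    exact hqk _ _ hx
  have hx'' : x ∈ (a ^ s • ⊤ : Submodule R (LinearMap.ker (q t))).map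
      (LinearMap.ker (q t)).subtype := by
    rw [Submodule.map_smul'', Submodule.map_top, Submodule.range_subtype]
    exact Submodule.smul_mono le_rfl (fun y hy ↦ (Submodule.Quotient.mk_eq_zero _).2 hy) hx'
  obtain ⟨y, hy, hyx⟩ := hx''
  exact ⟨y, hy, hyx⟩

end Noetherian

end localCohomology
end

noncomputable section

open CategoryTheory Limits Abelian

universe u

namespace localCohomology

variable {R : Type u} [CommRing R] {a : Ideal R} {T : Submonoid R}
  {M N P : Type u} [AddCommGroup M] [Module R M] [AddCommGroup N] [Module R N]
  [AddCommGroup P] [Module R P]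

lemma Vanishes.smul_mem {i : ℕ} {M : ModuleCat.{u} R} {t : ℕ}
    {e : Abelian.Ext (ModuleCat.of R (R ⧸ a ^ t)) M i} {s : ℕ} (hs : t ≤ s) {r : R} (hr : r ∈ T)
    (h : ∃ (s' : ℕ) (h' : s ≤ s'), ∃ r' ∈ T, r' • (Ext.mk₀ (powQuotient a h')).comp
      (r • (Ext.mk₀ (powQuotient a hs)).comp e (zero_add i)) (zero_add i) = 0) :
    ∃ (s' : ℕ) (h' : t ≤ s'), ∃ r' ∈ T,
      r' • (Ext.mk₀ (powQuotient a h')).comp e (zero_add i) = 0 := by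
  obtain ⟨s', hs', r', hr', h0⟩ := h
  refine ⟨s', hs.trans hs', r' * r, mul_mem hr' hr, ?_⟩
  rw [Ext.comp_smul, ← Ext.comp_assoc _ _ _ (zero_add 0) (zero_add i) (by lia), Ext.mk₀_comp_mk₀,
    powQuotient_comp, smul_smul] at h0
  exact h0

lemma shortExact_of_exact {f : M →ₗ[R] N} {g : N →ₗ[R] P} (hf : Function.Injective f)
    (hg : Function.Surjective g) (h : Function.Exact f g) :
    (ModuleCat.shortComplexOfCompEqZero f g h.linearMap_comp_eq_zero).ShortExact where
  exact := ModuleCat.shortComplex_exact _ h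
  mono_f := (ModuleCat.mono_iff_injective _).2 hf
  epi_g := (ModuleCat.epi_iff_surjective _).2 hg

lemma Vanishes.of_exact_right {f : M →ₗ[R] N} {g : N →ₗ[R] P} (hf : Function.Injective f)
    (hg : Function.Surjective g) (h : Function.Exact f g) {i : ℕ}
    (h₂ : Vanishes a T (ModuleCat.of R N) i) (h₁ : Vanishes a T (ModuleCat.of R M) (i + 1)) :
    Vanishes a T (ModuleCat.of R P) i :=
  Vanishes.of_shortExact (shortExact_of_exact hf hg h) h₂ h₁

lemma Vanishes.of_exact_middle {f : M →ₗ[R] N} {g : N →ₗ[R] P} (hf : Function.Injective f)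
    (hg : Function.Surjective g) (h : Function.Exact f g) {i : ℕ}
    (h₁ : Vanishes a T (ModuleCat.of R M) i) (h₃ : Vanishes a T (ModuleCat.of R P) i) :
    Vanishes a T (ModuleCat.of R N) i := by
  have hS := shortExact_of_exact hf hg h
  intro t e
  obtain ⟨s, hs, r, hr, h0⟩ := h₃ t (e.comp (Ext.mk₀ (ModuleCat.ofHom g)) (add_zero i))
  rw [← Ext.comp_assoc _ _ _ (zero_add i) (add_zero i) (by lia), ← Ext.smul_comp] at h0
  obtain ⟨x, hx⟩ := Ext.covariant_sequence_exact₂ _ hS _ h0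
  refine Vanishes.smul_mem hs hr ?_
  obtain ⟨s', hs', r', hr', h1⟩ := h₁ s x
  refine ⟨s', hs', r', hr', ?_⟩
  rw [← hx, ← Ext.comp_assoc _ _ _ (zero_add i) (add_zero i) (by lia), ← Ext.smul_comp]
  erw [h1]
  rw [Ext.zero_comp]

lemma smul_ext_eq_zero {X Y : ModuleCat.{u} R} {r : R} (hr : ∀ y : Y, r • y = 0) {i : ℕ}
    (e : Abelian.Ext X Y i) : r • e = 0 := by
  have : r • 𝟙 Y = 0 := by
    ext y
    exact hr y
  rw [Ext.smul_eq_comp_mk₀, this, Ext.mk₀_zero, Ext.comp_zero]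

lemma smul_ext_eq_zero' {X Y : ModuleCat.{u} R} {r : R} (hr : ∀ x : X, r • x = 0) {i : ℕ}
    (e : Abelian.Ext X Y i) : r • e = 0 := by
  have : r • 𝟙 X = 0 := by
    ext y
    exact hr y
  rw [← Ext.mk₀_id_comp e, ← Ext.smul_comp, ← Ext.mk₀_smul, this, Ext.mk₀_zero, Ext.zero_comp]

lemma vanishes_of_smul_eq_zero {r : R} (hr : r ∈ T) (h : ∀ x : M, r • x = 0) (i : ℕ) :
    Vanishes a T (ModuleCat.of R M) i := fun t _ ↦
  ⟨t, le_rfl, r, hr, smul_ext_eq_zero h _⟩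

lemma pow_smul_quotient_eq_zero {x : R} (hx : x ∈ a) (t : ℕ) (y : R ⧸ a ^ t) :
    x ^ t • y = 0 := by
  obtain ⟨y, rfl⟩ := Submodule.Quotient.mk_surjective _ y
  exact (Submodule.Quotient.mk_eq_zero _).2 (Ideal.mul_mem_right _ _ (Ideal.pow_mem_pow hx t))

lemma vanishes_of_mem_of_mem {r : R} (hr : r ∈ T) (hra : r ∈ a) (M : ModuleCat.{u} R) (i : ℕ) :
    Vanishes a T M i := fun t _ ↦
  ⟨t, le_rfl, r ^ t, pow_mem hr t, smul_ext_eq_zero' (pow_smul_quotient_eq_zero hra t) _⟩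

lemma Vanishes.quotSMulTop {x : R} (hx : IsSMulRegular M x) {i : ℕ}
    (h₀ : Vanishes a T (ModuleCat.of R M) i) (h₁ : Vanishes a T (ModuleCat.of R M) (i + 1)) :
    Vanishes a T (ModuleCat.of R (QuotSMulTop x M)) i :=
  Vanishes.of_shortExact
    (IsSMulRegular.smulShortComplex_shortExact (M := ModuleCat.of R M) hx) h₀ h₁

lemma Vanishes.of_linearEquiv (e : M ≃ₗ[R] N) {i : ℕ} (h : Vanishes a T (ModuleCat.of R M) i) :
    Vanishes a T (ModuleCat.of R N) i :=
  Vanishes.of_exact_right (M := PUnit.{u + 1}) (f := (0 : PUnit.{u + 1} →ₗ[R] M))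
    (g := e.toLinearMap)
    (Function.injective_of_subsingleton _) e.surjective
    ((LinearMap.exact_zero_iff_injective _ e.toLinearMap).2 e.injective) h
    (vanishes_of_smul_eq_zero (one_mem T) (fun _ ↦ rfl) _)

/-- If `x ∈ a` is `M`-regular, multiplication by `x` is injective on `H_a^{i+1}(M)` as soon as
`H_a^i(M ⧸ xM)` vanishes; as every element is killed by a power of `x`, so does `H_a^{i+1}(M)`. -/
lemma Vanishes.of_quotSMulTop {x : R} (hxa : x ∈ a) (hx : IsSMulRegular M x) {i : ℕ}
    (h : Vanishes a T (ModuleCat.of R (QuotSMulTop x M)) i) :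
    Vanishes a T (ModuleCat.of R M) (i + 1) := by
  have hS := IsSMulRegular.smulShortComplex_shortExact (M := ModuleCat.of R M) hx
  replace h : Vanishes a T ((ModuleCat.of R M).smulShortComplex x).X₃ i := h
  have key (k : ℕ) : ∀ (t : ℕ) (e : Abelian.Ext (ModuleCat.of R (R ⧸ a ^ t))
      (ModuleCat.of R M) (i + 1)), x ^ k • e = 0 →
      ∃ (s : ℕ) (h : t ≤ s), ∃ r ∈ T,
        r • (Ext.mk₀ (powQuotient a h)).comp e (zero_add (i + 1)) = 0 := by
    induction k with
    | zero =>
      intro t e he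
      rw [pow_zero, one_smul] at he
      exact ⟨t, le_rfl, 1, one_mem _, by rw [he, Ext.comp_zero, smul_zero]⟩
    | succ k ih =>
      intro t e he
      rw [pow_succ', mul_smul, Ext.smul_eq_comp_mk₀] at he
      obtain ⟨w, hw⟩ := Ext.covariant_sequence_exact₁ _ hS (x ^ k • e) he rfl
      obtain ⟨s, hs, r, hr, h0⟩ := h t w
      refine Vanishes.smul_mem hs hr (ih s _ ?_)
      have h1 :
          (r • (Ext.mk₀ (powQuotient a hs)).comp w (zero_add i)).comp hS.extClass rfl = 0 := by
        rw [h0, Ext.zero_comp]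
      rw [Ext.smul_comp, Ext.comp_assoc _ _ _ (zero_add i) rfl (by lia), hw] at h1
      replace h1 : r • (Ext.mk₀ (powQuotient a hs)).comp (x ^ k • e) (zero_add (i + 1)) = 0 := h1
      rw [Ext.comp_smul] at h1
      rw [smul_comm]
      exact h1
  intro t e
  exact key t t e (smul_ext_eq_zero' (pow_smul_quotient_eq_zero hxa t) e)

lemma vanishes_zero_of_forall
    (h : ∀ (t : ℕ) (y : M), (∀ b ∈ a ^ t, b • y = 0) → y = 0) :
    Vanishes a T (ModuleCat.of R M) 0 :=
  vanishes_zero_iff.2 fun t y hy ↦ ⟨1, one_mem _, by rw [h t y hy, smul_zero]⟩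

section Noetherian

variable [IsNoetherianRing R] [Module.Finite R M]

lemma exists_isSMulRegular (h : ∀ y : M, (∀ b ∈ a, b • y = 0) → y = 0) :
    ∃ x ∈ a, IsSMulRegular M x := by
  have : Subsingleton ((R ⧸ a) →ₗ[R] M) := by
    refine subsingleton_of_forall_eq 0 fun f ↦ ?_
    refine Submodule.linearMap_qext _ (LinearMap.ext_ring ?_)
    refine h (f (Submodule.Quotient.mk 1)) fun b hb ↦ ?_
    rw [← map_smul, ← Submodule.Quotient.mk_smul, smul_eq_mul, mul_one,
      (Submodule.Quotient.mk_eq_zero _).2 hb, map_zero]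
  obtain ⟨x, hx, hreg⟩ := IsSMulRegular.subsingleton_linearMap_iff.1 this
  rw [Ideal.annihilator_quotient] at hx
  exact ⟨x, hx, hreg⟩

lemma Vanishes.exists_isSMulRegular (h : Vanishes a ⊥ (ModuleCat.of R M) 0) :
    ∃ x ∈ a, IsSMulRegular M x := by
  refine localCohomology.exists_isSMulRegular fun y hy ↦ ?_
  obtain ⟨r, hr, h0⟩ := vanishes_zero_iff.1 h 1 y (by rwa [pow_one])
  rwa [Submonoid.mem_bot.1 hr, one_smul] at h0

variable (a M) in
/-- A finite module has a largest submodule annihilated by a power of `a`, and the quotient by it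
has no `a`-torsion. -/
lemma exists_torsion_submodule : ∃ (G : Submodule R M) (m : ℕ), (∀ b ∈ a ^ m, ∀ x : G, b • x = 0) ∧
    ∀ (t : ℕ) (y : M ⧸ G), (∀ b ∈ a ^ t, b • y = 0) → y = 0 := by
  let F : ℕ →o Submodule R M :=
    ⟨fun t ↦ Submodule.torsionBySet R M ((a ^ t : Ideal R) : Set R), fun s t hst ↦
      Submodule.torsionBySet_le_torsionBySet_of_subset (Ideal.pow_le_pow_right hst)⟩
  obtain ⟨m, hm⟩ := monotone_stabilizes_iff_noetherian.2 (inferInstance : IsNoetherian R M) F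
  refine ⟨F m, m, fun b hb x ↦ Subtype.ext ((Submodule.mem_torsionBySet_iff _ _).1 x.2 ⟨b, hb⟩),
    fun t y hy ↦ ?_⟩
  obtain ⟨y, rfl⟩ := Submodule.Quotient.mk_surjective _ y
  refine (Submodule.Quotient.mk_eq_zero _).2 ?_
  rw [hm (m + t) (Nat.le_add_right _ _)]
  refine (Submodule.mem_torsionBySet_iff _ _).2 fun ⟨b, hb⟩ ↦ ?_
  change b ∈ a ^ (m + t) at hb
  change b • y = 0
  rw [pow_add] at hb
  refine Submodule.mul_induction_on hb (fun b₁ h₁ b₂ h₂ ↦ ?_) fun b₁ b₂ h₁ h₂ ↦ ?_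
  · rw [mul_smul]
    exact (Submodule.mem_torsionBySet_iff _ _).1 ((Submodule.Quotient.mk_eq_zero _).1 (hy b₂ h₂))
      ⟨b₁, h₁⟩
  · rw [add_smul, h₁, h₂, add_zero]

end Noetherian

open Classical in
lemma exists_submonoid_torsion [IsNoetherianRing R] [Module.Finite R M] (T : Submonoid R) :
    ∃ (K : Submodule R M) (r : R), r ∈ T ∧ (∀ x : K, r • x = 0) ∧
      ∀ s ∈ T, ∀ y : M ⧸ K, s • y = 0 → y = 0 := by
  let K := Submodule.torsion' R M T
  have hK : Module.IsTorsion' K T := Submodule.torsion'_isTorsion' T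
  obtain ⟨r, hr⟩ : ∃ r : T, ∀ x : K, (r : R) • x = 0 := by
    obtain ⟨S, hS⟩ := (inferInstance : Module.Finite R K)
    choose f hf using fun x : K ↦ @hK x
    refine ⟨∏ x ∈ S, f x, fun x ↦ ?_⟩
    have : x ∈ Submodule.span R (S : Set K) := by rw [hS]; trivial
    induction this using Submodule.span_induction with
    | mem x hx =>
      rw [← Finset.prod_erase_mul _ _ hx, Submonoid.coe_mul, mul_smul]
      exact (congrArg _ (hf x)).trans (smul_zero _)
    | zero => exact smul_zero _
    | add x y _ _ hx hy => rw [smul_add, hx, hy, add_zero]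
    | smul c x _ hx => rw [smul_comm, hx, smul_zero]
  refine ⟨K, r, r.2, hr, fun s hs y hy ↦ ?_⟩
  obtain ⟨y, rfl⟩ := Submodule.Quotient.mk_surjective _ y
  rw [← Submodule.Quotient.mk_smul, Submodule.Quotient.mk_eq_zero] at hy
  refine (Submodule.Quotient.mk_eq_zero _).2 ⟨r * ⟨s, hs⟩, ?_⟩
  change ((r : R) * s) • y = 0
  rw [mul_smul]
  exact congrArg Subtype.val (hr ⟨_, hy⟩)

section IsLocalRing

variable [IsNoetherianRing R] [IsLocalRing R]

lemma supportDim_quotSMulTop_lt [Module.Finite R M] {x : R} (hx : IsSMulRegular M x)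
    (hxm : x ∈ IsLocalRing.maximalIdeal R) {d : ℕ} (hd : Module.supportDim R M < (d + 1 : ℕ)) :
    Module.supportDim R (QuotSMulTop x M) < d := by
  rw [← Module.supportDim_quotSMulTop_succ_eq_supportDim hx hxm] at hd
  generalize Module.supportDim R (QuotSMulTop x M) = e at hd ⊢
  induction e with
  | bot => exact WithBot.bot_lt_coe _
  | coe e =>
    induction e with
    | top => exact absurd hd (not_lt.2 le_top)
    | coe e =>
      norm_cast at hd ⊢
      lia

/-- Grothendieck vanishing: `H_a^i(M) = 0` for `i > dim M`. -/
lemma vanishes_of_supportDim_lt (ha : a ≤ IsLocalRing.maximalIdeal R) (d : ℕ) :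
    ∀ (M : Type u) [AddCommGroup M] [Module R M] [Module.Finite R M],
      Module.supportDim R M < d → ∀ i, d ≤ i → Vanishes a T (ModuleCat.of R M) i := by
  induction d with
  | zero =>
    intro M _ _ _ h i _
    have : Subsingleton M := by
      rw [← Module.supportDim_eq_bot_iff_subsingleton (R := R)]
      generalize Module.supportDim R M = e at h
      induction e with
      | bot => rfl
      | coe e => exact absurd h (by simp)
    exact vanishes_of_smul_eq_zero (one_mem T) (fun _ ↦ Subsingleton.elim _ _) i
  | succ d ih =>
    intro M _ _ _ h i hi
    obtain ⟨i, rfl⟩ : ∃ j, i = j + 1 := ⟨i - 1, by lia⟩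
    obtain ⟨G, m, hG, hG'⟩ := exists_torsion_submodule a M
    refine Vanishes.of_exact_middle G.injective_subtype G.mkQ_surjective
      (LinearMap.exact_subtype_mkQ G) (vanishes_of_pow_smul_eq_zero hG i) ?_
    obtain ⟨x, hxa, hx⟩ := exists_isSMulRegular (M := M ⧸ G) (a := a)
      fun y hy ↦ hG' 1 y (by rwa [pow_one])
    refine Vanishes.of_quotSMulTop hxa hx (ih _ ?_ i (by lia))
    exact supportDim_quotSMulTop_lt hx (ha hxa)
      ((Module.supportDim_le_of_surjective G.mkQ G.mkQ_surjective).trans_lt h)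

lemma exists_nat_supportDim_lt : ∃ d : ℕ, ∀ (M : Type u) [AddCommGroup M] [Module R M],
    Module.supportDim R M < d := by
  obtain ⟨d, hd⟩ : ∃ d : ℕ, ringKrullDim R < d := by
    have := ringKrullDim_lt_top (R := R)
    generalize ringKrullDim R = e at this ⊢
    induction e with
    | bot => exact ⟨0, WithBot.bot_lt_coe _⟩
    | coe e =>
      induction e with
      | top => exact absurd this (lt_irrefl _)
      | coe e => exact ⟨e + 1, by norm_cast; lia⟩
  exact ⟨d, fun M _ _ ↦ (Module.supportDim_le_ringKrullDim R M).trans_lt hd⟩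

/-- If all local cohomology modules of `M` vanish at `p ⊇ a` then `M` vanishes at `p`. -/
lemma notMem_support_of_vanishes {p : PrimeSpectrum R} (hp : a ≤ p.asIdeal) (d : ℕ) :
    ∀ (M : Type u) [AddCommGroup M] [Module R M] [Module.Finite R M],
      Module.supportDim R M < d → (∀ i, Vanishes a p.asIdeal.primeCompl (ModuleCat.of R M) i) →
      p ∉ Module.support R M := by
  have ha : a ≤ IsLocalRing.maximalIdeal R := hp.trans (IsLocalRing.le_maximalIdeal p.2.ne_top)
  induction d with
  | zero =>
    intro M _ _ _ h _
    have : Subsingleton M := by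
      rw [← Module.supportDim_eq_bot_iff_subsingleton (R := R)]
      generalize Module.supportDim R M = e at h
      induction e with
      | bot => rfl
      | coe e => exact absurd h (by simp)
    rw [Module.support_eq_empty]
    exact Set.notMem_empty p
  | succ d ih =>
    intro M _ _ _ h hv
    obtain ⟨K, r, hr, hK, hK'⟩ := exists_submonoid_torsion (M := M) p.asIdeal.primeCompl
    have hv' (i : ℕ) : Vanishes a p.asIdeal.primeCompl (ModuleCat.of R (M ⧸ K)) i :=
      Vanishes.of_exact_right K.injective_subtype K.mkQ_surjective (LinearMap.exact_subtype_mkQ K)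
        (hv i) (vanishes_of_smul_eq_zero hr hK _)
    obtain ⟨x, hxa, hx⟩ := exists_isSMulRegular (M := M ⧸ K) (a := a) fun y hy ↦ by
      obtain ⟨s, hs, h0⟩ := vanishes_zero_iff.1 (hv' 0) 1 y (by rwa [pow_one])
      exact hK' s hs y h0
    have h1 := ih (QuotSMulTop x (M ⧸ K)) (supportDim_quotSMulTop_lt hx (ha hxa)
      ((Module.supportDim_le_of_surjective K.mkQ K.mkQ_surjective).trans_lt h))
      fun i ↦ (hv' i).quotSMulTop hx (hv' (i + 1))
    rw [Module.support_quotSMulTop] at h1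
    intro hpM
    refine h1 ⟨?_, by simpa using hp hxa⟩
    rw [Module.mem_support_iff'] at hpM
    obtain ⟨y, hy⟩ := hpM
    refine Module.mem_support_iff'.2 ⟨K.mkQ y, fun s hs h0 ↦ ?_⟩
    rw [← map_smul, Submodule.mkQ_apply, Submodule.Quotient.mk_eq_zero] at h0
    refine hy (r * s) (fun h ↦ (mul_mem hr hs) h) ?_
    rw [mul_smul]
    exact congrArg Subtype.val (hK ⟨_, h0⟩)

end IsLocalRing

end localCohomology
end

noncomputable section

open CategoryTheory Limits Abelian

universe u

namespace localCohomology

variable {R : Type u} [CommRing R] [IsNoetherianRing R] {a : Ideal R} {T : Submonoid R}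

lemma vanishes_of_forall_prime {I : Ideal R} {i : ℕ}
    (h : ∀ p : PrimeSpectrum R, I ≤ p.asIdeal →
      Vanishes a T (ModuleCat.of R (R ⧸ p.asIdeal)) i)
    {N : Type u} [AddCommGroup N] [Module R N] [hN : Module.Finite R N]
    (hIN : ∀ r ∈ I, ∀ y : N, r • y = 0) : Vanishes a T (ModuleCat.of R N) i := by
  induction hN using IsNoetherianRing.induction_on_isQuotientEquivQuotientPrime R with
  | subsingleton N => exact vanishes_of_smul_eq_zero (one_mem T) (fun _ ↦ Subsingleton.elim _ _) i
  | quotient N p e =>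
    refine Vanishes.of_linearEquiv e.symm (h p fun r hr ↦ ?_)
    have := hIN r hr (e.symm (Submodule.Quotient.mk 1))
    rw [← map_smul, LinearEquiv.map_eq_zero_iff, ← Submodule.Quotient.mk_smul, smul_eq_mul,
      mul_one, Submodule.Quotient.mk_eq_zero] at this
    exact this
  | exact N₁ N₂ N₃ f g hf hg hfg ih₁ ih₃ =>
    refine Vanishes.of_exact_middle hf hg hfg (ih₁ fun r hr y ↦ hf ?_) (ih₃ fun r hr y ↦ ?_)
    · rw [map_smul, hIN r hr, map_zero]
    · obtain ⟨y, rfl⟩ := hg y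
      rw [← map_smul, hIN r hr, map_zero]

lemma exists_linearMap_ne_zero {M : Type u} [AddCommGroup M] [Module R M] [Module.Finite R M]
    {q : Ideal R} [q.IsPrime] (hq : Module.annihilator R M ≤ q) :
    ∃ f : M →ₗ[R] R ⧸ q, f ≠ 0 := by
  by_contra! h
  have : Subsingleton (M →ₗ[R] R ⧸ q) := subsingleton_of_forall_eq 0 h
  obtain ⟨r, hr, hreg⟩ := IsSMulRegular.subsingleton_linearMap_iff.1 this
  have h1 : r • (Submodule.Quotient.mk 1 : R ⧸ q) = r • 0 := by
    rw [smul_zero, ← Submodule.Quotient.mk_smul, smul_eq_mul, mul_one]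
    exact (Submodule.Quotient.mk_eq_zero _).2 (hq hr)
  exact ‹q.IsPrime›.one_notMem ((Submodule.Quotient.mk_eq_zero _).1 (hreg h1))

lemma vanishes_quotient_prime {M : Type u} [AddCommGroup M] [Module R M] [Module.Finite R M]
    {i : ℕ} (hM : Vanishes a T (ModuleCat.of R M) i)
    (h : ∀ (N : Type u) [AddCommGroup N] [Module R N] [Module.Finite R N],
      (∀ r ∈ Module.annihilator R M, ∀ y : N, r • y = 0) →
        Vanishes a T (ModuleCat.of R N) (i + 1)) (p : PrimeSpectrum R)
    (hp : Module.annihilator R M ≤ p.asIdeal) :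
    Vanishes a T (ModuleCat.of R (R ⧸ p.asIdeal)) i := by
  have : WellFoundedGT (PrimeSpectrum R) :=
    StrictMono.wellFoundedGT (f := PrimeSpectrum.asIdeal) fun _ _ h ↦ h
  induction p using WellFoundedGT.induction with
  | ind p ih =>
    obtain ⟨f, hf⟩ := exists_linearMap_ne_zero hp
    have hr : ∃ r ∉ p.asIdeal, (Submodule.Quotient.mk r : R ⧸ p.asIdeal) ∈ LinearMap.range f := by
      by_contra! h0
      refine hf (LinearMap.ext fun y ↦ ?_)
      obtain ⟨r, hr⟩ := Submodule.Quotient.mk_surjective _ (f y)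
      by_contra hne
      refine h0 r (fun hrp ↦ hne ?_) ⟨y, hr.symm⟩
      rw [← hr, (Submodule.Quotient.mk_eq_zero _).2 hrp]
      rfl
    obtain ⟨r, hrp, hr⟩ := hr
    refine Vanishes.of_exact_middle (LinearMap.range f).injective_subtype
      (LinearMap.range f).mkQ_surjective (LinearMap.exact_subtype_mkQ _) ?_ ?_
    · refine Vanishes.of_exact_right (LinearMap.ker f).injective_subtype f.surjective_rangeRestrict
        ?_ hM (h _ fun s hs y ↦ ?_)
      · rw [LinearMap.exact_iff, LinearMap.ker_rangeRestrict, Submodule.range_subtype]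
      · exact Subtype.ext (Module.mem_annihilator.1 hs y)
    · refine vanishes_of_forall_prime (I := p.asIdeal ⊔ Ideal.span {r}) (fun q hq ↦ ?_) ?_
      · have hpq := le_sup_left.trans hq
        refine ih q (lt_of_le_of_ne hpq ?_) (hp.trans hpq)
        rintro rfl
        exact hrp (hq (Ideal.mem_sup_right (Ideal.mem_span_singleton_self r)))
      · intro s hs y
        obtain ⟨y, rfl⟩ := Submodule.Quotient.mk_surjective _ y
        obtain ⟨y, rfl⟩ := Submodule.Quotient.mk_surjective _ y
        rw [← Submodule.Quotient.mk_smul, Submodule.Quotient.mk_eq_zero]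
        obtain ⟨b, hb, c, hc, rfl⟩ := Submodule.mem_sup.1 hs
        obtain ⟨c, rfl⟩ := Ideal.mem_span_singleton'.1 hc
        rw [add_smul]
        refine add_mem ?_ ?_
        · rw [← Submodule.Quotient.mk_smul, smul_eq_mul,
            (Submodule.Quotient.mk_eq_zero _).2 (Ideal.mul_mem_right _ _ hb)]
          exact zero_mem _
        · have := Submodule.smul_mem _ (c * y) hr
          rwa [← Submodule.Quotient.mk_smul, smul_eq_mul, mul_right_comm] at this

/-- Gruson's theorem: vanishing of local cohomology of `M` in degrees `> n` passes to all finite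
modules annihilated by the annihilator of `M`. -/
lemma vanishes_of_annihilator [IsLocalRing R] (ha : a ≤ IsLocalRing.maximalIdeal R)
    {M : Type u} [AddCommGroup M] [Module R M] [Module.Finite R M] {n : ℕ}
    (hM : ∀ i, n < i → Vanishes a T (ModuleCat.of R M) i) {i : ℕ} (hi : n < i)
    {N : Type u} [AddCommGroup N] [Module R N] [Module.Finite R N]
    (hN : ∀ r ∈ Module.annihilator R M, ∀ y : N, r • y = 0) :
    Vanishes a T (ModuleCat.of R N) i := by
  obtain ⟨d, hd⟩ := exists_nat_supportDim_lt (R := R)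
  have key (k : ℕ) : ∀ i, n < i → d ≤ i + k → ∀ (N : Type u) [AddCommGroup N] [Module R N]
      [Module.Finite R N], (∀ r ∈ Module.annihilator R M, ∀ y : N, r • y = 0) →
        Vanishes a T (ModuleCat.of R N) i := by
    induction k with
    | zero => exact fun i _ h N _ _ _ _ ↦ vanishes_of_supportDim_lt ha d N (hd N) i h
    | succ k ih =>
      exact fun i hi h N _ _ _ hN ↦ vanishes_of_forall_prime
        (vanishes_quotient_prime (hM i hi) (ih (i + 1) (by lia) (by lia))) hN
  exact key d i hi (by lia) N hN

end localCohomology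
end

section

namespace IsArtinian

variable {A H : Type*} [CommRing A] [AddCommGroup H] [Module A H]

/-- A module all of whose elements are annihilated by a power of `x` is Artinian as soon as the
submodule of elements annihilated by `x` is. -/
theorem of_torsionBy (x : A) (hx : ∀ h : H, ∃ k : ℕ, x ^ k • h = 0)
    [IsArtinian A (Submodule.torsionBy A H x)] : IsArtinian A H := by
  let F (i : ℕ) (W : Submodule A H) : Submodule A (Submodule.torsionBy A H x) :=
    (W.map (LinearMap.lsmul A H (x ^ i))).comap (Submodule.torsionBy A H x).subtype
  have hF {i : ℕ} {W : Submodule A H} {k : Submodule.torsionBy A H x} :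
      k ∈ F i W ↔ ∃ w ∈ W, x ^ i • w = k := Iff.rfl
  have hmono (i : ℕ) {W W' : Submodule A H} (h : W ≤ W') : F i W ≤ F i W' :=
    Submodule.comap_mono (Submodule.map_mono h)
  have hanti (W : Submodule A H) {i j : ℕ} (h : i ≤ j) : F j W ≤ F i W := by
    obtain ⟨m, rfl⟩ := Nat.exists_eq_add_of_le h
    intro k hk
    obtain ⟨w, hw, hwk⟩ := hF.1 hk
    exact hF.2 ⟨x ^ m • w, W.smul_mem _ hw, by rw [smul_smul, ← pow_add, hwk]⟩
  rw [← monotone_stabilizes_iff_artinian]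
  intro W
  have hW {m n : ℕ} (h : m ≤ n) : OrderDual.ofDual (W n) ≤ OrderDual.ofDual (W m) := W.monotone h
  let W' (n : ℕ) : Submodule A H := OrderDual.ofDual (W n)
  obtain ⟨N, hN⟩ := monotone_stabilizes_iff_artinian.2
    (inferInstanceAs (IsArtinian A (Submodule.torsionBy A H x)))
    ⟨fun j ↦ OrderDual.toDual (F j (W' j)), fun i j h ↦
      ((hmono j (hW h)).trans (hanti _ h) : F j (W' j) ≤ F i (W' i))⟩
  have hN' (j : ℕ) (hj : N ≤ j) : F N (W' N) = F j (W' j) := hN j hj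
  have hst (i : ℕ) : ∃ K, ∀ m, K ≤ m → F i (W' K) = F i (W' m) :=
    monotone_stabilizes_iff_artinian.2
      (inferInstanceAs (IsArtinian A (Submodule.torsionBy A H x)))
      ⟨fun j ↦ OrderDual.toDual (F i (W' j)), fun j k h ↦ (hmono i (hW h) : F i (W' k) ≤ _)⟩
  choose K hK using hst
  let L := N + ∑ i ∈ Finset.range N, K i
  have hL (i m : ℕ) (hm : L ≤ m) : F i (W' L) ≤ F i (W' m) := by
    rcases lt_or_ge i N with hi | hi
    · have hiL : K i ≤ L := (Finset.single_le_sum (f := K) (fun _ _ ↦ Nat.zero_le _)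
        (Finset.mem_range.2 hi)).trans (Nat.le_add_left _ _)
      rw [← hK i L hiL, ← hK i m (hiL.trans hm)]
    · have h1 : F i (W' L) ≤ F N (W' N) := (hanti _ hi).trans (hmono N (hW (Nat.le_add_right _ _)))
      rw [hN' (max i m) (hi.trans (le_max_left _ _))] at h1
      exact h1.trans ((hanti _ (le_max_left _ _)).trans (hmono i (hW (le_max_right _ _))))
  refine ⟨L, fun m hm ↦ le_antisymm (hW hm : W' m ≤ W' L) ?_ |>.symm⟩
  have key (e : ℕ) : ∀ w ∈ W' L, x ^ e • w = 0 → w ∈ W' m := by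
    induction e with
    | zero => exact fun w _ h ↦ by rw [pow_zero, one_smul] at h; rw [h]; exact zero_mem _
    | succ e ih =>
      intro w hw h
      have h1 : (⟨x ^ e • w, by rwa [Submodule.mem_torsionBy_iff, smul_smul, ← pow_succ']⟩ :
          Submodule.torsionBy A H x) ∈ F e (W' L) := hF.2 ⟨w, hw, rfl⟩
      obtain ⟨w', hw', hww'⟩ := hF.1 (hL e m hm h1)
      have h2 := ih (w - w') (sub_mem hw (hW hm hw')) (by rw [smul_sub, hww', sub_self])
      simpa using add_mem h2 hw'
  exact fun w hw ↦ (hx w).elim fun e he ↦ key e w hw he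

/-- On a sup-irreducible submodule of an Artinian module every scalar is nilpotent or
surjective. -/
lemma map_lsmul_eq_or_of_supIrred [IsArtinian A H] {N : Submodule A H} (hN : SupIrred N) (y : A) :
    (∃ k : ℕ, ∀ h ∈ N, y ^ k • h = 0) ∨ ∀ h ∈ N, ∃ h' ∈ N, y • h' = h := by
  obtain ⟨k, hk1, hk⟩ := ((Filter.eventually_ge_atTop 1).and
    (LinearMap.eventually_codisjoint_ker_pow_range_pow (LinearMap.lsmul A N y))).exists
  have hpow (h : N) : (LinearMap.lsmul A N y ^ k) h = y ^ k • h := by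
    clear hk hk1
    induction k with
    | zero => simp
    | succ k ih =>
      rw [pow_succ', Module.End.mul_apply, ih, LinearMap.lsmul_apply, smul_smul, pow_succ']
  have h1 := congrArg (Submodule.map N.subtype) hk.eq_top
  rw [Submodule.map_sup, Submodule.map_top, Submodule.range_subtype] at h1
  refine (hN.2 h1).imp (fun h2 ↦ ⟨k, fun h hh ↦ ?_⟩) fun h2 h hh ↦ ?_
  · rw [← h2] at hh
    obtain ⟨z, hz, rfl⟩ := hh
    exact congrArg Subtype.val ((hpow z).symm.trans hz)
  · rw [← h2] at hh
    obtain ⟨_, ⟨z, rfl⟩, rfl⟩ := hh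
    obtain ⟨j, rfl⟩ : ∃ j, k = j + 1 := ⟨k - 1, by lia⟩
    refine ⟨y ^ j • z, N.smul_mem _ z.2, ?_⟩
    rw [smul_smul, ← pow_succ', hpow]
    rfl

lemma isPrime_radical_annihilator_of_supIrred [IsArtinian A H] {N : Submodule A H}
    (hN : SupIrred N) : (Module.annihilator A N).radical.IsPrime := by
  have hmem {y : A} : y ∈ (Module.annihilator A N).radical ↔ ∃ k : ℕ, ∀ h ∈ N, y ^ k • h = 0 := by
    simp only [Ideal.mem_radical_iff, Module.mem_annihilator, Subtype.forall, ← Subtype.val_inj]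
    rfl
  refine ⟨?_, fun {y z} hyz ↦ or_iff_not_imp_left.2 fun hy ↦ ?_⟩
  · rw [Ideal.ne_top_iff_one, hmem]
    rintro ⟨k, hk⟩
    refine hN.1 (isMin_iff_eq_bot.2 ((Submodule.eq_bot_iff _).2 fun h hh ↦ ?_))
    simpa using hk h hh
  · obtain ⟨k, hk⟩ := hmem.1 hyz
    have hs := (map_lsmul_eq_or_of_supIrred hN y).resolve_left fun h ↦ hy (hmem.2 h)
    have hs' (k : ℕ) : ∀ h ∈ N, ∃ h' ∈ N, y ^ k • h' = h := by
      induction k with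
      | zero => exact fun h hh ↦ ⟨h, hh, by simp⟩
      | succ k ih =>
        intro h hh
        obtain ⟨h', hh', rfl⟩ := hs h hh
        obtain ⟨h'', hh'', rfl⟩ := ih h' hh'
        exact ⟨h'', hh'', by rw [smul_smul, pow_succ']⟩
    refine hmem.2 ⟨k, fun h hh ↦ ?_⟩
    obtain ⟨h', hh', rfl⟩ := hs' k h hh
    rw [smul_smul, ← mul_pow, mul_comm z y]
    exact hk h' hh'

/-- If `H` is Artinian, `a` is finitely generated and `a H = H`, then already `x H = H` for some
`x ∈ a`. -/
theorem exists_forall_exists_smul_eq [IsArtinian A H] {R : Type*} [CommRing R] (φ : R →+* A)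
    {a : Ideal R} (ha : a.FG) (haH : a.map φ • (⊤ : Submodule A H) = ⊤) :
    ∃ x ∈ a, ∀ h : H, ∃ h', φ x • h' = h := by
  classical
  obtain ⟨s, hs, hirr⟩ := exists_supIrred_decomposition (⊤ : Submodule A H)
  let P (N : Submodule A H) : Ideal A := (Module.annihilator A N).radical
  let g : Finset (Submodule A H) := s.filter fun N ↦ ¬ a.map φ ≤ P N
  have hg : ∃ x ∈ a, ∀ N ∈ g, φ x ∉ P N := by
    by_contra! h
    have h1 : (a : Set R) ⊆ ⋃ N ∈ (g : Set (Submodule A H)), ((P N).comap φ : Set R) := by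
      intro x hx
      obtain ⟨N, hN, hxN⟩ := h x hx
      exact Set.mem_biUnion hN hxN
    obtain ⟨N, hN, hle⟩ := (Ideal.subset_union_prime (s := g) (f := fun N ↦ (P N).comap φ) ⊤ ⊤
      fun N hN _ _ ↦ (isPrime_radical_annihilator_of_supIrred
        (hirr (Finset.mem_filter.1 hN).1)).comap φ).1 h1
    exact (Finset.mem_filter.1 hN).2 (Ideal.map_le_iff_le_comap.2 hle)
  obtain ⟨x, hxa, hx⟩ := hg
  refine ⟨x, hxa, ?_⟩
  have hbad (N : Submodule A H) : ∃ k : ℕ, N ∈ s → N ∉ g → (a.map φ) ^ k • N = ⊥ := by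
    by_cases h : a.map φ ≤ P N
    · obtain ⟨k, hk⟩ := Ideal.exists_pow_le_of_le_radical_of_fg h (ha.map φ)
      refine ⟨k, fun _ _ ↦ (Submodule.eq_bot_iff _).2 fun h hh ↦ ?_⟩
      refine Submodule.smul_induction_on hh (fun r hr n hn ↦ ?_) fun _ _ h₁ h₂ ↦ by
        rw [h₁, h₂, add_zero]
      exact congrArg Subtype.val (Module.mem_annihilator.1 (hk hr) ⟨n, hn⟩)
    · exact ⟨0, fun hs hg ↦ absurd (Finset.mem_filter.2 ⟨hs, h⟩) hg⟩
  choose k hk using hbad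
  have hpow (m : ℕ) : (a.map φ) ^ m • (⊤ : Submodule A H) = ⊤ := by
    induction m with
    | zero => simp
    | succ m ih => rw [pow_succ, Submodule.mul_smul, haH, ih]
  let m := ∑ N ∈ s, k N
  have htop : (⊤ : Submodule A H) ≤ g.sup id := by
    rw [← hpow m, ← hs, Finset.sup_eq_iSup, Submodule.smul_iSup]
    refine iSup_le fun N ↦ ?_
    rw [Submodule.smul_iSup]
    refine iSup_le fun hN ↦ ?_
    by_cases h : N ∈ g
    · exact Submodule.smul_le_right.trans (Finset.le_sup (f := id) h)
    · refine (Submodule.smul_mono_left (Ideal.pow_le_pow_right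
        (Finset.single_le_sum (f := k) (fun _ _ ↦ Nat.zero_le _) hN))).trans ?_
      exact (hk N hN h).trans_le bot_le
  have hsup : g.sup id ≤ LinearMap.range (LinearMap.lsmul A H (φ x)) := by
    refine Finset.sup_le fun N hN h hh ↦ ?_
    obtain ⟨h', -, rfl⟩ := (map_lsmul_eq_or_of_supIrred (hirr (Finset.mem_filter.1 hN).1)
      (φ x)).resolve_left (fun ⟨k, hk⟩ ↦ hx N hN ⟨k, Module.mem_annihilator.2 fun n ↦
        Subtype.ext (hk n n.2)⟩) h hh
    exact ⟨h', rfl⟩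
  exact fun h ↦ hsup (htop (Submodule.mem_top (x := h)))

end IsArtinian
end

section

namespace LocalizedModule

variable {R : Type*} [CommRing R] {T : Submonoid R} {M N : Type*} [AddCommGroup M] [Module R M]
  [AddCommGroup N] [Module R N]

lemma isTorsionBySet_map {J : Ideal R} (hJ : ∀ r ∈ J, ∀ x : M, r • x = 0) :
    Module.IsTorsionBySet (Localization T) (LocalizedModule T M)
      (J.map (algebraMap R (Localization T))) := by
  refine (Module.isTorsionBySet_iff_is_torsion_by_span _).1 ?_
  rintro z ⟨_, r, hr, rfl⟩
  induction z using LocalizedModule.induction_on with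
  | h m s =>
    change algebraMap R (Localization T) r • LocalizedModule.mk m s = 0
    rw [algebraMap_smul, LocalizedModule.smul'_mk, hJ r hr, LocalizedModule.zero_mk]

lemma _root_.IsArtinianRing.quotient_map_of_mem_minimalPrimes [IsNoetherianRing R]
    {J p : Ideal R} [p.IsPrime] (hp : p ∈ J.minimalPrimes) :
    IsArtinianRing
      (Localization.AtPrime p ⧸ J.map (algebraMap R (Localization.AtPrime p))) := by
  let A := Localization.AtPrime p
  have : IsNoetherianRing A := IsLocalization.isNoetherianRing p.primeCompl A inferInstance
  have hI : IsLocalRing.maximalIdeal A ∈ (J.map (algebraMap R A)).minimalPrimes := by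
    rw [IsLocalization.minimalPrimes_map p.primeCompl A J, Set.mem_preimage,
      IsLocalization.AtPrime.under_maximalIdeal A p]
    exact hp
  exact IsLocalRing.quotient_artinian_of_mem_minimalPrimes_of_isLocalRing _ hI

section Finite

variable [IsNoetherianRing R] [Module.Finite R M] {J p : Ideal R} [p.IsPrime]

/-- The localization of a finite module at a minimal prime over an ideal annihilating it is
Artinian. -/
theorem isArtinian_of_mem_minimalPrimes (hp : p ∈ J.minimalPrimes)
    (hJ : ∀ r ∈ J, ∀ x : M, r • x = 0) :
    IsArtinian (Localization.AtPrime p) (LocalizedModule p.primeCompl M) := by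
  let A := Localization.AtPrime p
  let I : Ideal A := J.map (algebraMap R A)
  have := IsArtinianRing.quotient_map_of_mem_minimalPrimes hp
  have htors : Module.IsTorsionBySet A (LocalizedModule p.primeCompl M) I := isTorsionBySet_map hJ
  let := htors.module
  have : IsScalarTower A (A ⧸ I) (LocalizedModule p.primeCompl M) := htors.isScalarTower
  have : Module.Finite (A ⧸ I) (LocalizedModule p.primeCompl M) :=
    Module.Finite.of_restrictScalars_finite A _ _
  exact isArtinian_of_surjective_algebraMap (R := A ⧸ I) Ideal.Quotient.mk_surjective

theorem supportDim_le_zero_of_mem_minimalPrimes (hp : p ∈ J.minimalPrimes)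
    (hJ : ∀ r ∈ J, ∀ x : M, r • x = 0) :
    Module.supportDim (Localization.AtPrime p) (LocalizedModule p.primeCompl M) ≤ 0 := by
  let A := Localization.AtPrime p
  have := IsArtinianRing.quotient_map_of_mem_minimalPrimes hp
  have hle : J.map (algebraMap R A) ≤ Module.annihilator A (LocalizedModule p.primeCompl M) :=
    fun r hr ↦ Module.mem_annihilator.2 fun z ↦ @isTorsionBySet_map _ _ _ _ _ _ _ hJ z ⟨r, hr⟩
  rw [Module.supportDim_eq_ringKrullDim_quotient_annihilator]
  refine (ringKrullDim_le_of_surjective (Ideal.Quotient.factor hle)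
    (Ideal.Quotient.factor_surjective hle)).trans ?_
  exact (Ring.krullDimLE_iff (n := 0)).1 inferInstance

end Finite

theorem isArtinian_of_injective (f : M →ₗ[R] N) (hf : Function.Injective f)
    [IsArtinian (Localization T) (LocalizedModule T N)] :
    IsArtinian (Localization T) (LocalizedModule T M) :=
  _root_.isArtinian_of_injective (LocalizedModule.map T f)
    (IsLocalizedModule.map_injective T _ _ f hf)

theorem isArtinian_of_surjective (f : M →ₗ[R] N) (hf : Function.Surjective f)
    [IsArtinian (Localization T) (LocalizedModule T M)] :
    IsArtinian (Localization T) (LocalizedModule T N) :=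
  _root_.isArtinian_of_surjective _ (LocalizedModule.map T f)
    (IsLocalizedModule.map_surjective T _ _ f hf)

theorem isArtinian_of_ker_le_range (f : M →ₗ[R] N) {x : R} (hx : ∀ z : N, ∃ k : ℕ, x ^ k • z = 0)
    (hf : ∀ z : N, x • z = 0 → ∃ y, f y = z)
    [IsArtinian (Localization T) (LocalizedModule T M)] :
    IsArtinian (Localization T) (LocalizedModule T N) := by
  let g := LocalizedModule.map T f
  have hg : Submodule.torsionBy (Localization T) (LocalizedModule T N)
      (algebraMap R (Localization T) x) ≤ LinearMap.range g := by
    intro z hz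
    rw [Submodule.mem_torsionBy_iff, algebraMap_smul] at hz
    induction z using LocalizedModule.induction_on with
    | h m s =>
      rw [LocalizedModule.smul'_mk, ← LocalizedModule.zero_mk 1, LocalizedModule.mk_eq] at hz
      obtain ⟨r, hr⟩ := hz
      rw [one_smul, smul_zero, smul_zero, Submonoid.smul_def, smul_comm] at hr
      obtain ⟨y, hy⟩ := hf _ hr
      refine ⟨LocalizedModule.mk y (r * s), ?_⟩
      refine (IsLocalizedModule.map_LocalizedModules T f y (r * s)).trans ?_
      rw [hy]
      exact LocalizedModule.mk_cancel_common_left r s m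
  have := isArtinian_of_le hg
  refine IsArtinian.of_torsionBy (algebraMap R (Localization T) x) fun z ↦ ?_
  induction z using LocalizedModule.induction_on with
  | h m s =>
    obtain ⟨k, hk⟩ := hx m
    exact ⟨k, by rw [← map_pow, algebraMap_smul, LocalizedModule.smul'_mk, hk,
      LocalizedModule.zero_mk]⟩

theorem exists_forall_exists_smul_eq [IsArtinian (Localization T) (LocalizedModule T M)]
    {a : Ideal R} (ha : a.FG)
    (haM : ∀ z : M, ∃ r ∈ T, r • z ∈ a • (⊤ : Submodule R M)) :
    ∃ x ∈ a, ∀ z : M, ∃ r ∈ T, ∃ y : M, r • z = x • y := by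
  obtain ⟨x, hxa, hx⟩ := IsArtinian.exists_forall_exists_smul_eq (H := LocalizedModule T M)
    (algebraMap R (Localization T)) ha (by
      refine eq_top_iff.2 fun z _ ↦ ?_
      induction z using LocalizedModule.induction_on with
      | h m s =>
        obtain ⟨r, hr, hm⟩ := haM m
        have key (w : M) (hw : w ∈ a • (⊤ : Submodule R M)) : ∀ t : T, LocalizedModule.mk w t ∈
            a.map (algebraMap R (Localization T)) •
              (⊤ : Submodule (Localization T) (LocalizedModule T M)) := by
          refine Submodule.smul_induction_on hw (fun b hb n _ t ↦ ?_) fun v w hv hw t ↦ ?_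
          · rw [← LocalizedModule.smul'_mk, ← algebraMap_smul (Localization T)]
            exact Submodule.smul_mem_smul (Ideal.mem_map_of_mem _ hb) trivial
          · have := add_mem (hv t) (hw t)
            rwa [LocalizedModule.mk_add_mk, ← smul_add,
              LocalizedModule.mk_cancel_common_left] at this
        have := key _ hm (⟨r, hr⟩ * s)
        rwa [← LocalizedModule.mk_cancel_common_left ⟨r, hr⟩ s m])
  refine ⟨x, hxa, fun z ↦ ?_⟩
  obtain ⟨y, hy⟩ := hx (LocalizedModule.mk z 1)
  induction y using LocalizedModule.induction_on with
  | h y s =>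
    rw [algebraMap_smul, LocalizedModule.smul'_mk, LocalizedModule.mk_eq] at hy
    obtain ⟨r, hr⟩ := hy
    refine ⟨r * s, mul_mem r.2 s.2, (r : R) • y, ?_⟩
    rw [one_smul] at hr
    rw [mul_smul, smul_comm x]
    exact hr.symm

end LocalizedModule
end

noncomputable section

open CategoryTheory Limits Abelian

universe u

lemma Ideal.mem_minimalPrimes_pow_sup {R : Type*} [CommSemiring R] {a I p : Ideal R} {m : ℕ}
    (hm : m ≠ 0) (hp : p ∈ (a ⊔ I).minimalPrimes) : p ∈ (a ^ m ⊔ I).minimalPrimes :=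
  ⟨⟨hp.1.1, sup_le ((Ideal.pow_le_self hm).trans (le_sup_left.trans hp.1.2))
      (le_sup_right.trans hp.1.2)⟩,
    fun _ hq ↦ hp.2 ⟨hq.1, sup_le (hq.1.le_of_pow_le (le_sup_left.trans hq.2))
      (le_sup_right.trans hq.2)⟩⟩

namespace localCohomology

variable {R : Type u} [CommRing R] (a : Ideal R)

/-- The map `Ext^i(R ⧸ a ^ t, M) → Ext^i(R ⧸ a ^ s, M)` induced by the projection. -/
def restr (M : ModuleCat.{u} R) (i t s : ℕ) (h : t ≤ s) :
    Abelian.Ext (ModuleCat.of R (R ⧸ a ^ t)) M i →ₗ[R]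
      Abelian.Ext (ModuleCat.of R (R ⧸ a ^ s)) M i where
  toFun e := (Ext.mk₀ (powQuotient a h)).comp e (zero_add i)
  map_add' _ _ := Ext.comp_add _ _ _ _
  map_smul' _ _ := Ext.comp_smul _ _ _ _

lemma restr_apply (M : ModuleCat.{u} R) {i t s : ℕ} (h : t ≤ s)
    (e : Abelian.Ext (ModuleCat.of R (R ⧸ a ^ t)) M i) :
    restr a M i t s h e = (Ext.mk₀ (powQuotient a h)).comp e (zero_add i) := rfl

lemma restr_comp {M N : ModuleCat.{u} R} {i j k t s : ℕ} (h : t ≤ s)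
    (e : Abelian.Ext (ModuleCat.of R (R ⧸ a ^ t)) M i) (c : Abelian.Ext M N j) (hk : i + j = k) :
    restr a N k t s h (e.comp c hk) = (restr a M i t s h e).comp c hk := by
  rw [restr_apply, restr_apply, Ext.comp_assoc _ _ _ (zero_add i) hk (by lia)]

instance (M : ModuleCat.{u} R) (i : ℕ) : DirectedSystem
    (fun t ↦ Abelian.Ext (ModuleCat.of R (R ⧸ a ^ t)) M i) (fun t s h ↦ restr a M i t s h) where
  map_self t e := by
    have : powQuotient a (le_refl t) = 𝟙 _ := by ext; rfl
    rw [restr_apply, this, Ext.mk₀_id_comp]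
  map_map t s r h h' e := by
    rw [restr_apply, restr_apply, restr_apply, ← powQuotient_comp a h h', ← Ext.mk₀_comp_mk₀,
      Ext.comp_assoc _ _ _ (zero_add 0) (zero_add i) (by lia)]

/-- The direct limit of `Ext^i(R ⧸ a ^ t, M)`. -/
abbrev ExtLimit (M : ModuleCat.{u} R) (i : ℕ) : Type u :=
  Module.DirectLimit (fun t ↦ Abelian.Ext (ModuleCat.of R (R ⧸ a ^ t)) M i) (restr a M i)

namespace ExtLimit

variable {a}

/-- The class in the limit of an element of `Ext^i(R ⧸ a ^ t, M)`. -/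
abbrev of {M : ModuleCat.{u} R} {i : ℕ} (t : ℕ) :
    Abelian.Ext (ModuleCat.of R (R ⧸ a ^ t)) M i →ₗ[R] ExtLimit a M i :=
  Module.DirectLimit.of R ℕ _ (restr a M i) t

lemma of_restr {M : ModuleCat.{u} R} {i t s : ℕ} (h : t ≤ s)
    (e : Abelian.Ext (ModuleCat.of R (R ⧸ a ^ t)) M i) :
    of s (restr a M i t s h e) = of t e :=
  Module.DirectLimit.of_f

lemma exists_of {M : ModuleCat.{u} R} {i : ℕ} (z : ExtLimit a M i) : ∃ t e, of t e = z :=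
  Module.DirectLimit.exists_of z

lemma exists_restr_eq_zero {M : ModuleCat.{u} R} {i t : ℕ}
    {e : Abelian.Ext (ModuleCat.of R (R ⧸ a ^ t)) M i} (h : of t e = 0) :
    ∃ (s : ℕ) (h : t ≤ s), restr a M i t s h e = 0 :=
  Module.DirectLimit.of.zero_exact h

variable (a) in
/-- Composition with an extension class. -/
def postcomp {M N : ModuleCat.{u} R} {j : ℕ} (c : Abelian.Ext M N j) {i k : ℕ} (hk : i + j = k) :
    ExtLimit a M i →ₗ[R] ExtLimit a N k :=
  Module.DirectLimit.lift R ℕ _ _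
    (fun t ↦ of t ∘ₗ
      { toFun e := e.comp c hk
        map_add' _ _ := Ext.add_comp _ _ _ _
        map_smul' _ _ := Ext.smul_comp _ _ _ _ })
    fun t s h e ↦ by
      change of s ((restr a M i t s h e).comp c hk) = of t (e.comp c hk)
      rw [← restr_comp, of_restr]

lemma postcomp_of {M N : ModuleCat.{u} R} {j : ℕ} (c : Abelian.Ext M N j) {i k : ℕ}
    (hk : i + j = k) (t : ℕ) (e : Abelian.Ext (ModuleCat.of R (R ⧸ a ^ t)) M i) :
    postcomp a c hk (of t e) = of t (e.comp c hk) :=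
  Module.DirectLimit.lift_of _ _ _

lemma postcomp_mk₀_injective {S : ShortComplex (ModuleCat.{u} R)} (hS : S.ShortExact) {i : ℕ}
    (h : Vanishes a ⊥ S.X₁ i) : Function.Injective (postcomp a (Ext.mk₀ S.g) (add_zero i)) := by
  refine (injective_iff_map_eq_zero _).2 fun z hz ↦ ?_
  obtain ⟨t, e, rfl⟩ := exists_of z
  rw [postcomp_of] at hz
  obtain ⟨s, hs, h0⟩ := exists_restr_eq_zero hz
  rw [restr_comp] at h0
  obtain ⟨w, hw⟩ := Ext.covariant_sequence_exact₂ _ hS _ h0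
  obtain ⟨q, hq, r, hr, h1⟩ := h s w
  rw [Submonoid.mem_bot.1 hr, one_smul] at h1
  rw [← of_restr hs, ← hw, ← of_restr hq, restr_comp, restr_apply, h1, Ext.zero_comp, map_zero]

lemma exists_pow_smul_eq_zero {x : R} (hx : x ∈ a) {M : ModuleCat.{u} R} {i : ℕ}
    (z : ExtLimit a M i) : ∃ k : ℕ, x ^ k • z = 0 := by
  obtain ⟨t, e, rfl⟩ := exists_of z
  refine ⟨t, ?_⟩
  rw [← map_smul, smul_ext_eq_zero' (pow_smul_quotient_eq_zero hx t) e, map_zero]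

lemma exists_postcomp_extClass_eq {M : Type u} [AddCommGroup M] [Module R M] {x : R}
    (hx : IsSMulRegular M x) {i : ℕ} (z : ExtLimit a (ModuleCat.of R M) (i + 1)) (hz : x • z = 0) :
    ∃ y, postcomp a
      (IsSMulRegular.smulShortComplex_shortExact (M := ModuleCat.of R M) hx).extClass rfl y =
        z := by
  have hS := IsSMulRegular.smulShortComplex_shortExact (M := ModuleCat.of R M) hx
  obtain ⟨t, e, rfl⟩ := exists_of z
  rw [← map_smul] at hz
  obtain ⟨s, hs, h0⟩ := exists_restr_eq_zero hz
  rw [map_smul, Ext.smul_eq_comp_mk₀] at h0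
  obtain ⟨w, hw⟩ := Ext.covariant_sequence_exact₁ _ hS _ h0 rfl
  exact ⟨of s w, (postcomp_of _ _ _ _).trans ((congrArg (of s) hw).trans (of_restr hs e))⟩

lemma exists_surjective_zero {M : Type u} [AddCommGroup M] [Module R M] {G : Submodule R M} {m : ℕ}
    (hG : ∀ b ∈ a ^ m, ∀ x : G, b • x = 0)
    (hG' : ∀ (t : ℕ) (y : M ⧸ G), (∀ b ∈ a ^ t, b • y = 0) → y = 0) :
    ∃ f : G →ₗ[R] ExtLimit a (ModuleCat.of R M) 0, Function.Surjective f := by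
  have hG₀ (g : G) (b) (hb : b ∈ a ^ m) : b • (g : M) = 0 := congrArg Subtype.val (hG b hb g)
  let φ (g : G) : ModuleCat.of R (R ⧸ a ^ m) ⟶ ModuleCat.of R M :=
    ModuleCat.ofHom (Submodule.liftQ (a ^ m) (LinearMap.toSpanSingleton R M g) (hG₀ g))
  have hφ (s : ℕ) (f f' : ModuleCat.of R (R ⧸ a ^ s) ⟶ ModuleCat.of R M)
      (h : f.hom (Submodule.Quotient.mk (1 : R)) = f'.hom (Submodule.Quotient.mk (1 : R))) :
      f = f' := by
    ext1
    exact Submodule.linearMap_qext _ (LinearMap.ext_ring h)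
  have hφ1 (g : G) : (φ g).hom (Submodule.Quotient.mk (1 : R)) = g :=
    one_smul R (g : M)
  let f : G →ₗ[R] ExtLimit a (ModuleCat.of R M) 0 :=
    { toFun g := of m (Ext.mk₀ (φ g))
      map_add' g g' := by
        rw [← map_add, ← Ext.mk₀_add, hφ m (φ (g + g')) (φ g + φ g')]
        rw [ModuleCat.hom_add, LinearMap.add_apply, hφ1, hφ1, hφ1, Submodule.coe_add]
      map_smul' r g := by
        rw [RingHom.id_apply, ← map_smul, ← Ext.mk₀_smul, hφ m (φ (r • g)) (r • φ g)]
        rw [ModuleCat.hom_smul, LinearMap.smul_apply, hφ1, hφ1, Submodule.coe_smul] }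
  refine ⟨f, fun z ↦ ?_⟩
  obtain ⟨t, e, rfl⟩ := exists_of z
  obtain ⟨ψ, rfl⟩ := (Ext.mk₀_bijective _ _).2 e
  have hy : ψ.hom (Submodule.Quotient.mk (1 : R)) ∈ G := by
    rw [← Submodule.Quotient.mk_eq_zero]
    refine hG' t _ fun b hb ↦ ?_
    rw [← Submodule.Quotient.mk_smul, ← map_smul, ← Submodule.Quotient.mk_smul, smul_eq_mul,
      mul_one, (Submodule.Quotient.mk_eq_zero _).2 hb, map_zero, Submodule.Quotient.mk_zero]
  refine ⟨⟨_, hy⟩, ?_⟩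
  change of m (Ext.mk₀ (φ _)) = _
  rw [← of_restr (le_max_left t m), ← of_restr (le_max_right t m), restr_apply, restr_apply,
    Ext.mk₀_comp_mk₀, Ext.mk₀_comp_mk₀]
  congr 2
  exact hφ _ _ _ (hφ1 _)

section Artinian

variable [IsNoetherianRing R] {I p : Ideal R} [p.IsPrime]

/-- If `I` annihilates the finite module `M` and `p` is minimal over `a ⊔ I`, then all local
cohomology modules of `M` are Artinian at `p`. -/
theorem isArtinian_localizedModule (hp : p ∈ (a ⊔ I).minimalPrimes) (i : ℕ) :
    ∀ (M : Type u) [AddCommGroup M] [Module R M] [Module.Finite R M],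
      (∀ r ∈ I, ∀ x : M, r • x = 0) →
      IsArtinian (Localization.AtPrime p)
        (LocalizedModule p.primeCompl (ExtLimit a (ModuleCat.of R M) i)) := by
  induction i with
  | zero =>
    intro M _ _ _ hM
    obtain ⟨G, m, hG, hG'⟩ := exists_torsion_submodule a M
    obtain ⟨f, hf⟩ := exists_surjective_zero hG hG'
    have hp' := Ideal.mem_minimalPrimes_pow_sup m.succ_ne_zero hp
    have := LocalizedModule.isArtinian_of_mem_minimalPrimes (M := G) hp' fun r hr x ↦ by
      obtain ⟨b, hb, c, hc, rfl⟩ := Submodule.mem_sup.1 hr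
      rw [add_smul, hG b (Ideal.pow_le_pow_right m.le_succ hb), zero_add]
      exact Subtype.ext (hM c hc x)
    exact LocalizedModule.isArtinian_of_surjective f hf
  | succ i ih =>
    intro M _ _ _ hM
    obtain ⟨G, m, hG, hG'⟩ := exists_torsion_submodule a M
    have hS := shortExact_of_exact G.injective_subtype G.mkQ_surjective
      (LinearMap.exact_subtype_mkQ G)
    obtain ⟨x, hxa, hx⟩ := exists_isSMulRegular (M := M ⧸ G) (a := a)
      fun y hy ↦ hG' 1 y (by rwa [pow_one])
    have hN (r : R) (hr : r ∈ I) (y : M ⧸ G) : r • y = 0 := by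
      obtain ⟨y, rfl⟩ := G.mkQ_surjective y
      rw [← map_smul, hM r hr, map_zero]
    have : IsArtinian (Localization.AtPrime p) (LocalizedModule p.primeCompl
        (ExtLimit a ((ModuleCat.of R (M ⧸ G)).smulShortComplex x).X₃ i)) :=
        ih (QuotSMulTop x (M ⧸ G)) fun r hr y ↦ by
      obtain ⟨y, rfl⟩ := Submodule.mkQ_surjective _ y
      rw [← map_smul, hN r hr, map_zero]
    have : IsArtinian (Localization.AtPrime p)
        (LocalizedModule p.primeCompl (ExtLimit a (ModuleCat.of R (M ⧸ G)) (i + 1))) :=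
      LocalizedModule.isArtinian_of_ker_le_range _ (fun z ↦ exists_pow_smul_eq_zero hxa z)
        (exists_postcomp_extClass_eq hx)
    exact LocalizedModule.isArtinian_of_injective _
      (postcomp_mk₀_injective hS (vanishes_of_pow_smul_eq_zero hG i))

end Artinian

end ExtLimit

end localCohomology
end

noncomputable section

open CategoryTheory Limits Abelian Pointwise

universe u

namespace localCohomology

variable {R : Type u} [CommRing R] {a : Ideal R} {T : Submonoid R}

namespace ExtLimit

lemma vanishes_iff_forall_smul_eq_zero {M : ModuleCat.{u} R} {i : ℕ} :
    Vanishes a T M i ↔ ∀ z : ExtLimit a M i, ∃ r ∈ T, r • z = 0 := by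
  constructor
  · intro h z
    obtain ⟨t, e, rfl⟩ := exists_of z
    obtain ⟨s, hs, r, hr, h0⟩ := h t e
    exact ⟨r, hr, by rw [← of_restr hs, ← map_smul, restr_apply, h0, map_zero]⟩
  · intro h t e
    obtain ⟨r, hr, h0⟩ := h (of t e)
    rw [← map_smul] at h0
    obtain ⟨s, hs, h0⟩ := exists_restr_eq_zero h0
    exact ⟨s, hs, r, hr, by rw [← h0, map_smul, restr_apply]⟩

section Exact

variable {M N P : Type u} [AddCommGroup M] [Module R M] [AddCommGroup N] [Module R N]
  [AddCommGroup P] [Module R P] {f : M →ₗ[R] N} {g : N →ₗ[R] P}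

lemma exists_postcomp_eq_smul (hf : Function.Injective f) (hg : Function.Surjective g)
    (h : Function.Exact f g) {i : ℕ} (hM : Vanishes a T (ModuleCat.of R M) (i + 1))
    (z : ExtLimit a (ModuleCat.of R P) i) :
    ∃ r ∈ T, ∃ y : ExtLimit a (ModuleCat.of R N) i,
      postcomp a (Ext.mk₀ (ModuleCat.ofHom g)) (add_zero i) y = r • z := by
  have hS := shortExact_of_exact hf hg h
  obtain ⟨t, e, rfl⟩ := exists_of z
  obtain ⟨s, hs, r, hr, h0⟩ := hM t (e.comp hS.extClass rfl)
  rw [← restr_apply, restr_comp, ← Ext.smul_comp] at h0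
  obtain ⟨w, hw⟩ := Ext.covariant_sequence_exact₃ _ hS _ rfl h0
  exact ⟨r, hr, of s w, by rw [postcomp_of, hw, map_smul, of_restr]⟩

lemma exists_postcomp_eq (hf : Function.Injective f) (hg : Function.Surjective g)
    (h : Function.Exact f g) {i : ℕ} (hP : Vanishes a ⊥ (ModuleCat.of R P) i)
    (z : ExtLimit a (ModuleCat.of R N) i) :
    ∃ y : ExtLimit a (ModuleCat.of R M) i,
      postcomp a (Ext.mk₀ (ModuleCat.ofHom f)) (add_zero i) y = z := by
  have hS := shortExact_of_exact hf hg h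
  obtain ⟨t, e, rfl⟩ := exists_of z
  obtain ⟨s, hs, r, hr, h0⟩ := hP t (e.comp (Ext.mk₀ (ModuleCat.ofHom g)) (add_zero i))
  rw [Submonoid.mem_bot.1 hr, one_smul, ← restr_apply, restr_comp] at h0
  obtain ⟨w, hw⟩ := Ext.covariant_sequence_exact₂ _ hS _ h0
  exact ⟨of s w, by rw [postcomp_of, hw, of_restr]⟩

end Exact

lemma postcomp_postcomp {M N P : ModuleCat.{u} R} (f : M ⟶ N) (g : N ⟶ P) {i : ℕ}
    (z : ExtLimit a M i) :
    postcomp a (Ext.mk₀ g) (add_zero i) (postcomp a (Ext.mk₀ f) (add_zero i) z) =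
      postcomp a (Ext.mk₀ (f ≫ g)) (add_zero i) z := by
  obtain ⟨t, e, rfl⟩ := exists_of z
  rw [postcomp_of, postcomp_of, postcomp_of, ← Ext.mk₀_comp_mk₀,
    Ext.comp_assoc _ _ _ _ (zero_add 0) (by lia)]

variable {M : Type u} [AddCommGroup M] [Module R M] {N : Type u} [AddCommGroup N] [Module R N]

lemma smul_eq_zero {r : R} (hr : ∀ y : M, r • y = 0) {i : ℕ}
    (z : ExtLimit a (ModuleCat.of R M) i) : r • z = 0 := by
  obtain ⟨t, e, rfl⟩ := exists_of z
  rw [← map_smul, smul_ext_eq_zero hr e, map_zero]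

lemma postcomp_sum_smul_mem {ι : Type*} (s : Finset ι) (x : ι → R) (hx : ∀ j, x j ∈ a)
    (f : ι → N →ₗ[R] M) {i : ℕ} (z : ExtLimit a (ModuleCat.of R N) i) :
    postcomp a (Ext.mk₀ (ModuleCat.ofHom (∑ j ∈ s, x j • f j))) (add_zero i) z ∈
      a • (⊤ : Submodule R (ExtLimit a (ModuleCat.of R M) i)) := by
  classical
  obtain ⟨t, e, rfl⟩ := exists_of z
  rw [postcomp_of]
  induction s using Finset.induction_on with
  | empty =>
    rw [Finset.sum_empty, ModuleCat.ofHom_zero, Ext.mk₀_zero, Ext.comp_zero, map_zero]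
    exact zero_mem _
  | insert j s hj ih =>
    have hsmul : ModuleCat.ofHom (x j • f j) = x j • ModuleCat.ofHom (f j) := rfl
    rw [Finset.sum_insert hj, ModuleCat.ofHom_add, hsmul, Ext.mk₀_add, Ext.mk₀_smul,
      Ext.comp_add, Ext.comp_smul, map_add, map_smul]
    exact add_mem (Submodule.smul_mem_smul (hx j) trivial) ih

lemma exists_surjective_smul_top (M : Type u) [AddCommGroup M] [Module R M] (ha : a.FG) :
    ∃ (k : ℕ) (x : Fin k → R) (ψ : (Fin k → M) →ₗ[R] (a • ⊤ : Submodule R M)),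
      (∀ j, x j ∈ a) ∧ Function.Surjective ψ ∧
      (a • ⊤ : Submodule R M).subtype ∘ₗ ψ = ∑ j, x j • LinearMap.proj j := by
  obtain ⟨k, x, hx⟩ := Submodule.fg_iff_exists_fin_generating_family.1 ha
  have hxa (j) : x j ∈ a := by
    rw [← hx]
    exact Submodule.subset_span ⟨j, rfl⟩
  let φ : (Fin k → M) →ₗ[R] M := ∑ j, x j • LinearMap.proj j
  have hφ (v : Fin k → M) : φ v = ∑ j, x j • v j := by
    simp [φ]
  have hK (v : Fin k → M) : φ v ∈ (a • ⊤ : Submodule R M) := by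
    rw [hφ]
    exact sum_mem fun j _ ↦ Submodule.smul_mem_smul (hxa j) trivial
  refine ⟨k, x, φ.codRestrict _ hK, hxa, ?_, LinearMap.ext fun _ ↦ rfl⟩
  rintro ⟨y, hy⟩
  suffices (a • ⊤ : Submodule R M) ≤ LinearMap.range φ by
    obtain ⟨v, hv⟩ := this hy
    exact ⟨v, Subtype.ext hv⟩
  refine Submodule.smul_le.2 fun b hb m _ ↦ ?_
  rw [← hx, Submodule.mem_span_range_iff_exists_fun] at hb
  obtain ⟨c, rfl⟩ := hb
  refine ⟨fun j ↦ c j • m, ?_⟩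
  rw [hφ, Finset.sum_smul]
  exact Finset.sum_congr rfl fun j _ ↦ by rw [smul_smul, smul_eq_mul, mul_comm]

variable [IsNoetherianRing R] [Module.Finite R M]

/-- If `H_a^{n+1}` vanishes on all finite modules annihilated by the annihilator of `M`, then
`a H_a^n(M) = H_a^n(M)` for `n > 0`. -/
lemma exists_smul_mem_smul_top {i : ℕ}
    (h : ∀ (N : Type u) [AddCommGroup N] [Module R N] [Module.Finite R N],
      (∀ r ∈ Module.annihilator R M, ∀ y : N, r • y = 0) →
      Vanishes a T (ModuleCat.of R N) (i + 1 + 1))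
    (z : ExtLimit a (ModuleCat.of R M) (i + 1)) :
    ∃ r ∈ T, r • z ∈ a • (⊤ : Submodule R (ExtLimit a (ModuleCat.of R M) (i + 1))) := by
  obtain ⟨k, x, ψ, hxa, hψ, hψ'⟩ := exists_surjective_smul_top M (IsNoetherian.noetherian a)
  generalize hK : (a • ⊤ : Submodule R M) = K at ψ hψ hψ'
  have hV : Vanishes a ⊥ (ModuleCat.of R (M ⧸ K)) (i + 1) :=
    vanishes_of_pow_smul_eq_zero (m := 1) (fun b hb y ↦ by
      obtain ⟨y, rfl⟩ := K.mkQ_surjective y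
      rw [pow_one] at hb
      rw [← map_smul, Submodule.mkQ_apply, Submodule.Quotient.mk_eq_zero, ← hK]
      exact Submodule.smul_mem_smul hb trivial) i
  have hV' : Vanishes a T (ModuleCat.of R (LinearMap.ker ψ)) (i + 1 + 1) :=
    h (LinearMap.ker ψ) fun r hr y ↦ Subtype.ext (funext fun j ↦
      Module.mem_annihilator.1 hr ((y : Fin k → M) j))
  obtain ⟨w, rfl⟩ := exists_postcomp_eq K.injective_subtype K.mkQ_surjective
    (LinearMap.exact_subtype_mkQ K) hV z
  obtain ⟨r, hr, y, hy⟩ := exists_postcomp_eq_smul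
    (LinearMap.ker ψ).injective_subtype hψ (LinearMap.exact_subtype_ker_map ψ) hV' w
  refine ⟨r, hr, ?_⟩
  have key := postcomp_sum_smul_mem (a := a) Finset.univ x hxa
    (fun j ↦ LinearMap.proj (R := R) (φ := fun _ : Fin k ↦ M) j) y
  have hz := (postcomp_postcomp (a := a) (ModuleCat.ofHom ψ) (ModuleCat.ofHom K.subtype) y).trans
    (congrArg (fun f ↦ postcomp a (Ext.mk₀ (ModuleCat.ofHom f)) (add_zero (i + 1)) y) hψ')
  rw [hy, map_smul] at hz
  rw [hz]
  exact key

end ExtLimit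

/-- If `H_a^{i}` vanishes at `p` for `i > n > 0` on all finite modules annihilated by the
annihilator of `M`, and `p` is minimal over `a + ann M`, then `H_a^n(M ⧸ xM)` vanishes at `p` for
some `x ∈ a`. -/
lemma exists_vanishes_quotSMulTop [IsNoetherianRing R] {M : Type u} [AddCommGroup M] [Module R M]
    [Module.Finite R M] {p : Ideal R} [p.IsPrime]
    (hp : p ∈ (a ⊔ Module.annihilator R M).minimalPrimes) {i : ℕ}
    (h : ∀ (N : Type u) [AddCommGroup N] [Module R N] [Module.Finite R N],
      (∀ r ∈ Module.annihilator R M, ∀ y : N, r • y = 0) →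
      Vanishes a p.primeCompl (ModuleCat.of R N) (i + 1 + 1)) :
    ∃ x ∈ a, Vanishes a p.primeCompl (ModuleCat.of R (QuotSMulTop x M)) (i + 1) := by
  have := ExtLimit.isArtinian_localizedModule hp (i + 1) M fun r hr ↦ Module.mem_annihilator.1 hr
  obtain ⟨x, hxa, hx⟩ := LocalizedModule.exists_forall_exists_smul_eq (T := p.primeCompl)
    (IsNoetherian.noetherian a) (ExtLimit.exists_smul_mem_smul_top h)
  refine ⟨x, hxa, ExtLimit.vanishes_iff_forall_smul_eq_zero.2 fun z ↦ ?_⟩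
  let K : Submodule R M := x • ⊤
  obtain ⟨r, hr, y, hy⟩ := ExtLimit.exists_postcomp_eq_smul (i := i + 1)
    K.injective_subtype K.mkQ_surjective (LinearMap.exact_subtype_mkQ K)
    (h K fun r hr y ↦ Subtype.ext (Module.mem_annihilator.1 hr (y : M))) z
  obtain ⟨s, hs, w, hw⟩ := hx y
  refine ⟨s * r, mul_mem hs hr, ?_⟩
  rw [mul_smul]
  refine (congrArg (s • ·) hy.symm).trans ?_
  rw [← map_smul, hw, map_smul]
  refine ExtLimit.smul_eq_zero (fun y ↦ ?_) _
  obtain ⟨y, rfl⟩ := K.mkQ_surjective y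
  rw [← map_smul, Submodule.mkQ_apply, Submodule.Quotient.mk_eq_zero]
  exact Submodule.smul_mem_pointwise_smul _ _ _ trivial

end localCohomology
end

section

open Pointwise

namespace LocalizedModule

variable {R : Type*} [CommRing R] {T : Submonoid R} {M : Type*} [AddCommGroup M] [Module R M]

lemma map_lsmul_apply (x : R) (z : LocalizedModule T M) :
    LocalizedModule.map T (LinearMap.lsmul R M x) z = algebraMap R (Localization T) x • z := by
  induction z using LocalizedModule.induction_on with
  | h m s =>
    rw [algebraMap_smul, LocalizedModule.smul'_mk]
    exact IsLocalizedModule.map_LocalizedModules T (LinearMap.lsmul R M x) m s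

lemma isSMulRegular {x : R} (hx : IsSMulRegular M x) :
    IsSMulRegular (LocalizedModule T M) (algebraMap R (Localization T) x) := fun y z h ↦
  IsLocalizedModule.map_injective T (LocalizedModule.mkLinearMap T M)
    (LocalizedModule.mkLinearMap T M) (LinearMap.lsmul R M x) hx
    ((map_lsmul_apply x y).trans (h.trans (map_lsmul_apply x z).symm))

variable (T M) in
/-- Localization commutes with the quotient by `xM`. -/
lemma nonempty_quotSMulTop_equiv (x : R) :
    Nonempty (QuotSMulTop (algebraMap R (Localization T) x) (LocalizedModule T M)
      ≃ₗ[Localization T] LocalizedModule T (QuotSMulTop x M)) := by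
  let K : Submodule R M := x • ⊤
  let g : LocalizedModule T M →ₗ[Localization T] LocalizedModule T (QuotSMulTop x M) :=
    LocalizedModule.map T K.mkQ
  have hg : Function.Surjective g :=
    IsLocalizedModule.map_surjective T _ _ K.mkQ K.mkQ_surjective
  have hex : Function.Exact (LocalizedModule.map T (LinearMap.lsmul R M x)) g :=
    LocalizedModule.map_exact T _ _ fun y ↦ by
      rw [Submodule.mkQ_apply, Submodule.Quotient.mk_eq_zero,
        Submodule.mem_smul_pointwise_iff_exists]
      simp
  have hker : LinearMap.ker g =
      algebraMap R (Localization T) x • (⊤ : Submodule (Localization T) (LocalizedModule T M)) := by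
    ext z
    rw [LinearMap.mem_ker, hex z, Submodule.mem_smul_pointwise_iff_exists]
    exact ⟨fun ⟨y, hy⟩ ↦ ⟨y, trivial, (map_lsmul_apply x y).symm.trans hy⟩,
      fun ⟨y, _, hy⟩ ↦ ⟨y, (map_lsmul_apply x y).trans hy⟩⟩
  exact ⟨(Submodule.quotEquivOfEq _ _ hker.symm).trans (g.quotKerEquivOfSurjective hg)⟩

end LocalizedModule

namespace Module

variable {R : Type*} [CommRing R] [IsNoetherianRing R] {M : Type*} [AddCommGroup M] [Module R M]
  [Module.Finite R M] {p : Ideal R} [p.IsPrime] {x : R}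

lemma supportDim_localizedModule_le_quotSMulTop_add_one (hx : x ∈ p) :
    supportDim (Localization.AtPrime p) (LocalizedModule p.primeCompl M) ≤
      supportDim (Localization.AtPrime p) (LocalizedModule p.primeCompl (QuotSMulTop x M)) + 1 := by
  obtain ⟨e⟩ := LocalizedModule.nonempty_quotSMulTop_equiv p.primeCompl M x
  rw [← supportDim_eq_of_equiv e]
  refine supportDim_le_supportDim_quotSMulTop_succ ?_
  exact (IsLocalization.AtPrime.to_map_mem_maximal_iff _ p x).2 hx

lemma supportDim_localizedModule_quotSMulTop_add_one (hx : x ∈ p) (hreg : IsSMulRegular M x) :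
    supportDim (Localization.AtPrime p) (LocalizedModule p.primeCompl (QuotSMulTop x M)) + 1 =
      supportDim (Localization.AtPrime p) (LocalizedModule p.primeCompl M) := by
  obtain ⟨e⟩ := LocalizedModule.nonempty_quotSMulTop_equiv p.primeCompl M x
  rw [← supportDim_eq_of_equiv e]
  exact supportDim_quotSMulTop_succ_eq_supportDim (LocalizedModule.isSMulRegular hreg)
    ((IsLocalization.AtPrime.to_map_mem_maximal_iff _ p x).2 hx)

end Module
end

noncomputable section

open CategoryTheory Limits Abelian Pointwise

universe u

namespace localCohomology

variable {R : Type u} [CommRing R] [IsNoetherianRing R] {a : Ideal R}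
  {p : PrimeSpectrum R}

/-- The dimension of `M` at a minimal prime of `a + ann M` is at most the cohomological dimension
of `M` at that prime. -/
theorem supportDim_localizedModule_le [IsLocalRing R] (ha : a ≤ p.asIdeal) (n : ℕ) :
    ∀ (M : Type u) [AddCommGroup M] [Module R M] [Module.Finite R M],
      (∀ i, n < i → Vanishes a p.asIdeal.primeCompl (ModuleCat.of R M) i) →
      (∀ q : Ideal R, q.IsPrime → a ≤ q → Module.annihilator R M ≤ q → q ≤ p.asIdeal →
        p.asIdeal ≤ q) →
      Module.supportDim (Localization.AtPrime p.asIdeal)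
        (LocalizedModule p.asIdeal.primeCompl M) ≤ n := by
  have ham : a ≤ IsLocalRing.maximalIdeal R := ha.trans (IsLocalRing.le_maximalIdeal p.2.ne_top)
  induction n with
  | zero =>
    intro M _ _ _ hV hmin
    obtain ⟨G, m, hG, hG'⟩ := exists_torsion_submodule a M
    have hV' (i : ℕ) : Vanishes a p.asIdeal.primeCompl (ModuleCat.of R (M ⧸ G)) i := by
      cases i with
      | zero => exact vanishes_zero_of_forall hG'
      | succ i =>
        exact Vanishes.of_exact_right G.injective_subtype G.mkQ_surjective
          (LinearMap.exact_subtype_mkQ G) (hV _ i.succ_pos)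
          (vanishes_of_pow_smul_eq_zero hG (i + 1))
    obtain ⟨d, hd⟩ := exists_nat_supportDim_lt (R := R)
    have hsub := Module.notMem_support_iff.1 (notMem_support_of_vanishes ha d (M ⧸ G) (hd _) hV')
    have hsurj : Function.Surjective (LocalizedModule.map p.asIdeal.primeCompl G.subtype) :=
      fun z ↦ (LocalizedModule.map_exact p.asIdeal.primeCompl _ _
        (LinearMap.exact_subtype_mkQ G) z).1 (Subsingleton.elim _ _)
    refine (Module.supportDim_le_of_surjective _ hsurj).trans ?_
    by_cases hann : Module.annihilator R M ≤ p.asIdeal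
    · have hp : p.asIdeal ∈ (a ⊔ Module.annihilator R M).minimalPrimes :=
        ⟨⟨p.2, sup_le ha hann⟩, fun q hq hle ↦
          hmin q hq.1 (le_sup_left.trans hq.2) (le_sup_right.trans hq.2) hle⟩
      refine LocalizedModule.supportDim_le_zero_of_mem_minimalPrimes
        (Ideal.mem_minimalPrimes_pow_sup m.succ_ne_zero hp) fun r hr x ↦ ?_
      obtain ⟨b, hb, c, hc, rfl⟩ := Submodule.mem_sup.1 hr
      rw [add_smul, hG b (Ideal.pow_le_pow_right m.le_succ hb), zero_add]
      exact Subtype.ext (Module.mem_annihilator.1 hc x)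
    · have : Subsingleton (LocalizedModule p.asIdeal.primeCompl G) :=
        Module.notMem_support_iff.1 fun h ↦ hann
          ((LinearMap.annihilator_le_of_injective _ G.injective_subtype).trans
            (Module.mem_support_iff_of_finite.1 h))
      rw [Module.supportDim_eq_bot_of_subsingleton]
      exact bot_le
  | succ n ih =>
    intro M _ _ _ hV hmin
    by_cases hann : Module.annihilator R M ≤ p.asIdeal
    · have hp : p.asIdeal ∈ (a ⊔ Module.annihilator R M).minimalPrimes :=
        ⟨⟨p.2, sup_le ha hann⟩, fun q hq hle ↦
          hmin q hq.1 (le_sup_left.trans hq.2) (le_sup_right.trans hq.2) hle⟩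
      obtain ⟨x, hxa, hx⟩ := exists_vanishes_quotSMulTop hp (i := n) fun N _ _ _ hN ↦
        vanishes_of_annihilator ham hV (by lia) hN
      have hann' (r) (hr : r ∈ Module.annihilator R M) (y : QuotSMulTop x M) : r • y = 0 := by
        obtain ⟨y, rfl⟩ := Submodule.mkQ_surjective _ y
        rw [← map_smul, Module.mem_annihilator.1 hr, map_zero]
      refine (Module.supportDim_localizedModule_le_quotSMulTop_add_one (ha hxa)).trans ?_
      push_cast
      refine add_le_add_left (ih (QuotSMulTop x M) (fun i hi ↦ ?_) fun q hq haq hq' hle ↦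
        hmin q hq haq (fun r hr ↦ hq' (Module.mem_annihilator.2 (hann' r hr))) hle) 1
      obtain rfl | hi' := (Nat.succ_le_of_lt hi).eq_or_lt
      · exact hx
      · exact vanishes_of_annihilator ham hV hi' hann'
    · have : Subsingleton (LocalizedModule p.asIdeal.primeCompl M) :=
        Module.notMem_support_iff.1 fun h ↦ hann (Module.mem_support_iff_of_finite.1 h)
      rw [Module.supportDim_eq_bot_of_subsingleton]
      exact bot_le

/-- The dimension of `M` at a prime containing `a` is at least the grade of `a` on `M`. -/
theorem le_supportDim_localizedModule (ha : a ≤ p.asIdeal) (n : ℕ) :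
    ∀ (M : Type u) [AddCommGroup M] [Module R M] [Module.Finite R M],
      (∀ i, i < n → Vanishes a ⊥ (ModuleCat.of R M) i) → p ∈ Module.support R M →
      n ≤ Module.supportDim (Localization.AtPrime p.asIdeal)
        (LocalizedModule p.asIdeal.primeCompl M) := by
  induction n with
  | zero =>
    intro M _ _ _ _ hp
    have := Module.mem_support_iff.1 hp
    have := Module.nonempty_support_of_nontrivial (R := Localization.AtPrime p.asIdeal)
      (M := LocalizedModule p.asIdeal.primeCompl M)
    have := this.to_subtype
    exact Order.krullDim_nonneg
  | succ n ih =>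
    intro M _ _ _ hV hp
    obtain ⟨x, hxa, hx⟩ := (hV 0 n.succ_pos).exists_isSMulRegular
    have := ih (QuotSMulTop x M) (fun i hi ↦ (hV i (by lia)).quotSMulTop hx (hV (i + 1) (by lia)))
      (by
        rw [Module.support_quotSMulTop]
        exact ⟨hp, by simpa using ha hxa⟩)
    rw [← Module.supportDim_localizedModule_quotSMulTop_add_one (ha hxa) hx]
    push_cast
    exact add_le_add_left this 1

end localCohomology
end

noncomputable section

open CategoryTheory

universe u

namespace localCohomology

variable {R : Type u} [CommRing R] {a : Ideal R}
  {M : Type u} [AddCommGroup M] [Module R M] [Module.Finite R M]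

lemma support_subset_support_quotient (i : ℕ) :
    Module.support R ((localCohomology a i).obj (ModuleCat.of R M)) ⊆
      Module.support R (M ⧸ (a • (⊤ : Submodule R M))) := by
  intro p hp
  rw [Module.support_quotient]
  by_contra hp'
  refine vanishes_primeCompl_iff a p _ i |>.1 ?_ hp
  by_cases hpM : p ∈ Module.support R M
  · obtain ⟨r, hra, hr⟩ := SetLike.not_le_iff_exists.1 fun h : a ≤ p.asIdeal ↦ hp' ⟨hpM, h⟩
    exact vanishes_of_mem_of_mem hr hra _ i
  · rw [Module.mem_support_iff_of_finite] at hpM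
    obtain ⟨r, hrM, hr⟩ := SetLike.not_le_iff_exists.1 hpM
    exact vanishes_of_smul_eq_zero (T := p.asIdeal.primeCompl) hr
      (fun x ↦ Module.mem_annihilator.1 hrM x) i

variable [IsNoetherianRing R] [IsLocalRing R] {n : ℕ}

lemma support_eq_support_quotient
    (h : ∀ i, i ≠ n → Subsingleton ((localCohomology a i).obj (ModuleCat.of R M))) :
    Module.support R ((localCohomology a n).obj (ModuleCat.of R M)) =
      Module.support R (M ⧸ (a • (⊤ : Submodule R M))) := by
  refine (support_subset_support_quotient n).antisymm fun p hp ↦ ?_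
  rw [Module.support_quotient] at hp
  by_contra hp'
  obtain ⟨d, hd⟩ := exists_nat_supportDim_lt (R := R)
  refine notMem_support_of_vanishes hp.2 d M (hd M) (fun i ↦ ?_) hp.1
  obtain rfl | hi := eq_or_ne i n
  · exact (vanishes_primeCompl_iff a p _ i).2 hp'
  · exact ((vanishes_bot_iff a _ i).2 (h i hi)).mono bot_le

end localCohomology

lemma moduleKrullDim_eq_supportDim {S N : Type u} [CommRing S] [AddCommGroup N] [Module S N]
    [Module.Finite S N] : moduleKrullDim S N = Module.supportDim S N :=
  (Module.supportDim_eq_ringKrullDim_quotient_annihilator S N).symm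

variable {R : Type u} [CommRing R] {a : Ideal R} {n : ℕ}

lemma IsRelativeCMAt.lcGrade_eq {M : ModuleCat.{u} R} (h : IsRelativeCMAt R a n M) :
    lcGrade R a M = n := by
  have : {i | Nontrivial ((localCohomology a i).obj M)} = {n} := by
    ext i
    refine ⟨fun hi ↦ ?_, fun hi ↦ hi ▸ h.1⟩
    by_contra hin
    exact not_subsingleton_iff_nontrivial.2 hi (h.2 i hin)
  rw [lcGrade, this, csInf_singleton]

variable [IsNoetherianRing R] [IsLocalRing R] {M : Type u} [AddCommGroup M] [Module R M]
  [Module.Finite R M]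

lemma IsRelativeCMAt.heightWRT_eq (h : IsRelativeCMAt R a n (ModuleCat.of R M)) :
    heightWRT R a M = n := by
  have hsupp := localCohomology.support_eq_support_quotient h.2
  refine le_antisymm ?_ (le_iInf₂ fun p hp ↦ ?_)
  · have := h.1
    obtain ⟨q, hq⟩ := Module.nonempty_support_of_nontrivial (R := R)
      (M := (localCohomology a n).obj (ModuleCat.of R M))
    rw [hsupp, Module.support_quotient] at hq
    obtain ⟨p, hp, -⟩ := Ideal.exists_minimalPrimes_le (J := q.asIdeal)
      (sup_le hq.2 (Module.mem_support_iff_of_finite.1 hq.1))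
    have hpp := hp.1.1
    have hap := le_sup_left.trans hp.1.2
    refine (iInf₂_le ⟨p, hpp⟩ ?_).trans ?_
    · rw [Module.support_quotient]
      exact ⟨Module.mem_support_iff_of_finite.2 (le_sup_right.trans hp.1.2), hap⟩
    · rw [moduleKrullDim_eq_supportDim]
      exact localCohomology.supportDim_localizedModule_le (p := ⟨p, hpp⟩) hap n M
        (fun i hi ↦ ((localCohomology.vanishes_bot_iff a _ i).2 (h.2 i hi.ne')).mono bot_le)
        fun q hq haq hMq hle ↦ hp.2 ⟨hq, sup_le haq hMq⟩ hle
  · rw [Module.support_quotient] at hp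
    rw [moduleKrullDim_eq_supportDim]
    exact localCohomology.le_supportDim_localizedModule hp.2 n M
      (fun i hi ↦ (localCohomology.vanishes_bot_iff a _ i).2 (h.2 i hi.ne)) hp.1

end

noncomputable section
open CategoryTheory TensorProduct

/-- If `M` is relative Cohen-Macaulay with respect to `a` with
`cd(a,M) = n`, then `Supp H_a^n(M) = Supp (M / aM)` and `ht_M(a) = grade(a,M)`. -/
theorem stmt_5 (R : Type u) [CommRing R] [IsNoetherianRing R] [IsLocalRing R]
    (a : Ideal R) (M : Type u) [AddCommGroup M] [Module R M] [Module.Finite R M]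
    (n : ℕ) (hRCM : IsRelativeCMAt R a n (ModuleCat.of R M)) :
    Module.support R ↥((localCohomology a n).obj (ModuleCat.of R M)) =
      Module.support R (M ⧸ (a • (⊤ : Submodule R M))) ∧
    heightWRT R a M = ((lcGrade R a (ModuleCat.of R M) : ℕ∞) : WithBot ℕ∞) := by
  refine ⟨localCohomology.support_eq_support_quotient hRCM.2, ?_⟩
  rw [hRCM.heightWRT_eq, hRCM.lcGrade_eq]
  rfl

end
end

section
/- Let (R,m) be a Noetherian local ring, let C be a semidualizing R-module, and let M be a finitely generated R-module which is relative Cohen-Macaulay with respect to an ideal a of R with ht_M(a) = n. Then the C-injective dimension of H_a^n(M) satisfies C-id_R H_a^n(M) ≤ C-id_R(M) − n. -/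
noncomputable section

open CategoryTheory TensorProduct Limits Opposite

universe u

namespace RelativeCM

section Torsion

variable {R : Type u} [CommRing R] (a : Ideal R)
variable {M N X : Type u} [AddCommGroup M] [Module R M] [AddCommGroup N] [Module R N]
  [AddCommGroup X] [Module R X]

lemma mem_idealTorsion_iff {x : M} :
    x ∈ idealTorsion R a M ↔ ∃ k : ℕ, ∀ r ∈ a ^ k, r • x = 0 := by
  have hdir : Directed (· ≤ ·)
      (fun n : ℕ => Submodule.torsionBySet R M ((a ^ n : Ideal R) : Set R)) := by
    refine Monotone.directed_le fun i j hij x hx => ?_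
    rw [Submodule.mem_torsionBySet_iff] at hx ⊢
    rintro ⟨r, hr⟩
    exact hx ⟨r, Ideal.pow_le_pow_right hij hr⟩
  simp only [idealTorsion, Submodule.mem_iSup_of_directed _ hdir, Submodule.mem_torsionBySet_iff,
    Subtype.forall, SetLike.mem_coe]

lemma map_mem_idealTorsion (f : M →ₗ[R] N) {x : M} (hx : x ∈ idealTorsion R a M) :
    f x ∈ idealTorsion R a N := by
  rw [mem_idealTorsion_iff] at hx ⊢
  obtain ⟨k, hk⟩ := hx
  exact ⟨k, fun r hr => by rw [← map_smul, hk r hr, map_zero]⟩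

lemma mem_idealTorsion_of_injective {f : M →ₗ[R] N} (hf : Function.Injective f) {x : M}
    (hx : f x ∈ idealTorsion R a N) : x ∈ idealTorsion R a M := by
  rw [mem_idealTorsion_iff] at hx ⊢
  obtain ⟨k, hk⟩ := hx
  exact ⟨k, fun r hr => hf (by rw [map_smul, hk r hr, map_zero])⟩

/-- The map induced on `a`-torsion submodules by a linear map. -/
def torsionMap (f : M →ₗ[R] N) : idealTorsion R a M →ₗ[R] idealTorsion R a N :=
  f.restrict fun _ hx => map_mem_idealTorsion a f hx

@[simp]
lemma coe_torsionMap (f : M →ₗ[R] N) (x : idealTorsion R a M) :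
    (torsionMap a f x : N) = f x := rfl

lemma torsionMap_injective {f : M →ₗ[R] N} (hf : Function.Injective f) :
    Function.Injective (torsionMap a f) := fun _ _ h =>
  Subtype.ext (hf (congrArg Subtype.val h))

lemma torsionMap_exact {f : M →ₗ[R] X} {g : X →ₗ[R] N} (hf : Function.Injective f)
    (h : Function.Exact f g) : Function.Exact (torsionMap a f) (torsionMap a g) := by
  intro x
  constructor
  · intro hx
    obtain ⟨y, hy⟩ := (h x).1 (congrArg Subtype.val hx)
    exact ⟨⟨y, mem_idealTorsion_of_injective a hf (hy ▸ x.2)⟩, Subtype.ext hy⟩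
  · rintro ⟨y, rfl⟩
    exact Subtype.ext ((h _).2 ⟨y, rfl⟩)

/-- Isomorphic modules have isomorphic `a`-torsion submodules. -/
def torsionEquiv (e : M ≃ₗ[R] N) : idealTorsion R a M ≃ₗ[R] idealTorsion R a N :=
  LinearEquiv.ofLinearMap (torsionMap a e.toLinearMap) (torsionMap a e.symm.toLinearMap)
    (by ext x; simp) (by ext x; simp)

lemma exists_pow_smul_eq_zero_of_fg {L : Submodule R M} (hL : L.FG)
    (h : L ≤ idealTorsion R a M) : ∃ k : ℕ, ∀ r ∈ a ^ k, ∀ x ∈ L, r • x = 0 := by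
  obtain ⟨s, rfl⟩ := hL
  have hs : ∀ x ∈ s, ∃ k : ℕ, ∀ r ∈ a ^ k, r • x = 0 := fun x hx =>
    (mem_idealTorsion_iff a).1 (h (Submodule.subset_span hx))
  choose! k hk using hs
  refine ⟨s.sup k, fun r hr x hx => ?_⟩
  refine Submodule.span_induction (p := fun x _ => r • x = 0) ?_ (smul_zero r) ?_ ?_ hx
  · exact fun x hx => hk x hx r (Ideal.pow_le_pow_right (Finset.le_sup hx) hr)
  · intro x y _ _ hx hy
    rw [smul_add, hx, hy, add_zero]
  · intro t x _ hx
    rw [smul_comm, hx, smul_zero]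

lemma mem_idealTorsion_linearMap_iff [Module.Finite R N] (φ : N →ₗ[R] M) :
    φ ∈ idealTorsion R a (N →ₗ[R] M) ↔ ∀ x, φ x ∈ idealTorsion R a M := by
  constructor
  · intro h x
    exact map_mem_idealTorsion a (LinearMap.applyₗ x) h
  · intro h
    obtain ⟨k, hk⟩ := exists_pow_smul_eq_zero_of_fg a (L := LinearMap.range φ)
      (LinearMap.range_eq_map φ ▸ Module.Finite.fg_top.map φ) (by
        rintro _ ⟨x, rfl⟩; exact h x)
    exact (mem_idealTorsion_iff a).2 ⟨k, fun r hr => LinearMap.ext fun x => hk r hr _ ⟨x, rfl⟩⟩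

/-- For finite `N`, torsion in `Hom(N, M)` is `Hom(N, torsion of M)`. -/
def torsionLinearMapEquiv [Module.Finite R N] :
    idealTorsion R a (N →ₗ[R] M) ≃ₗ[R] (N →ₗ[R] idealTorsion R a M) where
  toFun φ := φ.1.codRestrict _ ((mem_idealTorsion_linearMap_iff a φ.1).1 φ.2)
  invFun ψ := ⟨(idealTorsion R a M).subtype ∘ₗ ψ,
    (mem_idealTorsion_linearMap_iff a _).2 fun x => (ψ x).2⟩
  map_add' _ _ := rfl
  map_smul' _ _ := rfl
  left_inv _ := rfl
  right_inv _ := rfl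

end Torsion

section Injective

variable {R : Type u} [CommRing R] {M N X : Type u} [AddCommGroup M] [Module R M]
  [AddCommGroup N] [Module R N] [AddCommGroup X] [Module R X]

/-- A map into an injective module factors through any map with smaller kernel. -/
lemma exists_comp_eq_of_ker_le [Module.Injective R X] (u : M →ₗ[R] N) (g : M →ₗ[R] X)
    (h : LinearMap.ker u ≤ LinearMap.ker g) : ∃ v : N →ₗ[R] X, v ∘ₗ u = g := by
  obtain ⟨v, hv⟩ := Module.Injective.out ((LinearMap.ker u).liftQ u le_rfl)
    (LinearMap.ker_eq_bot.1 (Submodule.ker_liftQ_eq_bot _ _ _ le_rfl))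
    ((LinearMap.ker u).liftQ g h)
  exact ⟨v, LinearMap.ext fun x => hv (Submodule.Quotient.mk x)⟩

lemma injective_of_retract [Module.Injective R X] (s : N →ₗ[R] X) (r : X →ₗ[R] N)
    (h : ∀ x, r (s x) = x) : Module.Injective R N where
  out Y Z _ _ _ _ f hf g := by
    obtain ⟨v, hv⟩ := Module.Injective.out f hf (s ∘ₗ g)
    exact ⟨r ∘ₗ v, fun x => by simp [hv, h]⟩

variable (a : Ideal R)

instance injective_idealTorsion [IsNoetherianRing R] [Module.Injective R M] :
    Module.Injective R (idealTorsion R a M) := by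
  refine Module.Baer.injective fun J g => ?_
  obtain ⟨k, hk⟩ := exists_pow_smul_eq_zero_of_fg a
    (L := LinearMap.range ((idealTorsion R a M).subtype ∘ₗ g))
    (LinearMap.range_eq_map ((idealTorsion R a M).subtype ∘ₗ g) ▸
      (Module.Finite.fg_top.map _)) (by
        rintro _ ⟨x, rfl⟩; exact (g x).2)
  obtain ⟨c, hc⟩ := Ideal.exists_pow_inf_eq_pow_smul a (M := R) J
  have hzero : ∀ x : R, x ∈ J → x ∈ a ^ (c + k) → ∃ hx : x ∈ J, g ⟨x, hx⟩ = 0 := by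
    intro x hx hxa
    have hmem : x ∈ a ^ k • J := by
      have h1 : x ∈ a ^ (c + k) • (⊤ : Submodule R R) ⊓ J := ⟨by simpa using hxa, hx⟩
      rw [hc (c + k) (Nat.le_add_right _ _), Nat.add_sub_cancel_left] at h1
      exact Submodule.smul_mono le_rfl inf_le_right h1
    refine Submodule.smul_induction_on hmem ?_ ?_
    · intro r hr n hn
      have h2 := hk r hr _ ⟨⟨n, hn⟩, rfl⟩
      rw [← map_smul] at h2
      exact ⟨J.mul_mem_left r hn, Subtype.ext h2⟩
    · rintro x y ⟨hx, hx'⟩ ⟨hy, hy'⟩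
      refine ⟨J.add_mem hx hy, ?_⟩
      rw [← AddMemClass.mk_add_mk J x y hx hy, map_add, hx', hy', add_zero]
  obtain ⟨v, hv⟩ := exists_comp_eq_of_ker_le ((a ^ (c + k)).mkQ ∘ₗ J.subtype)
    ((idealTorsion R a M).subtype ∘ₗ g) (by
      rintro ⟨x, hx⟩ hx'
      obtain ⟨_, h⟩ := hzero x hx ((Submodule.Quotient.mk_eq_zero _).1 hx')
      exact congrArg Subtype.val h)
  refine ⟨(v ∘ₗ (a ^ (c + k)).mkQ).codRestrict _ fun x => ?_, fun x hx =>
    Subtype.ext (LinearMap.congr_fun hv ⟨x, hx⟩)⟩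
  refine (mem_idealTorsion_iff a).2 ⟨c + k, fun r hr => ?_⟩
  rw [← map_smul, LinearMap.comp_apply, Submodule.mkQ_apply,
    (Submodule.Quotient.mk_eq_zero _ (x := r • x)).2 (Ideal.mul_mem_right x _ hr), map_zero]

instance injective_linearMap_fin (m : ℕ) [Module.Injective R M] :
    Module.Injective R ((Fin m → R) →ₗ[R] M) where
  out Y Z _ _ _ _ f hf g := by
    have : ∀ i : Fin m, ∃ h : Z →ₗ[R] M, ∀ y, h (f y) = g y (Pi.single i 1) := fun i =>
      Module.Injective.out f hf (LinearMap.applyₗ (Pi.single i 1) ∘ₗ g)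
    choose h hh using this
    refine ⟨((LinearMap.lsum R (fun _ : Fin m => R) R).toLinearMap ∘ₗ
      LinearMap.pi fun i => (LinearMap.ringLmapEquivSelf R R M).symm.toLinearMap ∘ₗ h i), ?_⟩
    intro y
    ext i
    simp [hh, LinearMap.lsum_apply, Pi.single_apply]

end Injective

section CInjective

variable {R : Type u} [CommRing R]

lemma isCInjective_congr {C M N : ModuleCat.{u} R} (e : M ≃ₗ[R] N) (h : IsCInjective R C M) :
    IsCInjective R C N := by
  obtain ⟨I, hI, ⟨f⟩⟩ := h
  exact ⟨I, hI, ⟨e.symm.trans f⟩⟩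

lemma isCInjective_of_subsingleton (C M : ModuleCat.{u} R) [Subsingleton M] :
    IsCInjective R C M := by
  refine ⟨ModuleCat.of R PUnit.{u + 1}, ⟨fun _ _ _ _ _ _ _ _ _ => ⟨0, fun _ => rfl⟩⟩, ⟨?_⟩⟩
  have : Subsingleton (C →ₗ[R] (ModuleCat.of R PUnit.{u + 1})) :=
    ⟨fun f g => LinearMap.ext fun x => rfl⟩
  exact LinearEquiv.ofSubsingleton _ _

lemma isCInjective_idealTorsion [IsNoetherianRing R] (a : Ideal R) {C M : ModuleCat.{u} R}
    [Module.Finite R C] (h : IsCInjective R C M) :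
    IsCInjective R C (ModuleCat.of R (idealTorsion R a M)) := by
  obtain ⟨I, hI, ⟨e⟩⟩ := h
  exact ⟨ModuleCat.of R (idealTorsion R a I), injective_idealTorsion a,
    ⟨(torsionEquiv a e).trans (torsionLinearMapEquiv a)⟩⟩

lemma eq_zero_of_linearMap_subsingleton [IsNoetherianRing R] {C K : Type u} [AddCommGroup C]
    [Module R C] [Module.Finite R C] [AddCommGroup K] [Module R K]
    (hC : Function.Injective (LinearMap.lsmul R C)) (hK : ∀ φ : C →ₗ[R] K, φ = 0) (x : K) :
    x = 0 := by
  have : Subsingleton (C →ₗ[R] Submodule.span R {x}) := ⟨fun φ ψ => by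
    rw [← sub_eq_zero]
    have h := hK ((Submodule.span R {x}).subtype ∘ₗ (φ - ψ))
    exact LinearMap.ext fun c => Subtype.ext (LinearMap.congr_fun h c)⟩
  obtain ⟨r, hr, hreg⟩ := IsSMulRegular.subsingleton_linearMap_iff.1 this
  have hr0 : r = 0 := hC (by
    ext c
    simpa using Module.mem_annihilator.1 hr c)
  subst hr0
  have := hreg (a₁ := ⟨x, Submodule.mem_span_singleton_self x⟩) (a₂ := 0) (by simp)
  exact congrArg Subtype.val this

lemma linearMap_fin_apply {R M : Type u} [CommRing R] [AddCommGroup M] [Module R M] {m : ℕ}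
    (p : (Fin m → R) →ₗ[R] M) (s : Fin m → R) : p s = ∑ i, s i • p (Pi.single i 1) := by
  conv_lhs => rw [← Finset.univ_sum_single s, map_sum]
  refine Finset.sum_congr rfl fun i _ => ?_
  rw [← map_smul, ← Pi.single_smul, smul_eq_mul, mul_one]

/-- For `C` with `R ≃ Hom(C, C)` and injective `I`, every linear map from `Hom(C, I)` to another
module of homomorphisms out of `C` is induced by a linear map between the targets. -/
lemma exists_comp_eq_of_linearMap [IsNoetherianRing R] {C I I' : Type u} [AddCommGroup C]
    [Module R C] [Module.Finite R C] [AddCommGroup I] [Module R I] [Module.Injective R I]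
    [AddCommGroup I'] [Module R I'] (hC : Function.Bijective (LinearMap.lsmul R C))
    (g : (C →ₗ[R] I) →ₗ[R] (C →ₗ[R] I')) : ∃ f : I →ₗ[R] I', ∀ φ, g φ = f ∘ₗ φ := by
  obtain ⟨m, p, hp⟩ := Module.Finite.exists_fin' R C
  set c : Fin m → C := fun i => p (Pi.single i 1) with hc
  have hpc : ∀ s : Fin m → R, p s = ∑ i, s i • c i := linearMap_fin_apply p
  obtain ⟨n, q, hq⟩ := Module.Finite.exists_fin' R (LinearMap.ker p)
  let rel : Fin n → Fin m → R := fun j => q (Pi.single j 1)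
  have hrel : ∀ j, ∑ i, rel j i • c i = 0 := fun j => by
    rw [← hpc]; exact (q (Pi.single j 1)).2
  -- a vector killed by all relations is a multiple of the vector of generators
  let D : (Fin m → C) →ₗ[R] (Fin n → C) :=
    LinearMap.pi fun j => ∑ i, rel j i • LinearMap.proj i
  have hD : ∀ y, D y = 0 → ∃ r : R, y = fun i => r • c i := by
    intro y hy
    have hker : LinearMap.ker p ≤ LinearMap.ker (Fintype.linearCombination R y) := by
      intro s hs
      obtain ⟨t, ht⟩ := hq ⟨s, hs⟩
      have hst : s = ∑ j, t j • rel j := by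
        have := congrArg Subtype.val ht
        rw [linearMap_fin_apply q t] at this
        simpa [rel] using this.symm
      rw [hst, LinearMap.mem_ker, map_sum]
      refine Finset.sum_eq_zero fun j _ => ?_
      rw [map_smul]
      have := congrFun hy j
      simp only [D, LinearMap.pi_apply, LinearMap.sum_apply, LinearMap.smul_apply,
        LinearMap.proj_apply, Pi.zero_apply] at this
      rw [Fintype.linearCombination_apply, this, smul_zero]
    let e : C →ₗ[R] C := (LinearMap.ker p).liftQ _ hker ∘ₗ
      (p.quotKerEquivOfSurjective hp).symm.toLinearMap
    obtain ⟨r, hr⟩ := hC.2 e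
    refine ⟨r, funext fun i => ?_⟩
    have h1 := LinearMap.congr_fun hr (c i)
    have h2 : (p.quotKerEquivOfSurjective hp).symm (c i) =
        Submodule.Quotient.mk (Pi.single i 1) := by
      rw [LinearEquiv.symm_apply_eq]; rfl
    simp only [LinearMap.lsmul_apply, e, LinearMap.comp_apply, LinearEquiv.coe_coe, h2] at h1
    rw [h1]
    exact (by simp [Fintype.linearCombination_apply, Pi.single_apply] : y i =
      Fintype.linearCombination R y (Pi.single i 1))
  let ev : (Fin m → (C →ₗ[R] I)) →ₗ[R] I := ∑ i, LinearMap.applyₗ (c i) ∘ₗ LinearMap.proj i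
  let ev' : (Fin m → (C →ₗ[R] I)) →ₗ[R] I' :=
    ∑ i, LinearMap.applyₗ (c i) ∘ₗ g ∘ₗ LinearMap.proj i
  have hev : ∀ φ, ev φ = ∑ i, φ i (c i) := fun φ => by simp [ev]
  have hev' : ∀ φ, ev' φ = ∑ i, g (φ i) (c i) := fun φ => by simp [ev']
  have hsurj : Function.Surjective ev := by
    intro x
    obtain ⟨v, hv⟩ := exists_comp_eq_of_ker_le (LinearMap.toSpanSingleton R (Fin m → C) c)
      (LinearMap.toSpanSingleton R I x) (by
        intro r hr
        have : r = 0 := hC.1 (by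
          refine LinearMap.ext fun y => ?_
          obtain ⟨s, rfl⟩ := hp y
          have hri : ∀ i, r • c i = 0 := fun i => congrFun hr i
          simp [hpc, hri])
        simp [this])
    refine ⟨fun i => v ∘ₗ LinearMap.single R (fun _ => C) i, ?_⟩
    have := LinearMap.congr_fun hv 1
    simp only [LinearMap.comp_apply, LinearMap.toSpanSingleton_apply, one_smul] at this
    rw [hev, ← this]
    simp only [LinearMap.comp_apply, LinearMap.coe_single]
    rw [← map_sum, Finset.univ_sum_single]
  have hker : LinearMap.ker ev ≤ LinearMap.ker ev' := by
    intro φ hφ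
    rw [LinearMap.mem_ker, hev] at hφ
    obtain ⟨v, hv⟩ := exists_comp_eq_of_ker_le D (∑ i, φ i ∘ₗ LinearMap.proj i) (by
      intro y hy
      obtain ⟨r, rfl⟩ := hD y hy
      simp [← Finset.smul_sum, hφ])
    have hφi : ∀ i, φ i = ∑ j, rel j i • (v ∘ₗ LinearMap.single R (fun _ => C) j) := by
      intro i
      ext y
      have h1 := LinearMap.congr_fun hv (Pi.single i y)
      have h2 : D (Pi.single i y) = ∑ j, Pi.single j (rel j i • y) := by
        rw [Finset.univ_sum_single]
        ext j
        simp [D, Pi.single_apply]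
      have h3 : (∑ i, φ i ∘ₗ LinearMap.proj i : (Fin m → C) →ₗ[R] I) (Pi.single i y) = φ i y := by
        simp only [LinearMap.sum_apply, LinearMap.comp_apply, LinearMap.proj_apply]
        rw [Finset.sum_eq_single i]
        · simp
        · intro j _ hj; simp [hj]
        · simp
      rw [LinearMap.comp_apply, h2, h3] at h1
      rw [← h1]
      simp [LinearMap.sum_apply, ← Pi.single_smul, map_sum, ← map_smul]
    rw [LinearMap.mem_ker, hev']
    calc ∑ i, g (φ i) (c i)
        = ∑ j, g (v ∘ₗ LinearMap.single R (fun _ => C) j) (∑ i, rel j i • c i) := by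
          simp only [map_sum, map_smul]
          rw [Finset.sum_comm]
          refine Finset.sum_congr rfl fun i _ => ?_
          conv_lhs => rw [hφi i]
          simp
      _ = 0 := by simp [hrel]
  refine ⟨(LinearMap.ker ev).liftQ ev' hker ∘ₗ (ev.quotKerEquivOfSurjective hsurj).symm.toLinearMap,
    fun φ => LinearMap.ext fun y => ?_⟩
  obtain ⟨s, rfl⟩ := hp y
  have h1 : (ev.quotKerEquivOfSurjective hsurj).symm (φ (p s)) =
      Submodule.Quotient.mk (fun i => s i • φ) := by
    rw [LinearEquiv.symm_apply_eq]
    change _ = ev _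
    simp [hev, hpc]
  have h2 : g φ (p s) = ev' (fun i => s i • φ) := by simp [hev', hpc]
  rw [h2, LinearMap.comp_apply, LinearMap.comp_apply, LinearEquiv.coe_coe, h1]
  rfl

/-- The cokernel of an injection between `C`-injective modules is `C`-injective. -/
lemma isCInjective_quotient [IsNoetherianRing R] {C J X : ModuleCat.{u} R}
    [Module.Finite R C] (hC : Function.Bijective (LinearMap.lsmul R C))
    (hJ : IsCInjective R C J) (hX : IsCInjective R C X) (i : J →ₗ[R] X)
    (hi : Function.Injective i) :
    IsCInjective R C (ModuleCat.of R (X ⧸ LinearMap.range i)) := by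
  obtain ⟨I, hI, ⟨e⟩⟩ := hJ
  obtain ⟨I', hI', ⟨e'⟩⟩ := hX
  obtain ⟨f, hf⟩ := exists_comp_eq_of_linearMap hC
    (e'.toLinearMap ∘ₗ i ∘ₗ e.symm.toLinearMap)
  have hf' : ∀ x, e' (i x) = f ∘ₗ e x := fun x => by simpa using hf (e x)
  have hfinj : Function.Injective f := by
    rw [← LinearMap.ker_eq_bot, LinearMap.ker_eq_bot']
    intro x hx
    have := eq_zero_of_linearMap_subsingleton (K := LinearMap.ker f) hC.1 (fun φ => by
      have h1 : e' (i (e.symm ((LinearMap.ker f).subtype ∘ₗ φ))) = 0 := by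
        rw [hf']
        ext y
        simp
      have h2 : (LinearMap.ker f).subtype ∘ₗ φ = 0 := by
        have h3 : i (e.symm ((LinearMap.ker f).subtype ∘ₗ φ)) = 0 := by simpa using h1
        have h4 := hi (h3.trans (map_zero i).symm)
        simpa using h4
      exact LinearMap.ext fun y => Subtype.ext (LinearMap.congr_fun h2 y)) ⟨x, hx⟩
    exact congrArg Subtype.val this
  obtain ⟨ρ, hρ⟩ := Module.Injective.out f hfinj LinearMap.id
  have hρ' : ∀ x, ρ (f x) = x := hρ
  let π : I' →ₗ[R] LinearMap.ker ρ :=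
    (LinearMap.id - f ∘ₗ ρ).codRestrict _ fun x => by simp [hρ']
  have hπ : ∀ x, (π x : I') = x - f (ρ x) := fun x => rfl
  have hπs : ∀ x : LinearMap.ker ρ, π x = x := fun x => Subtype.ext (by
    rw [hπ, LinearMap.mem_ker.1 x.2, map_zero, sub_zero])
  refine ⟨ModuleCat.of R (LinearMap.ker ρ),
    injective_of_retract (LinearMap.ker ρ).subtype π hπs, ⟨?_⟩⟩
  let Φ : X →ₗ[R] (C →ₗ[R] LinearMap.ker ρ) := LinearMap.compRight R π ∘ₗ e'.toLinearMap
  have hΦ : ∀ x y, (Φ x y : I') = e' x y - f (ρ (e' x y)) := fun _ _ => rfl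
  have hΦs : Function.Surjective Φ := fun φ =>
    ⟨e'.symm ((LinearMap.ker ρ).subtype ∘ₗ φ), by
      ext y
      rw [hΦ]
      simp⟩
  have hΦk : LinearMap.range i = LinearMap.ker Φ := by
    ext x
    constructor
    · rintro ⟨y, rfl⟩
      refine LinearMap.ext fun z => Subtype.ext ?_
      rw [hΦ, hf']
      simp [hρ']
    · intro hx
      refine ⟨e.symm (ρ ∘ₗ e' x), e'.injective ?_⟩
      rw [hf']
      ext z
      have := hΦ x z
      rw [LinearMap.mem_ker.1 hx] at this
      simpa using (sub_eq_zero.1 this.symm).symm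
  exact (Submodule.quotEquivOfEq _ _ hΦk).trans (Φ.quotKerEquivOfSurjective hΦs)

end CInjective

section OppositeComplex

variable {R : Type u} [CommRing R] (K : ChainComplex (ModuleCat.{u} R)ᵒᵖ ℕ) (n : ℕ)

/-- The degree-`n` cocycles of a chain complex in the opposite category of modules, viewed as
a cochain complex of modules. -/
abbrev opCocycles : Submodule R ((K.X n).unop) := LinearMap.ker (K.d (n + 1) n).unop.hom

lemma pOpcycles_unop_injective : Function.Injective (K.pOpcycles n).unop.hom :=
  (ModuleCat.mono_iff_injective _).1 inferInstance

lemma range_pOpcycles_unop : LinearMap.range (K.pOpcycles n).unop.hom = opCocycles K n := by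
  have h := (ShortComplex.exact_of_g_is_cokernel (ShortComplex.mk _ _ (K.d_pOpcycles (n + 1) n))
    (K.opcyclesIsCokernel (n + 1) n (by simp))).unop
  exact ((ShortComplex.moduleCat_exact_iff_range_eq_ker _).1 h)

/-- Cocycles are the opposite of opcycles. -/
def opCocyclesEquiv : (K.opcycles n).unop ≃ₗ[R] opCocycles K n :=
  (LinearEquiv.ofInjective _ (pOpcycles_unop_injective K n)).trans
    (LinearEquiv.ofEq _ _ (range_pOpcycles_unop K n))

lemma coe_opCocyclesEquiv (x : (K.opcycles n).unop) :
    (opCocyclesEquiv K n x : (K.X n).unop) = (K.pOpcycles n).unop.hom x := rfl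

/-- The class of a cocycle in cohomology. -/
def opClass : opCocycles K n →ₗ[R] (K.homology n).unop :=
  (K.homologyι n).unop.hom ∘ₗ (opCocyclesEquiv K n).symm.toLinearMap

lemma opClass_surjective : Function.Surjective (opClass K n) :=
  ((ModuleCat.epi_iff_surjective (K.homologyι n).unop).1 inferInstance).comp
    (opCocyclesEquiv K n).symm.surjective

lemma opClass_eq_zero_iff (x : opCocycles K n) : opClass K n x = 0 ↔
    ∃ y, (K.d n ((ComplexShape.down ℕ).next n)).unop.hom y = x := by
  have h := (ShortComplex.exact_of_f_is_kernel (ShortComplex.mk _ _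
    (K.homologyι_comp_fromOpcycles n _))
    (K.homologyIsKernel n ((ComplexShape.down ℕ).next n) rfl)).unop
  have h : ∀ z : (K.opcycles n).unop, (K.homologyι n).unop.hom z = 0 ↔
      ∃ y, (K.fromOpcycles n ((ComplexShape.down ℕ).next n)).unop.hom y = z := fun z =>
    (SetLike.ext_iff.1 ((ShortComplex.moduleCat_exact_iff_range_eq_ker _).1 h) z).symm
  refine (h _).trans (exists_congr fun y => ?_)
  rw [LinearEquiv.coe_coe, LinearEquiv.eq_symm_apply, ← Subtype.coe_inj, coe_opCocyclesEquiv]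
  have := congrArg (fun f => f.unop.hom y)
    (K.p_fromOpcycles n ((ComplexShape.down ℕ).next n))
  exact Eq.congr_left this

variable {K} {L : ChainComplex (ModuleCat.{u} R)ᵒᵖ ℕ}

lemma opClass_naturality (φ : K ⟶ L) (x : opCocycles L n) (y : opCocycles K n)
    (h : (φ.f n).unop.hom x = (y : (K.X n).unop)) :
    (HomologicalComplex.homologyMap φ n).unop.hom (opClass L n x) = opClass K n y := by
  obtain ⟨x, rfl⟩ := (opCocyclesEquiv L n).surjective x
  obtain ⟨y, rfl⟩ := (opCocyclesEquiv K n).surjective y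
  have h1 := congrArg (fun f => f.unop.hom x) (HomologicalComplex.homologyι_naturality φ n)
  have h2 := congrArg (fun f => f.unop.hom x) (HomologicalComplex.p_opcyclesMap φ n)
  have h3 : (HomologicalComplex.opcyclesMap φ n).unop.hom x = y := by
    apply pOpcycles_unop_injective K n
    rw [coe_opCocyclesEquiv, coe_opCocyclesEquiv] at h
    exact h2.trans h
  simp only [opClass, LinearMap.comp_apply, LinearEquiv.coe_coe, LinearEquiv.symm_apply_apply]
  rw [← h3]
  exact h1

end OppositeComplex

section ExtComparison

variable {R : Type u} [CommRing R] {A : ModuleCat.{u} R} (P : ProjectiveResolution A)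
  (M : ModuleCat.{u} R) (n : ℕ)

/-- The complex `Hom(P, M)`, as a chain complex in the opposite category of modules. -/
abbrev opHomComplex : ChainComplex (ModuleCat.{u} R)ᵒᵖ ℕ :=
  ((((linearYoneda R (ModuleCat.{u} R)).obj M).rightOp).mapHomologicalComplex _).obj P.complex

/-- The degree-`n` cocycles of `Hom(P, M)`. -/
def homCocycles : Submodule R (P.complex.X n ⟶ M) where
  carrier := {f | P.complex.d (n + 1) n ≫ f = 0}
  add_mem' hf hg := by simp_all
  zero_mem' := by simp
  smul_mem' r f hf := by simp_all

variable {M n} in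
lemma mem_homCocycles {f : P.complex.X n ⟶ M} :
    f ∈ homCocycles P M n ↔ P.complex.d (n + 1) n ≫ f = 0 := Iff.rfl

/-- The class of a cocycle in the derived functor `Ext`. -/
def derivedClass : homCocycles P M n →ₗ[R] ((Ext R (ModuleCat.{u} R) n).obj (op A)).obj M :=
  (P.isoLeftDerivedObj ((linearYoneda R (ModuleCat.{u} R)).obj M).rightOp n).hom.unop.hom ∘ₗ
    opClass (opHomComplex P M) n ∘ₗ
      (Submodule.inclusion (le_refl (homCocycles P M n)) :
        homCocycles P M n →ₗ[R] opCocycles (opHomComplex P M) n)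

lemma derivedClass_surjective : Function.Surjective (derivedClass P M n) := by
  refine ((ConcreteCategory.bijective_of_isIso (P.isoLeftDerivedObj
    ((linearYoneda R (ModuleCat.{u} R)).obj M).rightOp n).hom.unop).2.comp
      (opClass_surjective _ n))

variable {M n} in
lemma derivedClass_eq_zero_iff (f : homCocycles P M n) : derivedClass P M n f = 0 ↔
    ∃ g, P.complex.d n ((ComplexShape.down ℕ).next n) ≫ g = f.1 := by
  refine Iff.trans ?_ (opClass_eq_zero_iff (opHomComplex P M) n f)
  exact map_eq_zero_iff _ (ConcreteCategory.bijective_of_isIso (P.isoLeftDerivedObj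
    ((linearYoneda R (ModuleCat.{u} R)).obj M).rightOp n).hom.unop).1

variable {P M n} in
lemma derivedClass_naturality {B : ModuleCat.{u} R} {Q : ProjectiveResolution B} {g : A ⟶ B}
    (φ : ProjectiveResolution.Hom P Q g) (f : homCocycles Q M n) (f' : homCocycles P M n)
    (h : φ.hom.f n ≫ f.1 = f'.1) :
    (((Ext R (ModuleCat.{u} R) n).map g.op).app M).hom (derivedClass Q M n f) =
      derivedClass P M n f' := by
  have h1 := opClass_naturality n
    ((((linearYoneda R (ModuleCat.{u} R)).obj M).rightOp.mapHomologicalComplex _).map φ.hom)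
    f f' h
  have h2 := congrArg (fun q => q.unop.hom (opClass (opHomComplex Q M) n f))
    (ProjectiveResolution.isoLeftDerivedObj_hom_naturality g P Q φ.hom φ.hom_f_zero_comp_π_f_zero
      ((linearYoneda R (ModuleCat.{u} R)).obj M).rightOp n)
  refine Eq.trans h2 ?_
  exact congrArg (P.isoLeftDerivedObj
    ((linearYoneda R (ModuleCat.{u} R)).obj M).rightOp n).hom.unop.hom h1

variable {P M} in
lemma extMk_degree_zero_eq_zero_iff (f : P.complex.X 0 ⟶ M) (hf : P.complex.d 1 0 ≫ f = 0) :
    P.extMk f 1 rfl hf = 0 ↔ f = 0 := by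
  refine ⟨fun h => ?_, fun h => by subst h; simp⟩
  rw [← P.extEquivCohomologyClass.apply_eq_iff_eq,
    ProjectiveResolution.extEquivCohomologyClass_extMk,
    ProjectiveResolution.extEquivCohomologyClass_zero,
    CochainComplex.HomComplex.CohomologyClass.mk_eq_zero_iff,
    CochainComplex.HomComplex.Cocycle.toSingleMk_mem_coboundaries_iff _ _ _ _ _ 1 (by simp)] at h
  obtain ⟨g, hg⟩ := h
  have h1 : IsZero (P.cochainComplex.X 1) := P.cochainComplex.isZero_of_isStrictlyLE 0 1
  rw [h1.eq_zero_of_src g, comp_zero] at hg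
  rw [← cancel_epi (P.cochainComplexXIso (-(0 : ℕ)) 0 rfl).hom, comp_zero]
  exact hg.symm

/-- The class of a cocycle in the Yoneda-type `Ext`. -/
def yonedaClass : homCocycles P M n →ₗ[R] Abelian.Ext A M n where
  toFun f := P.extMk f.1 (n + 1) rfl f.2
  map_add' f g := (P.add_extMk f.1 g.1 (n + 1) rfl f.2 g.2).symm
  map_smul' r f := by
    rw [RingHom.id_apply, Abelian.Ext.smul_eq_comp_mk₀]
    refine Eq.trans ?_ (P.extMk_comp_mk₀ f.1 (n + 1) rfl f.2 _).symm
    simp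

lemma yonedaClass_surjective : Function.Surjective (yonedaClass P M n) := fun x => by
  obtain ⟨f, hf, rfl⟩ := P.extMk_surjective x (n + 1) rfl
  exact ⟨⟨f, hf⟩, rfl⟩

variable {M n} in
lemma yonedaClass_eq_zero_iff (f : homCocycles P M n) : yonedaClass P M n f = 0 ↔
    ∃ g, P.complex.d n ((ComplexShape.down ℕ).next n) ≫ g = f.1 := by
  cases n with
  | zero =>
    rw [ChainComplex.next_nat_zero, P.complex.shape 0 0 (by simp)]
    simp only [zero_comp, exists_const]
    exact (extMk_degree_zero_eq_zero_iff f.1 f.2).trans eq_comm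
  | succ n =>
    rw [ChainComplex.next_nat_succ]
    exact P.extMk_eq_zero_iff f.1 (n + 1 + 1) rfl f.2 n rfl

variable {P M n} in
lemma yonedaClass_naturality {B : ModuleCat.{u} R} {Q : ProjectiveResolution B} {g : A ⟶ B}
    (φ : ProjectiveResolution.Hom P Q g) (f : homCocycles Q M n) (f' : homCocycles P M n)
    (h : φ.hom.f n ≫ f.1 = f'.1) :
    (Abelian.Ext.mk₀ g).comp (yonedaClass Q M n f) (zero_add n) = yonedaClass P M n f' := by
  refine (ProjectiveResolution.mk₀_comp_extMk f.1 (n + 1) rfl f.2 φ).trans ?_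
  simp only [h]
  rfl

/-- Two surjective linear maps with the same kernel have isomorphic targets. -/
def equivOfKerEq {X Y Z : Type u} [AddCommGroup X] [Module R X] [AddCommGroup Y] [Module R Y]
    [AddCommGroup Z] [Module R Z] (f : X →ₗ[R] Y) (g : X →ₗ[R] Z) (hf : Function.Surjective f)
    (hg : Function.Surjective g) (h : LinearMap.ker f = LinearMap.ker g) : Y ≃ₗ[R] Z :=
  (f.quotKerEquivOfSurjective hf).symm ≪≫ₗ Submodule.quotEquivOfEq _ _ h ≪≫ₗ
    g.quotKerEquivOfSurjective hg

lemma equivOfKerEq_apply {X Y Z : Type u} [AddCommGroup X] [Module R X] [AddCommGroup Y]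
    [Module R Y] [AddCommGroup Z] [Module R Z] (f : X →ₗ[R] Y) (g : X →ₗ[R] Z)
    (hf : Function.Surjective f) (hg : Function.Surjective g)
    (h : LinearMap.ker f = LinearMap.ker g) (x : X) : equivOfKerEq f g hf hg h (f x) = g x := by
  have h1 : (f.quotKerEquivOfSurjective hf).symm (f x) = Submodule.Quotient.mk x := by
    rw [LinearEquiv.symm_apply_eq]
    rfl
  simp only [equivOfKerEq, LinearEquiv.trans_apply, h1]
  rfl

variable (A) in
/-- The derived functor `Ext` agrees with the Yoneda-type `Ext`. -/
def extEquiv : ((Ext R (ModuleCat.{u} R) n).obj (op A)).obj M ≃ₗ[R] Abelian.Ext A M n :=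
  equivOfKerEq (derivedClass (projectiveResolution A) M n)
    (yonedaClass (projectiveResolution A) M n)
    (derivedClass_surjective _ M n) (yonedaClass_surjective _ M n) (by
      ext f
      exact (derivedClass_eq_zero_iff _ f).trans (yonedaClass_eq_zero_iff _ f).symm)

variable {M n} in
lemma extEquiv_naturality {B : ModuleCat.{u} R} (g : A ⟶ B)
    (x : ((Ext R (ModuleCat.{u} R) n).obj (op B)).obj M) :
    extEquiv A M n ((((Ext R (ModuleCat.{u} R) n).map g.op).app M).hom x) =
      (Abelian.Ext.mk₀ g).comp (extEquiv B M n x) (zero_add n) := by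
  obtain ⟨f, rfl⟩ := derivedClass_surjective (projectiveResolution B) M n x
  let φ : ProjectiveResolution.Hom (projectiveResolution A) (projectiveResolution B) g :=
    { hom := ProjectiveResolution.lift g _ _
      hom_f_zero_comp_π_f_zero := by
        simpa using ProjectiveResolution.lift_commutes_zero g _ _ }
  let f' : homCocycles (projectiveResolution A) M n := ⟨φ.hom.f n ≫ f.1, by
    have := (mem_homCocycles _).1 f.2
    rw [mem_homCocycles, ← φ.hom.comm_assoc, this, comp_zero]⟩
  rw [derivedClass_naturality φ f f' rfl, extEquiv, extEquiv, equivOfKerEq_apply,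
    equivOfKerEq_apply, yonedaClass_naturality φ f f' rfl]

end ExtComparison

section DirectLimit

variable {R : Type u} [CommRing R]

/-- A compatible family of linear maps which is jointly surjective and detects zero in the
direct limit identifies its target with the direct limit. -/
def directLimitEquiv {G : ℕ → Type u} [∀ k, AddCommGroup (G k)] [∀ k, Module R (G k)]
    {f : ∀ i j, i ≤ j → G i →ₗ[R] G j} {L : Type u}
    [AddCommGroup L] [Module R L] (g : ∀ k, G k →ₗ[R] L)
    (hg : ∀ i j h x, g j (f i j h x) = g i x) (hs : ∀ x, ∃ k y, g k y = x)
    (hz : ∀ k x, g k x = 0 → ∃ j, ∃ h : k ≤ j, f k j h x = 0) :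
    Module.DirectLimit G f ≃ₗ[R] L :=
  LinearEquiv.ofBijective (Module.DirectLimit.lift R ℕ G f g hg) (by
    constructor
    · rw [← LinearMap.ker_eq_bot, LinearMap.ker_eq_bot']
      intro x hx
      obtain ⟨k, y, rfl⟩ := Module.DirectLimit.exists_of x
      rw [Module.DirectLimit.lift_of] at hx
      obtain ⟨j, h, hj⟩ := hz k y hx
      rw [← Module.DirectLimit.of_f (hij := h), hj, map_zero]
    · intro x
      obtain ⟨k, y, rfl⟩ := hs x
      exact ⟨Module.DirectLimit.of R ℕ G f k y, Module.DirectLimit.lift_of _ _ _⟩)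

variable (a : Ideal R)

/-- The quotient of `R` by a power of `a`. -/
abbrev powQuot (k : ℕ) : ModuleCat.{u} R := ModuleCat.of R (R ⧸ a ^ k)

/-- The projections between the quotients by the powers of `a`. -/
def powQuotMap {i j : ℕ} (h : i ≤ j) : powQuot a j ⟶ powQuot a i :=
  ModuleCat.ofHom (Submodule.mapQ _ _ LinearMap.id (Ideal.pow_le_pow_right h))

lemma powQuotMap_self (i : ℕ) : powQuotMap a (le_refl i) = 𝟙 _ := by
  refine ModuleCat.hom_ext (LinearMap.ext fun x => ?_)
  obtain ⟨x, rfl⟩ := Submodule.Quotient.mk_surjective _ x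
  rfl

lemma powQuotMap_comp {i j k : ℕ} (hij : i ≤ j) (hjk : j ≤ k) :
    powQuotMap a hjk ≫ powQuotMap a hij = powQuotMap a (hij.trans hjk) := by
  refine ModuleCat.hom_ext (LinearMap.ext fun x => ?_)
  obtain ⟨x, rfl⟩ := Submodule.Quotient.mk_surjective _ x
  rfl

variable (n : ℕ) (M : ModuleCat.{u} R)

/-- The transition maps of the direct system defining local cohomology. -/
def extTransition (i j : ℕ) (h : i ≤ j) :
    Abelian.Ext (powQuot a i) M n →ₗ[R] Abelian.Ext (powQuot a j) M n :=
  (Abelian.Ext.mk₀ (powQuotMap a h)).precompOfLinear R M (zero_add n)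

lemma extTransition_apply (i j : ℕ) (h : i ≤ j) (x) : extTransition a n M i j h x =
    (Abelian.Ext.mk₀ (powQuotMap a h)).comp x (zero_add n) := rfl

instance : DirectedSystem (fun k => Abelian.Ext (powQuot a k) M n)
    (fun i j h => extTransition a n M i j h) where
  map_self i x := by
    rw [extTransition_apply, powQuotMap_self, Abelian.Ext.mk₀_id_comp]
  map_map k j i hij hjk x := by
    rw [extTransition_apply, extTransition_apply, extTransition_apply, ← powQuotMap_comp a hij hjk,
      Abelian.Ext.mk₀_comp_mk₀_assoc]

/-- Local cohomology, as a direct limit of Yoneda-type `Ext` modules. -/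
abbrev LC : Type u :=
  Module.DirectLimit (fun k => Abelian.Ext (powQuot a k) M n) (extTransition a n M)

/-- The structure maps of local cohomology. -/
abbrev LC.of (k : ℕ) : Abelian.Ext (powQuot a k) M n →ₗ[R] LC a n M :=
  Module.DirectLimit.of R ℕ (fun k => Abelian.Ext (powQuot a k) M n) (extTransition a n M) k

/-- The diagram defining Mathlib's local cohomology. -/
abbrev lcDiagram : (ℕᵒᵖ)ᵒᵖ ⥤ ModuleCat.{u} R ⥤ ModuleCat.{u} R :=
  localCohomology.diagram (localCohomology.idealPowersDiagram a) n

/-- The terms of the diagram defining local cohomology are `Ext` modules. -/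
def lcDiagramEquiv (k : ℕ) :
    ((lcDiagram a n).obj (op (op k))).obj M ≃ₗ[R] Abelian.Ext (powQuot a k) M n :=
  extEquiv (powQuot a k) M n

/-- The structure maps of Mathlib's local cohomology. -/
def lcι (k : ℕ) : Abelian.Ext (powQuot a k) M n →ₗ[R] (localCohomology a n).obj M :=
  ((colimit.ι (lcDiagram a n) (op (op k))).app M).hom ∘ₗ (lcDiagramEquiv a n M k).symm.toLinearMap

lemma lcDiagram_map {i j : ℕ} (h : i ≤ j) (x : Abelian.Ext (powQuot a i) M n) :
    (((lcDiagram a n).map (homOfLE h).op.op).app M).hom ((lcDiagramEquiv a n M i).symm x) =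
      (lcDiagramEquiv a n M j).symm (extTransition a n M i j h x) := by
  rw [LinearEquiv.eq_symm_apply, extTransition_apply]
  refine (extEquiv_naturality (powQuotMap a h) _).trans ?_
  congr 1
  exact (lcDiagramEquiv a n M i).apply_symm_apply x

lemma lcι_extTransition (i j : ℕ) (h : i ≤ j) (x) :
    lcι a n M j (extTransition a n M i j h x) = lcι a n M i x := by
  have := congrArg (fun f => (f.app M).hom ((lcDiagramEquiv a n M i).symm x))
    (colimit.w (lcDiagram a n) (homOfLE h).op.op)
  refine Eq.trans ?_ this
  exact congrArg ((colimit.ι (lcDiagram a n) (op (op j))).app M).hom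
    (lcDiagram_map a n M h x).symm

/-- Local cohomology is a colimit when evaluated at a module. -/
def lcIsColimit : IsColimit (((evaluation _ _).obj M).mapCocone (colimit.cocone (lcDiagram a n))) :=
  isColimitOfPreserves _ (colimit.isColimit _)

instance : PreservesFilteredColimitsOfSize.{0, 0} (forget (ModuleCat.{u} R)) :=
  preservesFilteredColimitsOfSize_shrink.{0, u, 0, u} _

lemma exists_lcι_eq (x : (localCohomology a n).obj M) : ∃ k y, lcι a n M k y = x := by
  obtain ⟨k, y, hy⟩ := Concrete.isColimit_exists_rep _ (lcIsColimit a n M) x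
  refine ⟨k.unop.unop, lcDiagramEquiv a n M _ y, ?_⟩
  refine Eq.trans ?_ hy
  exact congrArg ((colimit.ι (lcDiagram a n) k).app M).hom
    ((lcDiagramEquiv a n M _).symm_apply_apply y)

lemma exists_extTransition_eq_zero (k : ℕ) (x) (hx : lcι a n M k x = 0) :
    ∃ j, ∃ h : k ≤ j, extTransition a n M k j h x = 0 := by
  obtain ⟨j, f, g, h⟩ := Concrete.isColimit_exists_of_rep_eq _ (lcIsColimit a n M)
    (i := op (op k)) (j := op (op k)) ((lcDiagramEquiv a n M k).symm x) 0
    (hx.trans (map_zero ((colimit.ι (lcDiagram a n) (op (op k))).app M).hom).symm)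
  refine ⟨j.unop.unop, f.unop.unop.le, ?_⟩
  have h1 : (((lcDiagram a n).map f).app M).hom ((lcDiagramEquiv a n M k).symm x) = 0 :=
    h.trans (map_zero (((lcDiagram a n).map g).app M).hom)
  exact (lcDiagramEquiv a n M _).symm.map_eq_zero_iff.1
    ((lcDiagram_map a n M f.unop.unop.le x).symm.trans h1)

/-- Mathlib's local cohomology agrees with the direct limit of Yoneda-type `Ext` modules. -/
def lcEquiv : LC a n M ≃ₗ[R] (localCohomology a n).obj M :=
  directLimitEquiv (lcι a n M) (lcι_extTransition a n M) (exists_lcι_eq a n M)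
    (exists_extTransition_eq_zero a n M)

end DirectLimit

section LongExactSequence

variable {R : Type u} [CommRing R] (a : Ideal R)

/-- The map on local cohomology given by the Yoneda product with an extension class. -/
def lcPost {M N : ModuleCat.{u} R} {b : ℕ} (β : Abelian.Ext M N b) {n m : ℕ} (h : n + b = m) :
    LC a n M →ₗ[R] LC a m N :=
  Module.DirectLimit.map (fun k => β.postcompOfLinear R (powQuot a k) h) fun i j hij => by
    exact LinearMap.ext fun x => Abelian.Ext.comp_assoc _ _ _ (zero_add n) h (by lia)

lemma lcPost_of {M N : ModuleCat.{u} R} {b : ℕ} (β : Abelian.Ext M N b) {n m : ℕ} (h : n + b = m)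
    (k : ℕ) (x : Abelian.Ext (powQuot a k) M n) :
    lcPost a β h (LC.of a n M k x) = LC.of a m N k (x.comp β h) :=
  Module.DirectLimit.map_apply_of _ _ _

lemma lcPost_exact {M N P : ModuleCat.{u} R} {b c : ℕ} (β : Abelian.Ext M N b)
    (γ : Abelian.Ext N P c) {n m l : ℕ} (h : n + b = m) (h' : m + c = l)
    (hex : ∀ (A : ModuleCat.{u} R) (x : Abelian.Ext A N m), x.comp γ h' = 0 →
      ∃ y : Abelian.Ext A M n, y.comp β h = x)
    (hzero : β.comp γ rfl = 0) : Function.Exact (lcPost a β h) (lcPost a γ h') := by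
  intro x
  constructor
  · intro hx
    obtain ⟨k, x, rfl⟩ := Module.DirectLimit.exists_of x
    rw [lcPost_of] at hx
    obtain ⟨j, hj, hx⟩ := Module.DirectLimit.of.zero_exact hx
    have h1 : (extTransition a m N k j hj x).comp γ h' = 0 :=
      (Abelian.Ext.comp_assoc _ _ _ (zero_add m) h' (by lia)).trans hx
    obtain ⟨y, hy⟩ := hex _ _ h1
    refine ⟨LC.of a n M j y, ?_⟩
    rw [lcPost_of, hy]
    exact Module.DirectLimit.of_f
  · rintro ⟨y, rfl⟩
    obtain ⟨k, y, rfl⟩ := Module.DirectLimit.exists_of y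
    rw [lcPost_of, lcPost_of, Abelian.Ext.comp_assoc _ _ _ _ rfl (by lia), hzero,
      Abelian.Ext.comp_zero, map_zero]

lemma subsingleton_LC {M : ModuleCat.{u} R} {n : ℕ}
    (h : ∀ A : ModuleCat.{u} R, Subsingleton (Abelian.Ext A M n)) : Subsingleton (LC a n M) := by
  refine subsingleton_of_forall_eq 0 fun x => ?_
  obtain ⟨k, x, rfl⟩ := Module.DirectLimit.exists_of x
  rw [(h _).elim x 0, map_zero]

lemma subsingleton_LC_of_injective (M : ModuleCat.{u} R) [Module.Injective R M] (i : ℕ) :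
    Subsingleton (LC a (i + 1) M) := by
  have := Module.injective_object_of_injective_module R M
  exact subsingleton_LC a fun A => Abelian.Ext.subsingleton_of_injective A M i

lemma subsingleton_LC_of_subsingleton (M : ModuleCat.{u} R) [Subsingleton M] (i : ℕ) :
    Subsingleton (LC a i M) := by
  refine subsingleton_LC a fun A => subsingleton_of_forall_eq 0 fun x => ?_
  rw [← x.comp_mk₀_id, (ModuleCat.isZero_of_subsingleton M).eq_of_src (𝟙 M) 0,
    Abelian.Ext.mk₀_zero, Abelian.Ext.comp_zero]

/-- Evaluation at `1` of a class of degree zero. -/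
def evalOne (M : ModuleCat.{u} R) (k : ℕ) :
    Abelian.Ext (powQuot a k) M 0 →ₗ[R] idealTorsion R a M :=
  ((LinearMap.applyₗ (1 : R ⧸ a ^ k) ∘ₗ
    (ModuleCat.homLinearEquiv (S := R) (M := powQuot a k) (N := M)).toLinearMap) ∘ₗ
      (Abelian.Ext.linearEquiv₀ (R := R) (X := powQuot a k) (Y := M)).toLinearMap).codRestrict _
        fun x => (mem_idealTorsion_iff a).2 ⟨k, fun r hr => by
          simp only [LinearMap.comp_apply, LinearEquiv.coe_coe, LinearMap.applyₗ_apply_apply]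
          have h : r • (1 : R ⧸ a ^ k) = 0 :=
            (Submodule.Quotient.mk_eq_zero (a ^ k) (x := r • (1 : R))).2
              (Ideal.mul_mem_right _ _ hr)
          rw [← map_smul, h, map_zero]⟩

lemma coe_evalOne_mk₀ {M : ModuleCat.{u} R} {k : ℕ} (f : powQuot a k ⟶ M) :
    (evalOne a M k (Abelian.Ext.mk₀ f) : M) = f.hom (1 : R ⧸ a ^ k) := by
  have h : Abelian.Ext.linearEquiv₀ (R := R) (Abelian.Ext.mk₀ f) = f :=
    Abelian.Ext.addEquiv₀.apply_symm_apply f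
  exact congrArg (fun g : powQuot a k ⟶ M => g.hom (1 : R ⧸ a ^ k)) h

lemma evalOne_extTransition (M : ModuleCat.{u} R) (i j : ℕ) (h : i ≤ j)
    (x : Abelian.Ext (powQuot a i) M 0) :
    evalOne a M j (extTransition a 0 M i j h x) = evalOne a M i x := by
  obtain ⟨f, rfl⟩ := (Abelian.Ext.mk₀_bijective _ _).2 x
  rw [extTransition_apply, Abelian.Ext.mk₀_comp_mk₀]
  apply Subtype.ext
  rw [coe_evalOne_mk₀, coe_evalOne_mk₀]
  rfl

lemma evalOne_injective (M : ModuleCat.{u} R) (k : ℕ) : Function.Injective (evalOne a M k) := by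
  intro x y hxy
  obtain ⟨f, rfl⟩ := (Abelian.Ext.mk₀_bijective _ _).2 x
  obtain ⟨g, rfl⟩ := (Abelian.Ext.mk₀_bijective _ _).2 y
  have h := congrArg Subtype.val hxy
  rw [coe_evalOne_mk₀, coe_evalOne_mk₀] at h
  congr 1
  exact ModuleCat.hom_ext (Submodule.linearMap_qext _ (LinearMap.ext_ring h))

lemma exists_evalOne_eq (M : ModuleCat.{u} R) (x : idealTorsion R a M) :
    ∃ k y, evalOne a M k y = x := by
  obtain ⟨k, hk⟩ := (mem_idealTorsion_iff a).1 x.2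
  refine ⟨k, Abelian.Ext.mk₀ (ModuleCat.ofHom
    (Submodule.liftQ _ (LinearMap.toSpanSingleton R M x.1) hk)), Subtype.ext ?_⟩
  rw [coe_evalOne_mk₀]
  exact one_smul R x.1

/-- Zeroth local cohomology is the torsion submodule. -/
def lcZeroEquiv (M : ModuleCat.{u} R) : LC a 0 M ≃ₗ[R] idealTorsion R a M :=
  directLimitEquiv (evalOne a M) (evalOne_extTransition a M) (exists_evalOne_eq a M)
    fun k x hx => ⟨k, le_rfl, by
      rw [evalOne_injective a M k (hx.trans (map_zero _).symm), map_zero]⟩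

lemma lcZeroEquiv_of (M : ModuleCat.{u} R) (k : ℕ) (x : Abelian.Ext (powQuot a k) M 0) :
    lcZeroEquiv a M (LC.of a 0 M k x) = evalOne a M k x :=
  Module.DirectLimit.lift_of _ (evalOne_extTransition a M) _

lemma lcZeroEquiv_lcPost {M N : ModuleCat.{u} R} (f : M ⟶ N) (x : LC a 0 M) :
    lcZeroEquiv a N (lcPost a (Abelian.Ext.mk₀ f) (add_zero 0) x) =
      torsionMap a f.hom (lcZeroEquiv a M x) := by
  obtain ⟨k, x, rfl⟩ := Module.DirectLimit.exists_of x
  obtain ⟨g, rfl⟩ := (Abelian.Ext.mk₀_bijective _ _).2 x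
  rw [lcPost_of, lcZeroEquiv_of, lcZeroEquiv_of, Abelian.Ext.mk₀_comp_mk₀]
  apply Subtype.ext
  rw [coe_torsionMap, coe_evalOne_mk₀, coe_evalOne_mk₀]
  rfl

variable {S : ShortComplex (ModuleCat.{u} R)} (hS : S.ShortExact)

/-- The connecting homomorphism on local cohomology. -/
abbrev lcδ (n : ℕ) : LC a n S.X₃ →ₗ[R] LC a (n + 1) S.X₁ := lcPost a hS.extClass rfl

/-- The map induced on local cohomology. -/
abbrev lcMap {M N : ModuleCat.{u} R} (f : M ⟶ N) (n : ℕ) : LC a n M →ₗ[R] LC a n N :=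
  lcPost a (Abelian.Ext.mk₀ f) (add_zero n)

lemma lcMap_exact_lcδ (n : ℕ) : Function.Exact (lcMap a S.g n) (lcδ a hS n) :=
  lcPost_exact a _ _ _ _ (fun _ x hx => Abelian.Ext.covariant_sequence_exact₃ _ hS x rfl hx)
    hS.comp_extClass

lemma lcδ_exact_lcMap (n : ℕ) : Function.Exact (lcδ a hS n) (lcMap a S.f (n + 1)) :=
  lcPost_exact a _ _ _ _ (fun _ x hx => Abelian.Ext.covariant_sequence_exact₁ _ hS x hx rfl)
    hS.extClass_comp

lemma lcδ_surjective (n : ℕ) [Subsingleton (LC a (n + 1) S.X₂)] :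
    Function.Surjective (lcδ a hS n) := fun x =>
  (lcδ_exact_lcMap a hS n x).1 (Subsingleton.elim _ _)

/-- The dimension shift in local cohomology along an acyclic middle term. -/
def lcShiftEquiv (n : ℕ) [Subsingleton (LC a n S.X₂)] [Subsingleton (LC a (n + 1) S.X₂)] :
    LC a n S.X₃ ≃ₗ[R] LC a (n + 1) S.X₁ :=
  LinearEquiv.ofBijective (lcδ a hS n) ⟨by
    rw [← LinearMap.ker_eq_bot, LinearMap.ker_eq_bot']
    intro x hx
    obtain ⟨y, rfl⟩ := (lcMap_exact_lcδ a hS n x).1 hx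
    rw [Subsingleton.elim y 0, map_zero], lcδ_surjective a hS n⟩

/-- First local cohomology as the cokernel of the map on torsion submodules. -/
def lcOneEquiv [Subsingleton (LC a 1 S.X₂)] :
    (idealTorsion R a S.X₃ ⧸ LinearMap.range (torsionMap a S.g.hom)) ≃ₗ[R] LC a 1 S.X₁ :=
  (Submodule.Quotient.equiv _ _ (lcZeroEquiv a S.X₃).symm (by
    rw [LinearMap.exact_iff.1 (lcMap_exact_lcδ a hS 0)]
    ext x
    rw [Submodule.mem_map]
    constructor
    · rintro ⟨_, ⟨y, rfl⟩, rfl⟩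
      refine ⟨(lcZeroEquiv a S.X₂).symm y, ?_⟩
      rw [LinearEquiv.coe_coe, LinearEquiv.eq_symm_apply, lcZeroEquiv_lcPost,
        LinearEquiv.apply_symm_apply]
    · rintro ⟨y, rfl⟩
      exact ⟨_, ⟨lcZeroEquiv a S.X₂ y, (lcZeroEquiv_lcPost a S.g y).symm⟩,
        LinearEquiv.symm_apply_apply _ _⟩)).trans
    ((lcδ a hS 0).quotKerEquivOfSurjective (lcδ_surjective a hS 0))

end LongExactSequence

section Acyclic

variable {R : Type u} [CommRing R] (a : Ideal R)

/-- Isomorphic modules have isomorphic local cohomology. -/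
def lcCongr {M N : ModuleCat.{u} R} (e : M ≃ₗ[R] N) (n : ℕ) : LC a n M ≃ₗ[R] LC a n N :=
  (lcEquiv a n M).trans (((localCohomology a n).mapIso
    (LinearEquiv.toModuleIso (X₁ := M) (X₂ := N) e)).toLinearEquiv.trans (lcEquiv a n N).symm)

/-- The short complex attached to an injection of modules. -/
abbrev cokernelComplex {M X : ModuleCat.{u} R} (f : M →ₗ[R] X) : ShortComplex (ModuleCat.{u} R) :=
  ModuleCat.shortComplexOfCompEqZero f (LinearMap.range f).mkQ (LinearMap.range_mkQ_comp f)

lemma shortExact_cokernelComplex {M X : ModuleCat.{u} R} {f : M →ₗ[R] X}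
    (hf : Function.Injective f) : (cokernelComplex f).ShortExact :=
  ModuleCat.shortComplex_shortExact _ (LinearMap.exact_map_mkQ_range f) hf
    (Submodule.mkQ_surjective _)

/-- If `f` is injective with cokernel `g`, and `g` is surjective on torsion, then the torsion of
the cokernel is the cokernel on torsion. -/
def torsionQuotEquiv {M N X : Type u} [AddCommGroup M] [Module R M] [AddCommGroup N] [Module R N]
    [AddCommGroup X] [Module R X] {f : M →ₗ[R] X} {g : X →ₗ[R] N} (hf : Function.Injective f)
    (h : Function.Exact f g) (hg : Function.Surjective (torsionMap a g)) :
    (idealTorsion R a X ⧸ LinearMap.range (torsionMap a f)) ≃ₗ[R] idealTorsion R a N :=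
  (Submodule.quotEquivOfEq _ _ (LinearMap.exact_iff.1 (torsionMap_exact a hf h)).symm).trans
    ((torsionMap a g).quotKerEquivOfSurjective hg)

lemma torsionMap_surjective {S : ShortComplex (ModuleCat.{u} R)} (hS : S.ShortExact)
    [Subsingleton (LC a 1 S.X₂)] [Subsingleton (LC a 1 S.X₁)] :
    Function.Surjective (torsionMap a S.g.hom) := by
  have := (lcOneEquiv a hS).toEquiv.subsingleton
  exact LinearMap.range_eq_top.1 (Submodule.Quotient.subsingleton_iff.1 this)

/-- The short complex obtained by applying `Hom(-, I)` to the kernel of `p`. -/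
abbrev dualComplex {F D : Type u} [AddCommGroup F] [Module R F] [AddCommGroup D] [Module R D]
    (p : F →ₗ[R] D) (I : Type u) [AddCommGroup I] [Module R I] : ShortComplex (ModuleCat.{u} R) :=
  ModuleCat.shortComplexOfCompEqZero (LinearMap.lcomp R I p)
    (LinearMap.lcomp R I (LinearMap.ker p).subtype) (by ext φ x; simp)

lemma shortExact_dualComplex {F D : Type u} [AddCommGroup F] [Module R F] [AddCommGroup D]
    [Module R D] {p : F →ₗ[R] D} (hp : Function.Surjective p) (I : Type u) [AddCommGroup I]
    [Module R I] [Module.Injective R I] : (dualComplex p I).ShortExact := by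
  refine ModuleCat.shortComplex_shortExact _ (fun φ => ⟨fun h => ?_, ?_⟩)
    (LinearMap.lcomp_injective_of_surjective p hp) fun φ => ?_
  · obtain ⟨v, hv⟩ := exists_comp_eq_of_ker_le p φ fun x hx => LinearMap.congr_fun h ⟨x, hx⟩
    exact ⟨v, hv⟩
  · rintro ⟨ψ, rfl⟩
    refine LinearMap.ext fun x => ?_
    change ψ (p x) = 0
    rw [LinearMap.mem_ker.1 x.2, map_zero]
  · obtain ⟨v, hv⟩ := Module.Injective.out (LinearMap.ker p).subtype
      (LinearMap.ker p).injective_subtype φ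
    exact ⟨v, LinearMap.ext hv⟩

lemma torsionMap_lcomp_subtype_surjective [IsNoetherianRing R] {F : Type u} [AddCommGroup F]
    [Module R F] [Module.Finite R F] (K : Submodule R F) (I : Type u) [AddCommGroup I]
    [Module R I] [Module.Injective R I] :
    Function.Surjective (torsionMap a (LinearMap.lcomp R I K.subtype)) := by
  intro φ
  obtain ⟨v, hv⟩ := Module.Injective.out K.subtype K.injective_subtype
    (torsionLinearMapEquiv a φ)
  refine ⟨(torsionLinearMapEquiv a).symm v, Subtype.ext (LinearMap.ext fun x => ?_)⟩
  exact congrArg Subtype.val (hv x)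

lemma subsingleton_LC_linearMap [IsNoetherianRing R] (I : Type u) [AddCommGroup I] [Module R I]
    [Module.Injective R I] (i : ℕ) (D : Type u) [AddCommGroup D] [Module R D]
    [Module.Finite R D] : Subsingleton (LC a (i + 1) (ModuleCat.of R (D →ₗ[R] I))) := by
  induction i generalizing D with
  | zero =>
    obtain ⟨m, p, hp⟩ := Module.Finite.exists_fin' R D
    have h1 : Subsingleton (LC a 1 (dualComplex p I).X₂) := subsingleton_LC_of_injective a _ 0
    have h2 := LinearMap.range_eq_top.2
      (torsionMap_lcomp_subtype_surjective a (LinearMap.ker p) I)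
    have h3 := Submodule.Quotient.subsingleton_iff.2 h2
    exact (lcOneEquiv a (shortExact_dualComplex hp I)).symm.toEquiv.subsingleton
  | succ i ih =>
    obtain ⟨m, p, hp⟩ := Module.Finite.exists_fin' R D
    have h1 : Subsingleton (LC a (i + 1) (dualComplex p I).X₂) :=
      subsingleton_LC_of_injective a _ i
    have h2 : Subsingleton (LC a (i + 1 + 1) (dualComplex p I).X₂) :=
      subsingleton_LC_of_injective a _ (i + 1)
    have h3 : Subsingleton (LC a (i + 1) (dualComplex p I).X₃) := ih (LinearMap.ker p)
    exact (lcShiftEquiv a (shortExact_dualComplex hp I) (i + 1)).symm.toEquiv.subsingleton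

lemma subsingleton_LC_of_isCInjective [IsNoetherianRing R] {C M : ModuleCat.{u} R}
    [Module.Finite R C] (h : IsCInjective R C M) (i : ℕ) : Subsingleton (LC a (i + 1) M) := by
  obtain ⟨I, hI, ⟨e⟩⟩ := h
  have := subsingleton_LC_linearMap a I i C
  exact (lcCongr a (N := ModuleCat.of R (C →ₗ[R] I)) e (i + 1)).toEquiv.subsingleton

end Acyclic

section Coresolution

variable {R : Type u} [CommRing R] {C : ModuleCat.{u} R}

lemma hasCoresDimLE_of_subsingleton (P : ModuleCat.{u} R → Prop) (d : ℕ) (M : ModuleCat.{u} R)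
    [h : Subsingleton M] : HasCoresDimLE R P d M := by
  cases d <;> exact Or.inl h

lemma hasCoresDimLE_congr {d : ℕ} {M N : ModuleCat.{u} R} (e : M ≃ₗ[R] N)
    (h : HasCoresDimLE R (IsCInjective R C) d M) : HasCoresDimLE R (IsCInjective R C) d N := by
  induction d generalizing M N with
  | zero =>
    exact h.imp (fun (_ : Subsingleton M) => e.symm.toEquiv.subsingleton) (isCInjective_congr e)
  | succ d ih =>
    refine h.imp (fun (_ : Subsingleton M) => e.symm.toEquiv.subsingleton) ?_
    rintro ⟨X, f, hX, hf, hq⟩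
    refine ⟨X, f ∘ₗ e.symm.toLinearMap, hX, hf.comp e.symm.injective, ih ?_ hq⟩
    exact Submodule.quotEquivOfEq _ _ (LinearEquiv.range_comp e.symm f).symm

lemma hasCoresDimLE_quotient [IsNoetherianRing R] [Module.Finite R C]
    (hC : Function.Bijective (LinearMap.lsmul R C)) {d : ℕ} {J N : ModuleCat.{u} R}
    (hJ : IsCInjective R C J) (i : J →ₗ[R] N) (hi : Function.Injective i)
    (h : HasCoresDimLE R (IsCInjective R C) d N) :
    HasCoresDimLE R (IsCInjective R C) d (ModuleCat.of R (N ⧸ LinearMap.range i)) := by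
  have hsub : Subsingleton N → Subsingleton (N ⧸ LinearMap.range i) := fun _ =>
    (Submodule.mkQ_surjective _).subsingleton
  cases d with
  | zero => exact h.imp hsub fun h => isCInjective_quotient hC hJ h i hi
  | succ d =>
    refine h.imp hsub ?_
    rintro ⟨Y, f, hY, hf, hq⟩
    have hle : LinearMap.range (f ∘ₗ i) ≤ LinearMap.range f := LinearMap.range_comp_le_range i f
    have hcomap : LinearMap.range i = (LinearMap.range (f ∘ₗ i)).comap f := by
      rw [LinearMap.range_comp, Submodule.comap_map_eq_of_injective hf]
    refine ⟨ModuleCat.of R (Y ⧸ LinearMap.range (f ∘ₗ i)), Submodule.mapQ _ _ f hcomap.le,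
      isCInjective_quotient hC hJ hY _ (hf.comp hi), ?_, hasCoresDimLE_congr ?_ hq⟩
    · rw [← LinearMap.ker_eq_bot, Submodule.ker_mapQ, ← hcomap, Submodule.mkQ_map_self]
    · refine (Submodule.quotientQuotientEquivQuotient _ _ hle).symm.trans
        (Submodule.quotEquivOfEq _ _ ?_)
      rw [Submodule.range_mapQ]

variable [IsNoetherianRing R] [Module.Finite R C] (a : Ideal R)

lemma hasCoresDimLE_idealTorsion {d : ℕ} {M : ModuleCat.{u} R}
    (h : HasCoresDimLE R (IsCInjective R C) d M) (hM : ∀ i, Subsingleton (LC a (i + 1) M)) :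
    HasCoresDimLE R (IsCInjective R C) d (ModuleCat.of R (idealTorsion R a M)) := by
  induction d generalizing M with
  | zero =>
    exact h.imp (fun (_ : Subsingleton M) => inferInstanceAs (Subsingleton (idealTorsion R a M)))
      (isCInjective_idealTorsion a)
  | succ d ih =>
    refine h.imp
      (fun (_ : Subsingleton M) => inferInstanceAs (Subsingleton (idealTorsion R a M))) ?_
    rintro ⟨X, f, hX, hf, hq⟩
    have hS := shortExact_cokernelComplex hf
    have hXa := subsingleton_LC_of_isCInjective a hX
    refine ⟨_, torsionMap a f, isCInjective_idealTorsion a hX, torsionMap_injective a hf,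
      hasCoresDimLE_congr (torsionQuotEquiv a hf (LinearMap.exact_map_mkQ_range f) ?_).symm
        (ih hq fun i => ?_)⟩
    · have h1 : Subsingleton (LC a 1 (cokernelComplex f).X₁) := hM 0
      have h2 : Subsingleton (LC a 1 (cokernelComplex f).X₂) := hXa 0
      exact torsionMap_surjective a hS
    · have h1 : Subsingleton (LC a (i + 1) (cokernelComplex f).X₂) := hXa i
      have h2 : Subsingleton (LC a (i + 1 + 1) (cokernelComplex f).X₂) := hXa (i + 1)
      have h3 : Subsingleton (LC a (i + 1 + 1) (cokernelComplex f).X₁) := hM (i + 1)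
      exact (lcShiftEquiv a hS (i + 1)).toEquiv.subsingleton

theorem hasCoresDimLE_LC (hC : Function.Bijective (LinearMap.lsmul R C)) {m d : ℕ}
    {M : ModuleCat.{u} R} (h : HasCoresDimLE R (IsCInjective R C) d M)
    (hM : ∀ i, i ≠ m → Subsingleton (LC a (i + 1) M))
    (hΓ : IsCInjective R C (ModuleCat.of R (idealTorsion R a M))) :
    HasCoresDimLE R (IsCInjective R C) (d - (m + 1)) (ModuleCat.of R (LC a (m + 1) M)) := by
  induction m generalizing d M with
  | zero =>
    cases d with
    | zero =>
      have : Subsingleton (LC a 1 M) := h.elim (fun _ => subsingleton_LC_of_subsingleton a M 1)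
        fun h => subsingleton_LC_of_isCInjective a h 0
      exact hasCoresDimLE_of_subsingleton _ _ _
    | succ d =>
      obtain h0 | ⟨X, f, hX, hf, hq⟩ := h
      · have := subsingleton_LC_of_subsingleton a M 1
        exact hasCoresDimLE_of_subsingleton _ _ _
      have hS := shortExact_cokernelComplex hf
      have hXa (i : ℕ) : Subsingleton (LC a (i + 1) (cokernelComplex f).X₂) :=
        subsingleton_LC_of_isCInjective a hX i
      have hNa (i : ℕ) : Subsingleton (LC a (i + 1) (cokernelComplex f).X₃) := by
        have h1 := hXa i
        have h2 := hXa (i + 1)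
        have h3 : Subsingleton (LC a (i + 1 + 1) (cokernelComplex f).X₁) := hM (i + 1) (by lia)
        exact (lcShiftEquiv a hS (i + 1)).toEquiv.subsingleton
      have hJ := isCInjective_quotient hC hΓ (isCInjective_idealTorsion a hX) (torsionMap a f)
        (torsionMap_injective a hf)
      have hker := LinearMap.exact_iff.1
        (torsionMap_exact a hf (LinearMap.exact_map_mkQ_range f))
      have h1 := hXa 0
      refine hasCoresDimLE_congr ((Submodule.quotEquivOfEq _ _ ?_).trans (lcOneEquiv a hS))
        (hasCoresDimLE_quotient hC hJ ((LinearMap.range (torsionMap a f)).liftQ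
          (torsionMap a (LinearMap.range f).mkQ) hker.ge)
          (LinearMap.ker_eq_bot.1 (Submodule.ker_liftQ_eq_bot _ _ _ hker.le))
          (hasCoresDimLE_idealTorsion a hq hNa))
      exact Submodule.range_liftQ _ _ _
  | succ m ih =>
    cases d with
    | zero =>
      have : Subsingleton (LC a (m + 1 + 1) M) :=
        h.elim (fun _ => subsingleton_LC_of_subsingleton a M _)
          fun h => subsingleton_LC_of_isCInjective a h _
      exact hasCoresDimLE_of_subsingleton _ _ _
    | succ d =>
      obtain h0 | ⟨X, f, hX, hf, hq⟩ := h
      · have := subsingleton_LC_of_subsingleton a M (m + 1 + 1)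
        exact hasCoresDimLE_of_subsingleton _ _ _
      have hS := shortExact_cokernelComplex hf
      have hXa (i : ℕ) : Subsingleton (LC a (i + 1) (cokernelComplex f).X₂) :=
        subsingleton_LC_of_isCInjective a hX i
      have h0 := hXa 0
      have h1 := hXa m
      have h2 := hXa (m + 1)
      have h3 : Subsingleton (LC a 1 (cokernelComplex f).X₁) := hM 0 (by lia)
      rw [Nat.add_sub_add_right]
      refine hasCoresDimLE_congr (lcShiftEquiv a hS (m + 1)) (ih hq (fun i hi => ?_)
        (isCInjective_congr (torsionQuotEquiv a hf (LinearMap.exact_map_mkQ_range f)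
          (torsionMap_surjective a hS)) (isCInjective_quotient hC hΓ
            (isCInjective_idealTorsion a hX) (torsionMap a f) (torsionMap_injective a hf))))
      have h4 := hXa i
      have h5 := hXa (i + 1)
      have h6 : Subsingleton (LC a (i + 1 + 1) (cokernelComplex f).X₁) := hM (i + 1) (by lia)
      exact (lcShiftEquiv a hS (i + 1)).toEquiv.subsingleton

end Coresolution

end RelativeCM

end

noncomputable section
open CategoryTheory TensorProduct

/-- If `M` is relative Cohen-Macaulay with respect to `a` with
`ht_M(a) = n`, then `C-id_R H_a^n(M) ≤ C-id_R M - n`. -/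
theorem stmt_6 (R : Type u) [CommRing R] [IsNoetherianRing R] [IsLocalRing R]
    (C : ModuleCat.{u} R) (hC : IsSemidualizing R C)
    (a : Ideal R) (M : ModuleCat.{u} R) [Module.Finite R ↥M]
    (n : ℕ) (hRCM : IsRelativeCM R a M)
    (hht : heightWRT R a ↥M = ((n : ℕ∞) : WithBot ℕ∞)) :
    cinjDim R C ((localCohomology a n).obj M) ≤ cinjDim R C M - (n : ℕ∞) := by
  obtain ⟨hfin, hbij, -⟩ := hC
  have hle (d : ℕ) (N : ModuleCat.{u} R) (h : HasCoresDimLE R (IsCInjective R C) d N) :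
      cinjDim R C N ≤ d := sInf_le ⟨d, rfl, h⟩
  by_cases hn : Subsingleton ((localCohomology a n).obj M)
  · exact (hle 0 _ (Or.inl hn)).trans zero_le
  rw [not_subsingleton_iff_nontrivial] at hn
  have hM (i : ℕ) (hi : i ≠ n) : Subsingleton (RelativeCM.LC a i M) := by
    have : Subsingleton ((localCohomology a i).obj M) :=
      not_nontrivial_iff_subsingleton.1 fun h => hi (hRCM.unique h hn)
    exact (RelativeCM.lcEquiv a i M).toEquiv.subsingleton
  by_cases hd : {d : ℕ∞ | ∃ n : ℕ, d = n ∧ HasCoresDimLE R (IsCInjective R C) n M}.Nonempty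
  · obtain ⟨d, hd, h⟩ := csInf_mem hd
    have hd' : cinjDim R C M = d := hd
    rw [hd', ← ENat.natCast_sub]
    refine hle _ _ (RelativeCM.hasCoresDimLE_congr
      (M := ModuleCat.of R (RelativeCM.LC a n M)) (RelativeCM.lcEquiv a n M) ?_)
    cases n with
    | zero =>
      exact RelativeCM.hasCoresDimLE_congr (M := ModuleCat.of R (idealTorsion R a M))
        (N := ModuleCat.of R (RelativeCM.LC a 0 M)) (RelativeCM.lcZeroEquiv a M).symm
        (RelativeCM.hasCoresDimLE_idealTorsion a h fun i => hM _ (by lia))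
    | succ m =>
      have h0 := hM 0 (by lia)
      have : Subsingleton (ModuleCat.of R (idealTorsion R a M)) :=
        (RelativeCM.lcZeroEquiv a M).symm.toEquiv.subsingleton
      exact RelativeCM.hasCoresDimLE_LC a hbij h (fun i hi => hM _ (by lia))
        (RelativeCM.isCInjective_of_subsingleton C _)
  · have : cinjDim R C M = ⊤ := by
      rw [cinjDim, coresDim, Set.not_nonempty_iff_eq_empty.1 hd, sInf_empty]
    rw [this, ENat.top_sub_natCast]
    exact le_top

end
end
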